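/- arXiv:2001.00310 — 3 statements merged into one kernel-verified Lean document; each statement's English description precedes it below -/
import Mathlib

section
/- Let k be a field. Every k-algebra automorphism of the polynomial algebra k[x₁,x₂] in two variables is tame, i.e., Aut(k[x₁,x₂]) = T(k[x₁,x₂]). -/
open MvPolynomial

/-- The group of `k`-algebra automorphisms of `k[x₁,x₂]`. -/
abbrev PolyAut (Φ : Type*) [CommRing Φ] :=
  MvPolynomial (Fin 2) Φ ≃ₐ[Φ] MvPolynomial (Fin 2) Φ

/-- An automorphism of `Φ[x₁,x₂]` is elementary if it has the form
`(x₁ ↦ αx₁ + f(x₂), x₂ ↦ x₂)` or `(x₁ ↦ x₁, x₂ ↦ βx₂ + g(x₁))` with `α, β` units. -/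
def IsElementary {Φ : Type*} [CommRing Φ] (σ : PolyAut Φ) : Prop :=
  (∃ (α : Φˣ) (f : MvPolynomial (Fin 2) Φ), f ∈ Algebra.adjoin Φ {(X 1 : MvPolynomial (Fin 2) Φ)} ∧
      σ (X 0) = C (α : Φ) * X 0 + f ∧ σ (X 1) = X 1) ∨
  (∃ (β : Φˣ) (g : MvPolynomial (Fin 2) Φ), g ∈ Algebra.adjoin Φ {(X 0 : MvPolynomial (Fin 2) Φ)} ∧
      σ (X 0) = X 0 ∧ σ (X 1) = C (β : Φ) * X 1 + g)

/-- The subgroup of tame automorphisms of `Φ[x₁,x₂]`, generated by the elementary ones. -/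
noncomputable def TameSubgroup (Φ : Type*) [CommRing Φ] : Subgroup (PolyAut Φ) :=
  Subgroup.closure {σ | IsElementary σ}

/-! The proof follows a one-parameter subgroup conjugate to translation: it degenerates to a
homogeneous family fixing the top form of `φ (X 0)`, which forces that form to be divisible by
a binomial linear in one variable, so that an elementary automorphism lowers the degree. -/

namespace JungVanDerKulk

variable {k : Type*} [Field k] {σ τ : Type*}

/-- Polynomials all of whose monomials have weight in `S`. -/
noncomputable def weightIn (w : σ → ℚ) (S : Set ℚ) : Submodule k (MvPolynomial σ k) :=
  restrictSupport k (Finsupp.weight w ⁻¹' S)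

theorem mem_weightIn {w : σ → ℚ} {S : Set ℚ} {P : MvPolynomial σ k} :
    P ∈ weightIn w S ↔ ∀ m, coeff m P ≠ 0 → Finsupp.weight w m ∈ S := by
  simp [weightIn, mem_restrictSupport_iff, Set.subset_def]

theorem weightIn_mono {w : σ → ℚ} {S T : Set ℚ} (h : S ⊆ T) :
    (weightIn w S : Submodule k _) ≤ weightIn w T :=
  restrictSupport_mono k (Set.preimage_mono h)

theorem mul_mem_weightIn {w : σ → ℚ} {S T U : Set ℚ} {P Q : MvPolynomial σ k}
    (hP : P ∈ weightIn w S) (hQ : Q ∈ weightIn w T) (h : ∀ s ∈ S, ∀ t ∈ T, s + t ∈ U) :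
    P * Q ∈ weightIn w U := by
  rw [weightIn, mem_restrictSupport_iff] at *
  classical
  refine fun m hm ↦ ?_
  obtain ⟨a, ha, b, hb, rfl⟩ := Finset.mem_add.mp (support_mul P Q hm)
  simpa using h _ (hP ha) _ (hQ hb)

theorem eq_zero_of_mem_weightIn {w : σ → ℚ} {S T : Set ℚ} {P : MvPolynomial σ k}
    (hS : P ∈ weightIn w S) (hT : P ∈ weightIn w T) (h : Disjoint S T) : P = 0 := by
  ext m
  by_contra hm
  exact Set.disjoint_left.mp h (mem_weightIn.mp hS m hm) (mem_weightIn.mp hT m hm)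

theorem weightedHomogeneousComponent_mem_weightIn (w : σ → ℚ) (d : ℚ) (P : MvPolynomial σ k) :
    weightedHomogeneousComponent w d P ∈ weightIn w {d} :=
  mem_weightIn.mpr fun _ hm ↦ weightedHomogeneousComponent_isWeightedHomogeneous d P hm

theorem sub_weightedHomogeneousComponent_mem_weightIn {w : σ → ℚ} {d : ℚ} {P : MvPolynomial σ k}
    (hP : P ∈ weightIn w (Set.Iic d)) :
    P - weightedHomogeneousComponent w d P ∈ weightIn w (Set.Iio d) := by
  classical
  refine mem_weightIn.mpr fun m hm ↦ ?_
  rw [coeff_sub, coeff_weightedHomogeneousComponent] at hm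
  split_ifs at hm with h
  · simp at hm
  · exact lt_of_le_of_ne (mem_weightIn.mp hP m (by simpa using hm)) h

/-- `Q` is homogeneous of weight `d`, and `P` agrees with `Q` up to terms of smaller weight. -/
def HasTopForm (w : σ → ℚ) (d : ℚ) (P Q : MvPolynomial σ k) : Prop :=
  Q ∈ weightIn w {d} ∧ P - Q ∈ weightIn w (Set.Iio d)

namespace HasTopForm

variable {w : σ → ℚ} {d e : ℚ} {P Q P' Q' : MvPolynomial σ k}

theorem mem_Iic (h : HasTopForm w d P Q) : P ∈ weightIn w (Set.Iic d) := by
  rw [← sub_add_cancel P Q]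
  exact add_mem (weightIn_mono Set.Iio_subset_Iic_self h.2)
    (weightIn_mono (by simp) h.1)

theorem mul (h : HasTopForm w d P Q) (h' : HasTopForm w e P' Q') :
    HasTopForm w (d + e) (P * P') (Q * Q') := by
  refine ⟨mul_mem_weightIn h.1 h'.1 (by rintro _ rfl _ rfl; rfl), ?_⟩
  rw [show P * P' - Q * Q' = (P - Q) * P' + Q * (P' - Q') by ring]
  exact add_mem
    (mul_mem_weightIn h.2 h'.mem_Iic fun s hs t ht ↦ Set.mem_Iio.mpr (add_lt_add_of_lt_of_le hs ht))
    (mul_mem_weightIn h.1 h'.2 fun s hs t ht ↦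
      Set.mem_Iio.mpr (add_lt_add_of_le_of_lt (le_of_eq hs) ht))

theorem const (w : σ → ℚ) (c : k) : HasTopForm w 0 (C c) (C c) := by
  refine ⟨mem_weightIn.mpr fun m hm ↦ ?_, by simp⟩
  exact isWeightedHomogeneous_C w c hm

theorem pow (h : HasTopForm w d P Q) (n : ℕ) : HasTopForm w (n • d) (P ^ n) (Q ^ n) := by
  induction n with
  | zero => simpa using const (k := k) w 1
  | succ n ih => simpa only [pow_succ, succ_nsmul] using ih.mul h

theorem prod {ι : Type*} (s : Finset ι) {d : ι → ℚ} {P Q : ι → MvPolynomial σ k}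
    (h : ∀ i ∈ s, HasTopForm w (d i) (P i) (Q i)) :
    HasTopForm w (∑ i ∈ s, d i) (∏ i ∈ s, P i) (∏ i ∈ s, Q i) := by
  classical
  induction s using Finset.induction_on with
  | empty => simpa using const (k := k) w 1
  | insert i s hi ih =>
    simp only [Finset.sum_insert hi, Finset.prod_insert hi]
    exact (h i (by simp)).mul (ih fun j hj ↦ h j (by simp [hj]))

theorem sum {ι : Type*} (s : Finset ι) {P Q : ι → MvPolynomial σ k}
    (h : ∀ i ∈ s, HasTopForm w d (P i) (Q i)) :
    HasTopForm w d (∑ i ∈ s, P i) (∑ i ∈ s, Q i) := by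
  refine ⟨sum_mem fun i hi ↦ (h i hi).1, ?_⟩
  rw [← Finset.sum_sub_distrib]
  exact sum_mem fun i hi ↦ (h i hi).2

end HasTopForm

theorem hasTopForm_X (w : σ → ℚ) (i : σ) :
    HasTopForm w (w i) (X i : MvPolynomial σ k) (X i) :=
  ⟨mem_weightIn.mpr fun _ hm ↦ isWeightedHomogeneous_X k w i hm, by simp⟩

/-- Passing to top forms commutes with algebra homomorphisms. -/
theorem hasTopForm_map {w : σ → ℚ} {w' : τ → ℚ} (f g : MvPolynomial σ k →ₐ[k] MvPolynomial τ k)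
    (hfg : ∀ i, HasTopForm w' (w i) (f (X i)) (g (X i)))
    {d : ℚ} {P Q : MvPolynomial σ k} (h : HasTopForm w d P Q) :
    HasTopForm w' d (f P) (g Q) := by
  have key (m : σ →₀ ℕ) (c : k) :
      HasTopForm w' (Finsupp.weight w m) (f (monomial m c)) (g (monomial m c)) := by
    rw [monomial_eq, map_mul, map_mul, Finsupp.prod, map_prod, map_prod,
      ← zero_add (Finsupp.weight w m),
      Finsupp.weight_apply, Finsupp.sum]
    simp only [map_pow, ← MvPolynomial.algebraMap_eq, AlgHom.commutes]
    exact (HasTopForm.const w' c).mul (HasTopForm.prod _ fun i _ ↦ (hfg i).pow _)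
  have hQ : HasTopForm w' d (f Q) (g Q) := by
    rw [Q.as_sum, map_sum, map_sum]
    refine HasTopForm.sum _ fun m hm ↦ ?_
    have := key m (coeff m Q)
    rwa [mem_weightIn.mp h.1 m (mem_support_iff.mp hm)] at this
  refine ⟨hQ.1, ?_⟩
  rw [show f P - g Q = f (P - Q) + (f Q - g Q) by rw [map_sub]; ring]
  refine add_mem ?_ hQ.2
  rw [(P - Q).as_sum, map_sum]
  refine sum_mem fun m hm ↦ weightIn_mono (fun r hr ↦ ?_) (key m (coeff m (P - Q))).mem_Iic
  exact lt_of_le_of_lt (Set.mem_Iic.mp hr)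
    (Set.mem_Iio.mp (mem_weightIn.mp h.2 m (mem_support_iff.mp hm)))

theorem HasTopForm.unique {w : σ → ℚ} {d : ℚ} {P Q Q' : MvPolynomial σ k}
    (h : HasTopForm w d P Q) (h' : HasTopForm w d P Q') : Q = Q' := by
  refine sub_eq_zero.mp (eq_zero_of_mem_weightIn (S := {d}) (T := Set.Iio d) (w := w)
    (sub_mem h.1 h'.1) ?_ (by simp))
  rw [show Q - Q' = (P - Q') - (P - Q) by ring]
  exact sub_mem h'.2 h.2

theorem hasTopForm_weightedHomogeneousComponent {w : σ → ℚ} {d : ℚ} {P : MvPolynomial σ k}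
    (hP : P ∈ weightIn w (Set.Iic d)) :
    HasTopForm w d P (weightedHomogeneousComponent w d P) :=
  ⟨weightedHomogeneousComponent_mem_weightIn w d P,
    sub_weightedHomogeneousComponent_mem_weightIn hP⟩

theorem weight_cons {n : ℕ} (w : Fin n → ℚ) (r : ℚ) (i : ℕ) (m : Fin n →₀ ℕ) :
    Finsupp.weight (Fin.cons r w : Fin (n + 1) → ℚ) (m.cons i) = i * r + Finsupp.weight w m := by
  simp [Finsupp.weight_eq_sum, Fin.sum_univ_succ]

/-- The one-parameter family of endomorphisms obtained by conjugating
`(x₁ ↦ x₁, x₂ ↦ x₂ + t)` by `φ`. -/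
noncomputable def conjShift (φ : MvPolynomial (Fin 2) k ≃ₐ[k] MvPolynomial (Fin 2) k) :
    MvPolynomial (Fin 2) k →ₐ[k] Polynomial (MvPolynomial (Fin 2) k) :=
  (aeval ![Polynomial.C (φ (X 0)), Polynomial.C (φ (X 1)) + Polynomial.X]).comp
    (φ.symm : MvPolynomial (Fin 2) k →ₐ[k] MvPolynomial (Fin 2) k)

section conjShift

variable (φ : MvPolynomial (Fin 2) k ≃ₐ[k] MvPolynomial (Fin 2) k)

theorem conjShift_apply_zero :
    conjShift φ (φ (X 0)) = Polynomial.C (φ (X 0)) := by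
  simp [conjShift]

theorem conjShift_apply_one :
    conjShift φ (φ (X 1)) = Polynomial.C (φ (X 1)) + Polynomial.X := by
  simp [conjShift]

theorem coeff_zero_conjShift (f : MvPolynomial (Fin 2) k) :
    (conjShift φ f).coeff 0 = f := by
  have : ((Polynomial.aeval (0 : MvPolynomial (Fin 2) k)).restrictScalars k).comp (conjShift φ) =
      AlgHom.id k _ := by
    rw [← AlgHom.cancel_right (f := (φ : MvPolynomial (Fin 2) k →ₐ[k] _)) φ.surjective]
    ext i : 1
    fin_cases i <;> simp [conjShift]
  simpa [Polynomial.coeff_zero_eq_eval_zero] using DFunLike.congr_fun this f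

theorem exists_conjShift_ne : ∃ i, conjShift φ (X i) ≠ Polynomial.C (X i) := by
  by_contra! h
  have : conjShift φ = Polynomial.CAlgHom := by
    ext i : 1
    simpa using h i
  have h1 := conjShift_apply_one φ
  simp [this] at h1

end conjShift

/-- The homogeneous family associated with `conjShift φ`: it fixes the top form of `φ (X 0)`. -/
theorem exists_homogeneous_family (φ : MvPolynomial (Fin 2) k ≃ₐ[k] MvPolynomial (Fin 2) k)
    (w : Fin 2 → ℚ) {d : ℚ} {Q : MvPolynomial (Fin 2) k} (hQ : HasTopForm w d (φ (X 0)) Q) :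
    ∃ Φ : MvPolynomial (Fin 2) k →ₐ[k] Polynomial (MvPolynomial (Fin 2) k),
      Φ Q = Polynomial.C Q ∧ (∀ f, (Φ f).coeff 0 = f) ∧ ∃ i, (Φ (X i)).natDegree ≠ 0 := by
  classical
  set E : MvPolynomial (Fin 2) k →ₐ[k] MvPolynomial (Fin 3) k :=
    ((finSuccEquiv k 2).symm : _ →ₐ[k] _).comp (conjShift φ) with hE
  have hcoeff (f : MvPolynomial (Fin 2) k) (n : ℕ) (m : Fin 2 →₀ ℕ) :
      coeff (m.cons n) (E f) = coeff m ((conjShift φ f).coeff n) := by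
    simp [hE, ← finSuccEquiv_coeff_coeff]
  let slopes : Finset ℚ := Finset.univ.biUnion fun i : Fin 2 ↦
    ((E (X i)).support.filter fun s ↦ s 0 ≠ 0).image
      fun s ↦ (Finsupp.weight w s.tail - w i) / s 0
  have hslopes : slopes.Nonempty := by
    obtain ⟨i, hi⟩ := exists_conjShift_ne φ
    obtain ⟨n, hn⟩ : ∃ n, (conjShift φ (X i)).coeff (n + 1) ≠ 0 := by
      by_contra! h
      refine hi (Polynomial.ext fun n ↦ ?_)
      cases n with
      | zero => simp [coeff_zero_conjShift]
      | succ n => simp [h]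
    obtain ⟨m, hm⟩ := MvPolynomial.ne_zero_iff.mp hn
    refine ⟨_, Finset.mem_biUnion.mpr ⟨i, Finset.mem_univ i, Finset.mem_image_of_mem _
      (Finset.mem_filter.mpr ⟨mem_support_iff.mpr ((hcoeff _ _ _).trans_ne hm), ?_⟩)⟩⟩
    simp
  set r := slopes.max' hslopes with hr
  have hle (i : Fin 2) (s : Fin 3 →₀ ℕ) (hs : coeff s (E (X i)) ≠ 0) (h0 : s 0 ≠ 0) :
      (Finsupp.weight w s.tail - w i) / s 0 ≤ r := by
    refine slopes.le_max' _ (Finset.mem_biUnion.mpr ⟨i, Finset.mem_univ i,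
      Finset.mem_image_of_mem (fun s : Fin 3 →₀ ℕ ↦ (Finsupp.weight w s.tail - w i) / s 0)
      (Finset.mem_filter.mpr ⟨mem_support_iff.mpr hs, h0⟩)⟩)
  obtain ⟨i₀, s₀, hs₀, hs₀0, hs₀r⟩ : ∃ (i : Fin 2) (s : Fin 3 →₀ ℕ), coeff s (E (X i)) ≠ 0 ∧
      s 0 ≠ 0 ∧ (Finsupp.weight w s.tail - w i) / s 0 = r := by
    obtain ⟨i, -, hi⟩ := Finset.mem_biUnion.mp (slopes.max'_mem hslopes)
    obtain ⟨s, hs, hsr⟩ := Finset.mem_image.mp hi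
    obtain ⟨hs, hs0⟩ := Finset.mem_filter.mp hs
    exact ⟨i, s, mem_support_iff.mp hs, hs0, hsr⟩
  set W : Fin 3 → ℚ := Fin.cons (-r) w with hW
  have hweight (s : Fin 3 →₀ ℕ) :
      Finsupp.weight W s = s 0 * -r + Finsupp.weight w s.tail := by
    conv_lhs => rw [← Finsupp.cons_tail s]
    rw [hW, weight_cons]
  have hEX (i : Fin 2) : E (X i) ∈ weightIn W (Set.Iic (w i)) := by
    refine mem_weightIn.mpr fun s hs ↦ ?_
    rw [hweight, Set.mem_Iic]
    by_cases h0 : s 0 = 0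
    · rw [← Finsupp.cons_tail s, h0, hcoeff, coeff_zero_conjShift] at hs
      rw [isWeightedHomogeneous_X k w i hs, h0]
      simp
    · have := hle i s hs h0
      rw [div_le_iff₀ (by positivity)] at this
      linarith
  let T (i : Fin 2) := weightedHomogeneousComponent W (w i) (E (X i))
  have hT : HasTopForm W d (E (φ (X 0))) (aeval T Q) :=
    hasTopForm_map E (aeval T)
      (fun i ↦ by simpa using hasTopForm_weightedHomogeneousComponent (hEX i)) hQ
  have hren : HasTopForm W d (rename Fin.succ (φ (X 0))) (rename Fin.succ Q) := by
    refine hasTopForm_map (rename Fin.succ) (rename Fin.succ) (fun i ↦ ?_) hQ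
    rw [rename_X]
    exact hasTopForm_X W i.succ
  have hfin (f : MvPolynomial (Fin 2) k) :
      finSuccEquiv k 2 (rename Fin.succ f) = Polynomial.C f := by
    have : ((finSuccEquiv k 2).toAlgHom.comp (rename Fin.succ)) = Polynomial.CAlgHom := by
      ext i : 1
      simp [finSuccEquiv_X_succ]
    simpa using DFunLike.congr_fun this f
  have hEφ : E (φ (X 0)) = rename Fin.succ (φ (X 0)) := by
    rw [← (finSuccEquiv k 2).injective.eq_iff, hfin]
    simp [hE, conjShift_apply_zero]
  rw [hEφ] at hT
  have hTc (i : Fin 2) (n : ℕ) (m : Fin 2 →₀ ℕ) :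
      coeff m ((finSuccEquiv k 2 (T i)).coeff n) =
        if Finsupp.weight W (m.cons n) = w i then coeff m ((conjShift φ (X i)).coeff n) else 0 := by
    rw [finSuccEquiv_coeff_coeff, coeff_weightedHomogeneousComponent, hcoeff]
  refine ⟨(finSuccEquiv k 2).toAlgHom.comp (aeval T), ?_, ?_, i₀, ?_⟩
  · exact (congrArg (finSuccEquiv k 2) (hT.unique hren)).trans (hfin Q)
  · have : (((Polynomial.aeval (0 : MvPolynomial (Fin 2) k)).restrictScalars k).comp
        ((finSuccEquiv k 2).toAlgHom.comp (aeval T))) = AlgHom.id k _ := by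
      ext i : 1
      suffices (finSuccEquiv k 2 (T i)).coeff 0 = X i by
        simpa [Polynomial.coeff_zero_eq_eval_zero] using this
      ext m
      rw [hTc, coeff_zero_conjShift, weight_cons]
      simp only [ite_eq_left_iff]
      intro h
      by_contra h'
      exact h (by simpa using isWeightedHomogeneous_X k w i (Ne.symm h'))
    intro f
    simpa [Polynomial.coeff_zero_eq_eval_zero] using DFunLike.congr_fun this f
  · intro h
    have h1 : (finSuccEquiv k 2 (T i₀)).coeff (s₀ 0) = 0 :=
      Polynomial.coeff_eq_zero_of_natDegree_lt
        (by simpa [h] using h.trans_lt (Nat.pos_of_ne_zero hs₀0))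
    have h2 := hTc i₀ (s₀ 0) s₀.tail
    rw [h1, Finsupp.cons_tail, if_pos, ← hcoeff, Finsupp.cons_tail] at h2
    · exact hs₀ (by simpa using h2.symm)
    · rw [hweight, ← hs₀r]
      field_simp
      ring

section Family

variable {Φ : MvPolynomial (Fin 2) k →ₐ[k] Polynomial (MvPolynomial (Fin 2) k)}
  {Q H : MvPolynomial (Fin 2) k}

theorem natDegree_map_eq_zero_of_dvd (hQ : Φ Q = Polynomial.C Q) (hQ0 : Q ≠ 0) (hH : H ∣ Q) :
    (Φ H).natDegree = 0 := by
  obtain ⟨R, rfl⟩ := hH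
  have h0 : Φ H * Φ R ≠ 0 := by rw [← map_mul, hQ]; simpa using hQ0
  have := congrArg Polynomial.natDegree hQ
  rw [map_mul, Polynomial.natDegree_mul (left_ne_zero_of_mul h0) (right_ne_zero_of_mul h0),
    Polynomial.natDegree_C] at this
  omega

theorem map_eq_C_of_dvd (hΦ : ∀ f, (Φ f).coeff 0 = f) (hQ : Φ Q = Polynomial.C Q) (hQ0 : Q ≠ 0)
    (hH : H ∣ Q) : Φ H = Polynomial.C H := by
  rw [Polynomial.eq_C_of_natDegree_eq_zero (natDegree_map_eq_zero_of_dvd hQ hQ0 hH), hΦ]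

theorem apply_eq_zero_of_X_dvd (hΦ : ∀ f, (Φ f).coeff 0 = f) (hne : ∃ i, (Φ (X i)).natDegree ≠ 0)
    (hQ : Φ Q = Polynomial.C Q) {i j : Fin 2} (hij : i ≠ j) (hi : X i ∣ Q)
    {m : Fin 2 →₀ ℕ} (hm : coeff m Q ≠ 0) : m j = 0 := by
  have hQ0 : Q ≠ 0 := MvPolynomial.ne_zero_iff.mpr ⟨m, hm⟩
  have hXi := map_eq_C_of_dvd hΦ hQ hQ0 hi
  have hor (l : Fin 2) : l = i ∨ l = j := by omega
  have hXj : (Φ (X j)).natDegree ≠ 0 := by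
    obtain ⟨l, hl⟩ := hne
    rcases hor l with rfl | rfl
    · simp [hXi] at hl
    · exact hl
  set P : Polynomial (MvPolynomial (Fin 2) k) :=
    aeval (fun l ↦ if l = i then Polynomial.C (X i) else Polynomial.X) Q with hP
  have hcomp : P.comp (Φ (X j)) = Φ Q := by
    have : ((Polynomial.aeval (Φ (X j))).restrictScalars k).comp
        (aeval (R := k) (fun l ↦ if l = i then Polynomial.C (X i : MvPolynomial (Fin 2) k)
          else Polynomial.X)) = Φ := by
      ext l : 1
      rcases hor l with rfl | rfl
      · simp [hXi]
      · simp [hij.symm]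
    exact DFunLike.congr_fun this Q
  have hdeg : P.natDegree = 0 := by
    have := congrArg Polynomial.natDegree hcomp
    rw [Polynomial.natDegree_comp, hQ, Polynomial.natDegree_C] at this
    exact (mul_eq_zero.mp this).resolve_right hXj
  have heval (r : MvPolynomial (Fin 2) k) :
      P.eval r = aeval (fun l ↦ if l = i then X i else r) Q := by
    have : ((Polynomial.aeval r).restrictScalars k).comp
        (aeval (R := k) (fun l ↦ if l = i then Polynomial.C (X i : MvPolynomial (Fin 2) k)
          else Polynomial.X)) =
        aeval (fun l ↦ if l = i then X i else r) := by
      ext l : 1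
      rcases hor l with rfl | rfl
      · simp
      · simp [hij.symm]
    exact DFunLike.congr_fun this Q
  have hQj : P.eval (X j) = Q := by
    rw [heval, show (fun l ↦ if l = i then X i else (X j : MvPolynomial (Fin 2) k)) = X from
      funext fun l ↦ by rcases hor l with rfl | rfl <;> simp [hij.symm], aeval_X_left_apply]
  have hmem : Q ∈ supported k {i} := by
    rw [← hQj, Polynomial.eq_C_of_natDegree_eq_zero hdeg, Polynomial.eval_C,
      Polynomial.coeff_zero_eq_eval_zero, heval, aeval_def]
    refine eval₂_mem (fun f _ ↦ ?_) fun l ↦ ?_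
    · exact (supported k {i}).algebraMap_mem _
    · split_ifs
      · exact X_mem_supported.mpr rfl
      · exact zero_mem _
  by_contra hmj
  have := mem_supported.mp hmem (mem_vars_iff_mem_support j |>.mpr
    ⟨m, mem_support_iff.mpr hm, by simpa using hmj⟩)
  exact hij.symm this

end Family

theorem coeff_form {A : Type*} [CommRing A] (g : ℕ) (c : ℕ → A) {u v : Polynomial A} {M : ℕ}
    (hu : u.natDegree ≤ M) (hv : v.natDegree ≤ M) :
    (∑ i ∈ Finset.range (g + 1), Polynomial.C (c i) * (u ^ i * v ^ (g - i))).coeff (g * M) =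
      ∑ i ∈ Finset.range (g + 1), c i * (u.coeff M ^ i * v.coeff M ^ (g - i)) := by
  rw [Polynomial.finsetSum_coeff]
  refine Finset.sum_congr rfl fun i hi ↦ ?_
  have hig : i + (g - i) = g := by have := Finset.mem_range.mp hi; omega
  rw [Polynomial.coeff_C_mul, ← Polynomial.coeff_pow_of_natDegree_le hu,
    ← Polynomial.coeff_pow_of_natDegree_le hv, ← Polynomial.coeff_mul_add_eq_of_natDegree_le
      (Polynomial.natDegree_pow_le_of_le i hu) (Polynomial.natDegree_pow_le_of_le _ hv),
    ← add_mul, hig]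

theorem coeff_max_natDegree_ne_zero {A : Type*} [CommRing A] {u v : Polynomial A}
    (h : u ≠ 0 ∨ v ≠ 0) :
    u.coeff (max u.natDegree v.natDegree) ≠ 0 ∨ v.coeff (max u.natDegree v.natDegree) ≠ 0 := by
  rcases lt_trichotomy u.natDegree v.natDegree with h' | h' | h'
  · rw [max_eq_right h'.le]
    right
    simpa using Polynomial.ne_zero_of_natDegree_gt h'
  · rw [h', max_self]
    conv_lhs => rw [← h']
    simpa using h
  · rw [max_eq_left h'.le]
    left
    simpa using Polynomial.ne_zero_of_natDegree_gt h'

/-- A nontrivial zero of a binary form over `k` in a polynomial algebra yields a zero in `k`. -/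
theorem exists_root_of_form_eq_zero {g : ℕ} {c : ℕ → k} (hc : c g ≠ 0) :
    ∀ {n : ℕ} {u v : MvPolynomial (Fin n) k}, u ≠ 0 ∨ v ≠ 0 →
      ∑ i ∈ Finset.range (g + 1), C (c i) * (u ^ i * v ^ (g - i)) = 0 →
      ∃ r : k, ∑ i ∈ Finset.range (g + 1), c i * r ^ i = 0 := by
  intro n
  induction n with
  | zero =>
    intro u v huv h
    obtain ⟨a, rfl⟩ := C_surjective (Fin 0) u
    obtain ⟨b, rfl⟩ := C_surjective (Fin 0) v
    simp only [← map_pow, ← map_mul, ← map_sum, map_eq_zero_iff C (C_injective (Fin 0) k)] at h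
    have hb : b ≠ 0 := by
      rintro rfl
      rw [Finset.sum_range_succ, Finset.sum_eq_zero] at h
      · simp [hc] at h
        simp_all
      · intro i hi
        rw [zero_pow (by have := Finset.mem_range.mp hi; omega)]
        simp
    refine ⟨a / b, ?_⟩
    rw [← mul_right_inj' (pow_ne_zero g hb), mul_zero, ← h, Finset.mul_sum]
    refine Finset.sum_congr rfl fun i hi ↦ ?_
    rw [← Nat.sub_add_cancel (Nat.lt_succ_iff.mp (Finset.mem_range.mp hi)), pow_add]
    simp only [Nat.add_sub_cancel, div_pow]
    field_simp
  | succ n ih =>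
    intro u v huv h
    have huv' : finSuccEquiv k n u ≠ 0 ∨ finSuccEquiv k n v ≠ 0 := by simpa using huv
    refine ih (coeff_max_natDegree_ne_zero huv') ?_
    rw [← coeff_form g (fun i ↦ C (c i)) (le_max_left _ _) (le_max_right _ _)]
    have := congrArg (finSuccEquiv k n) h
    simp only [map_sum, map_mul, map_pow, map_zero, ← MvPolynomial.algebraMap_eq,
      AlgEquiv.commutes] at this
    rw [← Polynomial.coeff_zero (g * _), ← this]
    rfl

/-- A derivation of `A` acts on `A[X]` coefficientwise. -/
noncomputable def coeffwiseDerivation {A : Type*} [CommRing A] [Algebra k A]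
    (D : Derivation k A A) : Derivation k (Polynomial A) (Polynomial A) :=
  (PolynomialModule.equivPolynomialSelf (R := A)).toLinearMap.compDer D.mapCoeffs

theorem coeff_coeffwiseDerivation {A : Type*} [CommRing A] [Algebra k A]
    (D : Derivation k A A) (P : Polynomial A) (n : ℕ) :
    (coeffwiseDerivation D P).coeff n = D (P.coeff n) := rfl

theorem coeffwiseDerivation_C {A : Type*} [CommRing A] [Algebra k A]
    (D : Derivation k A A) (a : A) :
    coeffwiseDerivation D (Polynomial.C a) = Polynomial.C (D a) := by
  ext n
  rw [coeff_coeffwiseDerivation, Polynomial.coeff_C, Polynomial.coeff_C]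
  split_ifs <;> simp

theorem natDegree_coeffwiseDerivation_le {A : Type*} [CommRing A] [Algebra k A]
    (D : Derivation k A A) (P : Polynomial A) :
    (coeffwiseDerivation D P).natDegree ≤ P.natDegree := by
  refine Polynomial.natDegree_le_iff_coeff_eq_zero.mpr fun n hn ↦ ?_
  rw [coeff_coeffwiseDerivation, Polynomial.coeff_eq_zero_of_natDegree_lt hn, map_zero]

section Binomial

variable {U V : Polynomial (MvPolynomial (Fin 2) k)} {i j : Fin 2} {a b : ℕ} {r s : k}

theorem coeffwiseDerivation_binomial
    (h : r • U ^ a + s • V ^ b = Polynomial.C (r • X i ^ a + s • X j ^ b))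
    (D : Derivation k (MvPolynomial (Fin 2) k) (MvPolynomial (Fin 2) k)) :
    (r * a) • (U ^ (a - 1) * coeffwiseDerivation D U) +
      (s * b) • (V ^ (b - 1) * coeffwiseDerivation D V) =
      Polynomial.C ((r * a) • (X i ^ (a - 1) * D (X i)) + (s * b) • (X j ^ (b - 1) * D (X j))) := by
  have := congrArg (coeffwiseDerivation D) h
  rw [coeffwiseDerivation_C] at this
  simp only [map_add, Derivation.map_smul, Derivation.leibniz_pow, smul_eq_mul, mul_smul,
    Nat.cast_smul_eq_nsmul] at this ⊢
  exact this

theorem natDegree_le_of_binomial (hij : i ≠ j) (hU : U.coeff 0 = X i) (hV : V.coeff 0 = X j)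
    (h : r • U ^ a + s • V ^ b = Polynomial.C (r • X i ^ a + s • X j ^ b))
    (hr : r ≠ 0) (ha : (a : k) ≠ 0) : (a - 1) * U.natDegree ≤ V.natDegree := by
  have hi := coeffwiseDerivation_binomial h (pderiv i)
  have hj := coeffwiseDerivation_binomial h (pderiv j)
  simp only [pderiv_X_self, pderiv_X_of_ne hij, pderiv_X_of_ne hij.symm, mul_one, mul_zero,
    smul_zero, add_zero, zero_add] at hi hj
  set Ui := coeffwiseDerivation (pderiv i) U with hUi
  set Uj := coeffwiseDerivation (pderiv j) U with hUj
  set Vi := coeffwiseDerivation (pderiv i) V with hVi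
  set Vj := coeffwiseDerivation (pderiv j) V with hVj
  have hJ : Ui * Vj - Uj * Vi ≠ 0 := by
    intro h0
    have := congrArg (Polynomial.coeff · 0) h0
    simp [Polynomial.mul_coeff_zero, hUi, hUj, hVi, hVj, coeff_coeffwiseDerivation, hU, hV,
      pderiv_X_of_ne hij, pderiv_X_of_ne hij.symm] at this
  have hU0 : U ≠ 0 := by rintro rfl; simp [eq_comm] at hU
  have key : (r * a) • (U ^ (a - 1) * (Ui * Vj - Uj * Vi)) =
      Polynomial.C ((r * a) • X i ^ (a - 1)) * Vj -
        Polynomial.C ((s * b) • X j ^ (b - 1)) * Vi := by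
    rw [← hi, ← hj]
    simp only [Algebra.smul_def]
    ring
  have hdeg := congrArg Polynomial.natDegree key
  rw [Polynomial.natDegree_smul _ (mul_ne_zero hr ha),
    Polynomial.natDegree_mul (pow_ne_zero _ hU0) hJ,
    Polynomial.natDegree_pow] at hdeg
  have : (Polynomial.C ((r * a) • X i ^ (a - 1)) * Vj -
      Polynomial.C ((s * b) • X j ^ (b - 1)) * Vi).natDegree ≤ V.natDegree :=
    (Polynomial.natDegree_sub_le_of_le
      ((Polynomial.natDegree_C_mul_le _ _).trans (natDegree_coeffwiseDerivation_le _ _))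
      ((Polynomial.natDegree_C_mul_le _ _).trans (natDegree_coeffwiseDerivation_le _ _))).trans
      (max_self _).le
  omega

theorem natDegree_eq_zero_of_binomial_of_cast_eq_zero
    (h : r • U ^ a + s • V ^ b = Polynomial.C (r • X i ^ a + s • X j ^ b))
    (hr : r ≠ 0) (hs : s ≠ 0) (ha0 : a ≠ 0) (ha : (a : k) = 0) (hb : (b : k) ≠ 0) (hb2 : 2 ≤ b) :
    U.natDegree = 0 ∧ V.natDegree = 0 := by
  have hj := coeffwiseDerivation_binomial h (pderiv j)
  simp only [ha, mul_zero, zero_smul, zero_add, pderiv_X_self, mul_one] at hj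
  have hne : (s * b) • (X j ^ (b - 1) : MvPolynomial (Fin 2) k) ≠ 0 :=
    smul_ne_zero (mul_ne_zero hs hb) (pow_ne_zero _ (X_ne_zero j))
  have hne' : V ^ (b - 1) * coeffwiseDerivation (pderiv j) V ≠ 0 := by
    intro h0
    rw [h0, smul_zero] at hj
    exact hne (Polynomial.C_eq_zero.mp hj.symm)
  have hV : V.natDegree = 0 := by
    have := congrArg Polynomial.natDegree hj
    rw [Polynomial.natDegree_C, Polynomial.natDegree_smul _ (mul_ne_zero hs hb),
      Polynomial.natDegree_mul (left_ne_zero_of_mul hne') (right_ne_zero_of_mul hne'),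
      Polynomial.natDegree_pow] at this
    exact (mul_eq_zero.mp (Nat.eq_zero_of_add_eq_zero this).1).resolve_left (by omega)
  refine ⟨?_, hV⟩
  rw [Polynomial.eq_C_of_natDegree_eq_zero hV] at h
  have := congrArg Polynomial.natDegree (eq_sub_of_add_eq h)
  rw [Polynomial.natDegree_smul _ hr, Polynomial.natDegree_pow, ← map_pow, Polynomial.smul_C,
    ← map_sub, Polynomial.natDegree_C] at this
  exact (mul_eq_zero.mp this).resolve_left ha0

theorem natDegree_eq_zero_of_binomial (hij : i ≠ j) (hU : U.coeff 0 = X i) (hV : V.coeff 0 = X j)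
    (h : r • U ^ a + s • V ^ b = Polynomial.C (r • X i ^ a + s • X j ^ b))
    (hr : r ≠ 0) (hs : s ≠ 0) (ha2 : 2 ≤ a) (hb2 : 2 ≤ b) (hab : a.Coprime b) :
    U.natDegree = 0 ∧ V.natDegree = 0 := by
  have h' : s • V ^ b + r • U ^ a = Polynomial.C (s • X j ^ b + r • X i ^ a) := by
    rw [add_comm, h, add_comm (r • _)]
  have hnot : ¬ ((a : k) = 0 ∧ (b : k) = 0) := by
    rintro ⟨ha, hb⟩
    have := (Nat.isCoprime_iff_coprime.mpr hab).map (Int.castRingHom k)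
    simp [ha, hb] at this
  by_cases ha : (a : k) = 0
  · exact natDegree_eq_zero_of_binomial_of_cast_eq_zero h hr hs (by omega) ha
      (fun hb ↦ hnot ⟨ha, hb⟩) hb2
  by_cases hb : (b : k) = 0
  · exact (natDegree_eq_zero_of_binomial_of_cast_eq_zero h' hs hr (by omega) hb ha ha2).symm
  have h1 := natDegree_le_of_binomial hij hU hV h hr ha
  have h2 := natDegree_le_of_binomial hij.symm hV hU h' hs hb
  obtain ⟨a, rfl⟩ := Nat.exists_eq_add_of_le' ha2
  obtain ⟨b, rfl⟩ := Nat.exists_eq_add_of_le' hb2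
  have h3 : a + b ≠ 0 := by
    intro h0
    obtain ⟨rfl, rfl⟩ := Nat.eq_zero_of_add_eq_zero h0
    simp at hab
  simp only [Nat.add_succ_sub_one, add_mul, one_mul] at h1 h2
  have h4 : a * U.natDegree = 0 := by omega
  have h5 : b * V.natDegree = 0 := by omega
  rcases Nat.eq_zero_or_pos a with rfl | h6
  · have : V.natDegree = 0 := (mul_eq_zero.mp h5).resolve_left (by omega)
    omega
  · have : U.natDegree = 0 := (mul_eq_zero.mp h4).resolve_left (by omega)
    omega

end Binomial

theorem sub_dvd_form {A : Type*} [CommRing A] [Algebra k A] {g : ℕ} {c : ℕ → k} {r : k}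
    (hr : ∑ i ∈ Finset.range (g + 1), c i * r ^ i = 0) (u v : A) :
    u - r • v ∣ ∑ i ∈ Finset.range (g + 1), algebraMap k A (c i) * (u ^ i * v ^ (g - i)) := by
  have : ∑ i ∈ Finset.range (g + 1), algebraMap k A (c i) * ((r • v) ^ i * v ^ (g - i)) = 0 := by
    trans algebraMap k A (∑ i ∈ Finset.range (g + 1), c i * r ^ i) * v ^ g
    · rw [map_sum, Finset.sum_mul]
      refine Finset.sum_congr rfl fun i hi ↦ ?_
      conv_rhs => rw [← Nat.add_sub_cancel' (Nat.lt_succ_iff.mp (Finset.mem_range.mp hi)), pow_add]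
      simp only [Algebra.smul_def, map_mul, map_pow]
      ring
    · rw [hr, map_zero, zero_mul]
  rw [← sub_zero (Finset.sum _ _), ← this, ← Finset.sum_sub_distrib]
  refine Finset.dvd_sum fun i _ ↦ ?_
  rw [← mul_sub, ← sub_mul]
  exact ((sub_dvd_pow_sub_pow _ _ i).mul_right _).mul_left _

theorem exists_coeff_ne_zero_of_not_X_dvd {i : σ} {Q : MvPolynomial σ k} (h : ¬ X i ∣ Q) :
    ∃ m, coeff m Q ≠ 0 ∧ m i = 0 := by
  rw [X_dvd_iff_modMonomial_eq_zero] at h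
  obtain ⟨m, hm⟩ := MvPolynomial.ne_zero_iff.mp h
  by_cases hle : Finsupp.single i 1 ≤ m
  · simp [coeff_modMonomial_of_le _ hle] at hm
  · rw [coeff_modMonomial_of_not_le _ hle] at hm
    exact ⟨m, hm, by simpa using hle⟩

theorem exists_coeff_ne_zero_eq_degreeOf {F : MvPolynomial σ k} (hF : F ≠ 0) (i : σ) :
    ∃ m, coeff m F ≠ 0 ∧ m i = degreeOf i F := by
  obtain ⟨m, hm, hmi⟩ := Finset.exists_mem_eq_sup F.support (support_nonempty.mpr hF) (fun m ↦ m i)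
  exact ⟨m, mem_support_iff.mp hm, by rw [degreeOf_eq_sup, hmi]⟩

/-- The weight for which the two pure powers of maximal degree have the same weight. -/
noncomputable def balancedWeight (F : MvPolynomial (Fin 2) k) : Fin 2 → ℚ :=
  ![degreeOf 1 F, degreeOf 0 F]

theorem weight_balancedWeight (F : MvPolynomial (Fin 2) k) {i j : Fin 2} (hij : i ≠ j)
    (m : Fin 2 →₀ ℕ) :
    Finsupp.weight (balancedWeight F) m = m i * degreeOf j F + m j * degreeOf i F := by
  fin_cases i <;> fin_cases j <;>
    simp_all [Finsupp.weight_eq_sum, balancedWeight, Fin.sum_univ_two, add_comm]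

theorem eq_single_of_apply_eq_zero {i j : Fin 2} (hij : i ≠ j) {m : Fin 2 →₀ ℕ} (h : m i = 0) :
    m = Finsupp.single j (m j) := by
  ext l
  obtain rfl | rfl : l = i ∨ l = j := by omega
  · simp [h, hij]
  · simp

/-- The top form of a coordinate for the balanced weight contains both pure powers. -/
theorem exists_topForm (φ : MvPolynomial (Fin 2) k ≃ₐ[k] MvPolynomial (Fin 2) k)
    (hD : ∀ i, degreeOf i (φ (X 0)) ≠ 0) :
    ∃ (Q : MvPolynomial (Fin 2) k),
      HasTopForm (balancedWeight (φ (X 0))) (degreeOf 0 (φ (X 0)) * degreeOf 1 (φ (X 0)))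
        (φ (X 0)) Q ∧ ∀ i, coeff (Finsupp.single i (degreeOf i (φ (X 0)))) Q ≠ 0 := by
  classical
  set F := φ (X 0) with hF
  have hF0 : F ≠ 0 := ne_zero_of_degreeOf_ne_zero (hD 0)
  set w := balancedWeight F with hw
  obtain ⟨n, hn, hmax⟩ := F.support.exists_max_image (Finsupp.weight w) (support_nonempty.mpr hF0)
  set d := Finsupp.weight w n with hd
  have hmax' (m : Fin 2 →₀ ℕ) (hm : coeff m F ≠ 0) : Finsupp.weight w m ≤ d :=
    hmax m (mem_support_iff.mpr hm)
  have hQ := hasTopForm_weightedHomogeneousComponent (mem_weightIn.mpr hmax')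
  set Q := weightedHomogeneousComponent w d F with hQdef
  have hcoeff (m : Fin 2 →₀ ℕ) : coeff m Q ≠ 0 ↔ coeff m F ≠ 0 ∧ Finsupp.weight w m = d := by
    rw [hQdef, coeff_weightedHomogeneousComponent]
    split_ifs with h <;> simp [h]
  have hle {m : Fin 2 →₀ ℕ} (hm : coeff m F ≠ 0) (i : Fin 2) : m i ≤ degreeOf i F :=
    monomial_le_degreeOf i (mem_support_iff.mpr hm)
  obtain ⟨Φ, hΦQ, hΦ, hne⟩ := exists_homogeneous_family φ w hQ
  have hd_ge {i j : Fin 2} (hij : i ≠ j) : (degreeOf i F * degreeOf j F : ℚ) ≤ d := by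
    obtain ⟨m, hm, hmi⟩ := exists_coeff_ne_zero_eq_degreeOf hF0 i
    have := hmax' m hm
    rw [weight_balancedWeight F hij, hmi] at this
    have : (0 : ℚ) ≤ m j * degreeOf i F := by positivity
    linarith
  have hpos (i : Fin 2) : (0 : ℚ) < degreeOf i F := by exact_mod_cast Nat.pos_of_ne_zero (hD i)
  have hpure {i j : Fin 2} (hij : i ≠ j) {m : Fin 2 →₀ ℕ} (hm : coeff m Q ≠ 0) (hmi : m i = 0) :
      m j = degreeOf j F ∧ d = degreeOf i F * degreeOf j F := by
    have h1 := ((hcoeff m).mp hm).2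
    rw [weight_balancedWeight F hij, hmi, Nat.cast_zero, zero_mul, zero_add] at h1
    have h2 := hd_ge hij
    rw [← h1, mul_comm, mul_le_mul_iff_of_pos_right (hpos i), Nat.cast_le] at h2
    have h3 := le_antisymm (hle ((hcoeff m).mp hm).1 j) h2
    exact ⟨h3, by rw [← h1, h3, mul_comm]⟩
  have hndvd {i j : Fin 2} (hij : i ≠ j) : ¬ X i ∣ Q := by
    intro hdvd
    have hzero {m : Fin 2 →₀ ℕ} (hm : coeff m Q ≠ 0) : m j = 0 :=
      apply_eq_zero_of_X_dvd hΦ hne hΦQ hij hdvd hm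
    have hnQ : coeff n Q ≠ 0 := (hcoeff n).mpr ⟨mem_support_iff.mp hn, rfl⟩
    obtain ⟨-, hd'⟩ := hpure hij.symm hnQ (hzero hnQ)
    obtain ⟨m, hm, hmj⟩ := exists_coeff_ne_zero_eq_degreeOf hF0 j
    have h1 := hmax' m hm
    rw [weight_balancedWeight F hij, hd', hmj] at h1
    have h2 : (m i * degreeOf j F : ℚ) = 0 := le_antisymm (by linarith) (by positivity)
    refine hD j (hmj ▸ hzero ((hcoeff m).mpr ⟨hm, ?_⟩))
    rw [weight_balancedWeight F hij, hd', hmj, h2, zero_add]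
  have hd_eq : d = degreeOf 0 F * degreeOf 1 F := by
    obtain ⟨m, hm, hm0⟩ := exists_coeff_ne_zero_of_not_X_dvd (hndvd (i := 0) (j := 1) (by simp))
    exact (hpure (by simp) hm hm0).2
  refine ⟨Q, hd_eq ▸ hQ, fun j ↦ ?_⟩
  obtain ⟨i, hij⟩ := exists_ne j
  obtain ⟨m, hm, hmi⟩ := exists_coeff_ne_zero_of_not_X_dvd (hndvd hij)
  rwa [← (hpure hij hm hmi).1, ← eq_single_of_apply_eq_zero hij hmi]

theorem eq_form_of_support {Q : MvPolynomial (Fin 2) k} {a b g : ℕ}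
    (ha : a ≠ 0) (hb : b ≠ 0) (hab : a.Coprime b)
    (hQ : ∀ m, coeff m Q ≠ 0 → m 0 * b + m 1 * a = g * a * b) :
    Q = ∑ i ∈ Finset.range (g + 1),
      C (coeff (Finsupp.single 0 (a * i) + Finsupp.single 1 (b * (g - i))) Q) *
        ((X 0 ^ a) ^ i * (X 1 ^ b) ^ (g - i)) := by
  classical
  set s : ℕ → Fin 2 →₀ ℕ :=
    fun i ↦ Finsupp.single 0 (a * i) + Finsupp.single 1 (b * (g - i)) with hs
  have hsinj : Function.Injective s := by
    intro i j h
    have := DFunLike.congr_fun h 0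
    simpa [hs, ha] using this
  have hsub : Q.support ⊆ (Finset.range (g + 1)).image s := by
    intro m hm
    have h := hQ m (mem_support_iff.mp hm)
    obtain ⟨i, hi⟩ : a ∣ m 0 := by
      refine hab.dvd_of_dvd_mul_right ((Nat.dvd_add_left (dvd_mul_left a (m 1))).mp ?_)
      rw [h, mul_right_comm]
      exact dvd_mul_left _ _
    have h1 : b * i + m 1 = b * g := by
      refine Nat.eq_of_mul_eq_mul_left (Nat.pos_of_ne_zero ha) ?_
      rw [hi] at h
      linarith
    have h2 : i ≤ g := Nat.le_of_mul_le_mul_left (by omega) (Nat.pos_of_ne_zero hb)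
    refine Finset.mem_image.mpr ⟨i, Finset.mem_range.mpr (by omega), ?_⟩
    ext l
    fin_cases l
    · simp [hs, hi]
    · simp [hs, Nat.mul_sub]
      omega
  conv_lhs => rw [Q.as_sum, Finset.sum_subset hsub (fun m _ hm ↦ by
    rw [notMem_support_iff.mp hm, monomial_zero]), Finset.sum_image hsinj.injOn]
  refine Finset.sum_congr rfl fun i _ ↦ ?_
  rw [monomial_eq, ← pow_mul, ← pow_mul, Finsupp.prod_fintype _ _ (by simp), Fin.prod_univ_two]
  simp [hs]

/-- The top form of a coordinate is divisible by a binomial that is linear in one variable. -/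
theorem exists_binomial_dvd_topForm (φ : MvPolynomial (Fin 2) k ≃ₐ[k] MvPolynomial (Fin 2) k)
    (hD : ∀ i, degreeOf i (φ (X 0)) ≠ 0) :
    ∃ (Q : MvPolynomial (Fin 2) k) (a b g : ℕ) (r : k),
      HasTopForm (balancedWeight (φ (X 0))) (degreeOf 0 (φ (X 0)) * degreeOf 1 (φ (X 0)))
        (φ (X 0)) Q ∧ degreeOf 0 (φ (X 0)) = a * g ∧ degreeOf 1 (φ (X 0)) = b * g ∧ r ≠ 0 ∧
        (a = 1 ∨ b = 1) ∧ X 0 ^ a - r • X 1 ^ b ∣ Q := by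
  obtain ⟨Q, hQ, hpure⟩ := exists_topForm φ hD
  set F := φ (X 0) with hF
  obtain ⟨Φ, hΦQ, hΦ, hne⟩ := exists_homogeneous_family φ _ hQ
  have hgpos : 0 < (degreeOf 0 F).gcd (degreeOf 1 F) :=
    Nat.gcd_pos_of_pos_left _ (Nat.pos_of_ne_zero (hD 0))
  obtain ⟨a, b, hab, hp, hq⟩ := Nat.exists_coprime (degreeOf 0 F) (degreeOf 1 F)
  set g := (degreeOf 0 F).gcd (degreeOf 1 F)
  have ha : a ≠ 0 := by rintro rfl; exact hD 0 (by simpa using hp)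
  have hb : b ≠ 0 := by rintro rfl; exact hD 1 (by simpa using hq)
  have hQform := eq_form_of_support (g := g) ha hb hab (Q := Q) <| by
    intro m hm
    have h := mem_weightIn.mp hQ.1 m hm
    rw [weight_balancedWeight F (i := 0) (j := 1) (by simp), Set.mem_singleton_iff, hp, hq] at h
    refine Nat.eq_of_mul_eq_mul_left hgpos ?_
    have h' : m 0 * (b * g) + m 1 * (a * g) = a * g * (b * g) := by exact_mod_cast h
    linarith
  set c : ℕ → k := fun i ↦
    coeff (Finsupp.single 0 (a * i) + Finsupp.single 1 (b * (g - i))) Q with hc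
  have hcg : c g ≠ 0 := by
    have h := hpure 0
    rw [hp] at h
    simpa only [hc, Nat.sub_self, mul_zero, Finsupp.single_zero, add_zero] using h
  have hc0 : c 0 ≠ 0 := by
    have h := hpure 1
    rw [hq] at h
    simpa only [hc, Nat.sub_zero, mul_zero, Finsupp.single_zero, zero_add] using h
  have hQ0 : Q ≠ 0 := MvPolynomial.ne_zero_iff.mpr ⟨_, hpure 0⟩
  have hXne (i : Fin 2) : Φ (X i) ≠ 0 := by
    intro h
    have := hΦ (X i)
    simp [h, eq_comm] at this
  set M := max (Φ (X 0) ^ a).natDegree (Φ (X 1) ^ b).natDegree with hM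
  have hMpos : 0 < M := by
    obtain ⟨i, hi⟩ := hne
    rw [hM, lt_max_iff, Polynomial.natDegree_pow, Polynomial.natDegree_pow]
    fin_cases i
    · left; exact Nat.pos_of_ne_zero (mul_ne_zero ha hi)
    · right; exact Nat.pos_of_ne_zero (mul_ne_zero hb hi)
  obtain ⟨r, hr⟩ := exists_root_of_form_eq_zero hcg
    (coeff_max_natDegree_ne_zero (.inl (pow_ne_zero a (hXne 0)) :
      Φ (X 0) ^ a ≠ 0 ∨ Φ (X 1) ^ b ≠ 0)) <| by
    rw [← coeff_form g (fun i ↦ C (c i)) (le_max_left _ _) (le_max_right _ _)]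
    have h1 : Φ Q = ∑ i ∈ Finset.range (g + 1),
        Polynomial.C (C (c i)) * ((Φ (X 0) ^ a) ^ i * (Φ (X 1) ^ b) ^ (g - i)) := by
      conv_lhs => rw [hQform]
      simp only [map_sum, map_mul, map_pow, ← MvPolynomial.algebraMap_eq, AlgHom.commutes]
      rfl
    rw [← h1, hΦQ, Polynomial.coeff_C_of_ne_zero (by positivity)]
  have hr0 : r ≠ 0 := by
    rintro rfl
    rw [Finset.sum_range_succ', Finset.sum_eq_zero (by simp)] at hr
    exact hc0 (by simpa using hr)
  have hdvd : X 0 ^ a - r • X 1 ^ b ∣ Q := by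
    rw [hQform]
    exact sub_dvd_form hr _ _
  refine ⟨Q, a, b, g, r, hQ, hp, hq, hr0, ?_, hdvd⟩
  by_contra! h
  have hfix := map_eq_C_of_dvd hΦ hΦQ hQ0 hdvd
  have hdeg := natDegree_eq_zero_of_binomial (i := 0) (j := 1) (r := 1) (s := -r) (by simp)
    (hΦ (X 0)) (hΦ (X 1)) (by simpa [sub_eq_add_neg] using hfix) one_ne_zero (neg_ne_zero.mpr hr0)
    (by omega) (by omega) hab
  obtain ⟨i, hi⟩ := hne
  fin_cases i
  · exact hi hdeg.1
  · exact hi hdeg.2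

theorem balancedWeight_apply (F : MvPolynomial (Fin 2) k) {i j : Fin 2} (hij : i ≠ j) :
    balancedWeight F i = degreeOf j F := by
  fin_cases i <;> fin_cases j <;> simp_all [balancedWeight]

/-- The endomorphism `xᵢ ↦ α xᵢ + f(xⱼ)`, `xⱼ ↦ xⱼ`. -/
noncomputable def elementaryHom (i j : Fin 2) (α : k) (f : Polynomial k) :
    MvPolynomial (Fin 2) k →ₐ[k] MvPolynomial (Fin 2) k :=
  aeval (Function.update X i (C α * X i + Polynomial.aeval (X j) f))

theorem elementaryHom_X_self (i j : Fin 2) (α : k) (f : Polynomial k) :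
    elementaryHom i j α f (X i) = C α * X i + Polynomial.aeval (X j) f := by
  simp [elementaryHom]

theorem elementaryHom_X_of_ne {i j : Fin 2} (hij : i ≠ j) (α : k) (f : Polynomial k) :
    elementaryHom i j α f (X j) = X j := by
  simp [elementaryHom, hij.symm]

theorem algHom_ext_of_ne {A : Type*} [Semiring A] [Algebra k A] {i j : Fin 2} (hij : i ≠ j)
    {f g : MvPolynomial (Fin 2) k →ₐ[k] A} (hi : f (X i) = g (X i)) (hj : f (X j) = g (X j)) :
    f = g := by
  ext l
  obtain rfl | rfl : l = i ∨ l = j := by omega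
  exacts [hi, hj]

theorem elementaryHom_comp {i j : Fin 2} (hij : i ≠ j) (α β : k) (f g : Polynomial k) :
    (elementaryHom i j α f).comp (elementaryHom i j β g) =
      elementaryHom i j (β * α) (Polynomial.C β * f + g) := by
  refine algHom_ext_of_ne hij ?_ ?_
  · simp only [AlgHom.comp_apply, elementaryHom_X_self, map_add, map_mul,
      ← Polynomial.aeval_algHom_apply, elementaryHom_X_of_ne hij, algHom_C, Polynomial.aeval_C,
      MvPolynomial.algebraMap_eq]
    ring
  · simp [elementaryHom_X_of_ne hij]

theorem elementaryHom_one_zero {i j : Fin 2} (hij : i ≠ j) :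
    elementaryHom i j (1 : k) 0 = AlgHom.id k _ := by
  refine algHom_ext_of_ne hij ?_ ?_ <;> simp [elementaryHom_X_self, elementaryHom_X_of_ne hij]

/-- The elementary automorphism `xᵢ ↦ α xᵢ + f(xⱼ)`, `xⱼ ↦ xⱼ`. -/
noncomputable def elementaryAut {i j : Fin 2} (hij : i ≠ j) (α : kˣ) (f : Polynomial k) :
    PolyAut k :=
  .ofAlgHom (elementaryHom i j α f)
    (elementaryHom i j (α⁻¹ : kˣ) (-(Polynomial.C ((α⁻¹ : kˣ) : k) * f)))
    (by rw [elementaryHom_comp hij, ← elementaryHom_one_zero hij]; simp)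
    (by
      rw [elementaryHom_comp hij, ← elementaryHom_one_zero hij, mul_neg, ← mul_assoc,
        ← Polynomial.C_mul]
      simp)

theorem elementaryAut_X_self {i j : Fin 2} (hij : i ≠ j) (α : kˣ) (f : Polynomial k) :
    elementaryAut hij α f (X i) = C (α : k) * X i + Polynomial.aeval (X j) f :=
  elementaryHom_X_self i j (α : k) f

theorem elementaryAut_X_of_ne {i j : Fin 2} (hij : i ≠ j) (α : kˣ) (f : Polynomial k) :
    elementaryAut hij α f (X j) = X j :=
  elementaryHom_X_of_ne hij (α : k) f

theorem elementaryAut_mem_tameSubgroup {i j : Fin 2} (hij : i ≠ j) (α : kˣ) (f : Polynomial k) :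
    elementaryAut hij α f ∈ TameSubgroup k := by
  refine Subgroup.subset_closure ?_
  have hi := elementaryAut_X_self hij α f
  have hj := elementaryAut_X_of_ne hij α f
  have hf : Polynomial.aeval (X j) f ∈ Algebra.adjoin k {(X j : MvPolynomial (Fin 2) k)} :=
    Polynomial.aeval_mem_adjoin_singleton k _
  obtain ⟨rfl, rfl⟩ | ⟨rfl, rfl⟩ : i = 0 ∧ j = 1 ∨ i = 1 ∧ j = 0 := by omega
  · exact .inl ⟨α, _, hf, hi, hj⟩
  · exact .inr ⟨α, _, hf, hj, hi⟩

/-- If the top form of `F` is divisible by `xᵢ - s xⱼ ^ b`, the substitution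
`xᵢ ↦ xᵢ + s xⱼ ^ b` lowers the degree of `F` in `xⱼ` without raising the one in `xᵢ`. -/
theorem degreeOf_elementaryAut_lt {F Q : MvPolynomial (Fin 2) k} {i j : Fin 2} (hij : i ≠ j)
    {b : ℕ} {s : k} (hi : degreeOf i F ≠ 0) (hj : degreeOf j F ≠ 0)
    (hb : degreeOf j F = b * degreeOf i F)
    (hQ : HasTopForm (balancedWeight F) (degreeOf i F * degreeOf j F) F Q)
    (hdvd : X i - s • X j ^ b ∣ Q) :
    degreeOf i (elementaryAut hij 1 (Polynomial.C s * Polynomial.X ^ b) F) ≤ degreeOf i F ∧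
      degreeOf j (elementaryAut hij 1 (Polynomial.C s * Polynomial.X ^ b) F) < degreeOf j F := by
  set ε := elementaryAut hij 1 (Polynomial.C s * Polynomial.X ^ b) with hε
  set w := balancedWeight F with hw
  have hεj : ε (X j) = X j := elementaryAut_X_of_ne hij _ _
  have hεi : ε (X i) = X i + s • X j ^ b := by
    rw [hε, elementaryAut_X_self]
    simp [smul_eq_C_mul, MvPolynomial.algebraMap_eq]
  have hpow : HasTopForm w (w i) (X j ^ b : MvPolynomial (Fin 2) k) (X j ^ b) := by
    have := (hasTopForm_X (k := k) w j).pow b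
    rwa [hw, balancedWeight_apply F hij.symm, nsmul_eq_mul, ← Nat.cast_mul, ← hb,
      ← balancedWeight_apply F hij] at this
  have htop := hasTopForm_map (w' := w) (ε : _ →ₐ[k] MvPolynomial (Fin 2) k)
    (ε : _ →ₐ[k] MvPolynomial (Fin 2) k) (fun l ↦ by
      obtain rfl | rfl : l = i ∨ l = j := by omega
      · refine ⟨?_, by simp⟩
        rw [AlgEquiv.coe_toAlgHom, hεi]
        exact add_mem (hasTopForm_X w l).1 (Submodule.smul_mem _ s hpow.1)
      · rw [AlgEquiv.coe_toAlgHom, hεj]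
        exact hasTopForm_X w l) hQ
  simp only [AlgEquiv.coe_toAlgHom] at htop
  have hXdvd : X i ∣ ε Q := by
    have := map_dvd ε hdvd
    rwa [map_sub, map_smul, map_pow, hεi, hεj, add_sub_cancel_right] at this
  have hcoeff (m : Fin 2 →₀ ℕ) (hm : m i = 0) : coeff m (ε Q) = 0 := by
    obtain ⟨R, hR⟩ := hXdvd
    rw [hR, coeff_X_mul', if_neg (by simpa using hm)]
  have hle {m : Fin 2 →₀ ℕ} (hm : coeff m (ε F) ≠ 0) :
      m i * degreeOf j F + m j * degreeOf i F ≤ degreeOf i F * degreeOf j F := by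
    have := mem_weightIn.mp htop.mem_Iic m hm
    rw [weight_balancedWeight F hij, Set.mem_Iic] at this
    exact_mod_cast this
  refine ⟨degreeOf_le_iff.mpr fun m hm ↦ ?_,
    (degreeOf_lt_iff (Nat.pos_of_ne_zero hj)).mpr fun m hm ↦ ?_⟩
  · have := hle (mem_support_iff.mp hm)
    exact Nat.le_of_mul_le_mul_right (by omega) (Nat.pos_of_ne_zero hj)
  · have h := hle (mem_support_iff.mp hm)
    refine lt_of_le_of_ne (Nat.le_of_mul_le_mul_right (c := degreeOf i F)
      (by rw [mul_comm (degreeOf j F)]; omega) (Nat.pos_of_ne_zero hi)) fun hmj ↦ ?_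
    have hmi : m i = 0 := by
      rw [hmj, mul_comm (degreeOf i F)] at h
      exact (mul_eq_zero.mp (by omega)).resolve_right hj
    have hlt := mem_weightIn.mp htop.2 m (by
      rw [coeff_sub, hcoeff m hmi, sub_zero]
      exact mem_support_iff.mp hm)
    rw [weight_balancedWeight F hij, hmi, hmj, Set.mem_Iio, Nat.cast_zero, zero_mul, zero_add,
      mul_comm] at hlt
    exact lt_irrefl _ hlt

/-- An automorphism that fixes a variable is tame. -/
theorem mem_tameSubgroup_of_fix {φ : PolyAut k} {i j : Fin 2} (hij : i ≠ j)
    (hφ : φ (X j) = X j) : φ ∈ TameSubgroup k := by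
  have hφ' : φ.symm (X j) = X j := by rw [AlgEquiv.symm_apply_eq, hφ]
  let Ψ : MvPolynomial (Fin 2) k →ₐ[k] Polynomial (Polynomial k) :=
    aeval (Function.update (fun _ ↦ Polynomial.C Polynomial.X) i Polynomial.X)
  have hΨi : Ψ (X i) = Polynomial.X := by simp [Ψ]
  have hΨj : Ψ (X j) = Polynomial.C Polynomial.X := by simp [Ψ, hij.symm]
  have hcomp : (Ψ (φ (X i))).comp (Ψ (φ.symm (X i))) = Polynomial.X := by
    have : ((Polynomial.aeval (Ψ (φ.symm (X i)))).restrictScalars k).comp Ψ =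
        Ψ.comp (φ.symm : MvPolynomial (Fin 2) k →ₐ[k] _) :=
      algHom_ext_of_ne hij (by simp [hΨi]) (by simp [hφ', hΨj])
    have h := DFunLike.congr_fun this (φ (X i))
    simpa [hΨi, Polynomial.comp_eq_aeval] using h
  obtain ⟨θ, hθX, hθC⟩ : ∃ θ : Polynomial (Polynomial k) →+* MvPolynomial (Fin 2) k,
      θ Polynomial.X = X i ∧ ∀ f, θ (Polynomial.C f) = Polynomial.aeval (X j) f :=
    ⟨Polynomial.eval₂RingHom (Polynomial.aeval (X j) : Polynomial k →ₐ[k] _).toRingHom (X i),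
      by simp, by simp⟩
  have hθΨ (R : MvPolynomial (Fin 2) k) : θ (Ψ R) = R := by
    induction R using MvPolynomial.induction_on with
    | C a =>
      rw [← MvPolynomial.algebraMap_eq, AlgHom.commutes,
        IsScalarTower.algebraMap_apply k (Polynomial k), Polynomial.algebraMap_eq, hθC]
      simp
    | add p q hp hq => rw [map_add, map_add, hp, hq]
    | mul_X p l hp =>
      rw [map_mul, map_mul, hp]
      obtain rfl | rfl : l = i ∨ l = j := by omega
      · rw [hΨi, hθX]
      · rw [hΨj, hθC, Polynomial.aeval_X]
  have hdeg : (Ψ (φ (X i))).natDegree = 1 ∧ (Ψ (φ.symm (X i))).natDegree = 1 := by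
    have := congrArg Polynomial.natDegree hcomp
    rwa [Polynomial.natDegree_comp, Polynomial.natDegree_X, mul_eq_one] at this
  have hunit : IsUnit ((Ψ (φ (X i))).coeff 1) := by
    have := congrArg Polynomial.leadingCoeff hcomp
    rw [Polynomial.leadingCoeff_comp (by omega), hdeg.1, Polynomial.leadingCoeff_X,
      Polynomial.leadingCoeff, hdeg.1] at this
    exact .of_mul_eq_one _ (by simpa using this)
  obtain ⟨α, hα, hαc⟩ := Polynomial.isUnit_iff.mp hunit
  have hform : φ (X i) = C α * X i + Polynomial.aeval (X j) ((Ψ (φ (X i))).coeff 0) := by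
    conv_lhs => rw [← hθΨ (φ (X i)), Polynomial.eq_X_add_C_of_natDegree_le_one hdeg.1.le, ← hαc]
    rw [map_add, map_mul, hθX, hθC, hθC, Polynomial.aeval_C, MvPolynomial.algebraMap_eq]
  have : φ = elementaryAut hij hα.unit ((Ψ (φ (X i))).coeff 0) := by
    refine AlgEquiv.coe_toAlgHom_injective (algHom_ext_of_ne hij ?_ ?_)
    · simpa [elementaryAut_X_self] using hform
    · simpa [elementaryAut_X_of_ne] using hφ
  rw [this]
  exact elementaryAut_mem_tameSubgroup _ _ _

theorem exists_eq_aeval_of_degreeOf_eq_zero {F : MvPolynomial (Fin 2) k} {i j : Fin 2}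
    (hij : i ≠ j) (h : degreeOf i F = 0) : ∃ f : Polynomial k, F = Polynomial.aeval (X j) f := by
  have hmem : F ∈ supported k {j} := by
    refine mem_supported.mpr fun l hl ↦ ?_
    obtain ⟨m, hm, hml⟩ := (mem_vars_iff_mem_support l).mp hl
    obtain rfl | rfl : l = i ∨ l = j := by omega
    · have := monomial_le_degreeOf l hm
      simp at hml
      omega
    · rfl
  rw [supported, Set.image_singleton, Algebra.adjoin_singleton_eq_range_aeval] at hmem
  obtain ⟨f, hf⟩ := hmem
  exact ⟨f, hf.symm⟩

/-- An automorphism that maps a variable to a polynomial in one variable is tame. -/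
theorem mem_tameSubgroup_of_degreeOf_eq_zero {φ : PolyAut k} {i j : Fin 2} (hij : i ≠ j)
    (h : degreeOf i (φ (X 0)) = 0) : φ ∈ TameSubgroup k := by
  obtain ⟨f, hf⟩ := exists_eq_aeval_of_degreeOf_eq_zero hij h
  have hdeg : f.natDegree = 1 := by
    have h1 : (X 0 : MvPolynomial (Fin 2) k) = Polynomial.aeval (φ.symm (X j)) f := by
      rw [Polynomial.aeval_algHom_apply φ.symm, ← hf, AlgEquiv.symm_apply_apply]
    have h2 := congrArg (aeval ![Polynomial.X, 0] : _ →ₐ[k] Polynomial k) h1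
    rw [← Polynomial.aeval_algHom_apply] at h2
    have h3 := congrArg Polynomial.natDegree h2
    rw [← Polynomial.comp_eq_aeval, Polynomial.natDegree_comp] at h3
    exact Nat.eq_one_of_mul_eq_one_right (by simpa using h3.symm)
  have hα : f.coeff 1 ≠ 0 := by
    rw [← hdeg, Polynomial.coeff_natDegree, Polynomial.leadingCoeff_ne_zero]
    rintro rfl
    simp at hdeg
  set ε := elementaryAut hij.symm (Units.mk0 _ hα) (Polynomial.C (f.coeff 0)) with hε
  have hεj : ε (X j) = φ (X 0) := by
    rw [hε, elementaryAut_X_self, hf]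
    conv_rhs => rw [Polynomial.eq_X_add_C_of_natDegree_le_one hdeg.le]
    simp [MvPolynomial.algebraMap_eq]
  have hεT : ε ∈ TameSubgroup k := elementaryAut_mem_tameSubgroup _ _ _
  rw [← Subgroup.mul_mem_cancel_left _ (inv_mem hεT)]
  have hfix : (ε⁻¹ * φ) (X 0) = X j := by
    rw [AlgEquiv.mul_apply, ← hεj]
    exact ε.symm_apply_apply _
  obtain rfl | rfl : j = 0 ∨ j = 1 := by omega
  · exact mem_tameSubgroup_of_fix hij hfix
  · let τ₁ : PolyAut k := elementaryAut (i := 1) (j := 0) one_ne_zero 1 Polynomial.X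
    let τ₂ : PolyAut k := elementaryAut (i := 0) (j := 1) zero_ne_one 1 (-Polynomial.X)
    have hτ : τ₂ * τ₁ ∈ TameSubgroup k :=
      mul_mem (elementaryAut_mem_tameSubgroup _ _ _) (elementaryAut_mem_tameSubgroup _ _ _)
    rw [← Subgroup.mul_mem_cancel_left _ hτ]
    refine mem_tameSubgroup_of_fix (i := 1) one_ne_zero ?_
    rw [AlgEquiv.mul_apply, hfix]
    simp [τ₁, τ₂, elementaryAut_X_self, elementaryAut_X_of_ne]

/-- An automorphism whose first component involves both variables can be composed with an
elementary one so that the total degree in the two variables drops. -/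
theorem exists_tame_degreeOf_add_lt {φ : PolyAut k} (hD : ∀ i, degreeOf i (φ (X 0)) ≠ 0) :
    ∃ ε ∈ TameSubgroup k, degreeOf 0 ((ε * φ) (X 0)) + degreeOf 1 ((ε * φ) (X 0)) <
      degreeOf 0 (φ (X 0)) + degreeOf 1 (φ (X 0)) := by
  obtain ⟨Q, a, b, g, r, hQ, ha, hb, hr, rfl | rfl, hdvd⟩ := exists_binomial_dvd_topForm φ hD
  · have := degreeOf_elementaryAut_lt zero_ne_one (hD 0) (hD 1) (b := b) (s := r)
      (by rw [ha, hb, one_mul]) hQ (by simpa using hdvd)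
    exact ⟨_, elementaryAut_mem_tameSubgroup zero_ne_one _ _, by
      rw [AlgEquiv.mul_apply]; exact add_lt_add_of_le_of_lt this.1 this.2⟩
  · have := degreeOf_elementaryAut_lt one_ne_zero (hD 1) (hD 0) (b := a) (s := r⁻¹)
      (by rw [ha, hb, one_mul]) (by rwa [mul_comm (degreeOf 1 (φ (X 0)) : ℚ)]) (by
        have : X 1 - r⁻¹ • X 0 ^ a = -(r⁻¹ • (X 0 ^ a - r • X 1 ^ 1 : MvPolynomial (Fin 2) k)) := by
          rw [smul_sub, smul_smul, inv_mul_cancel₀ hr, one_smul, pow_one, neg_sub]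
        rw [this, neg_dvd, smul_eq_C_mul]
        exact ((isUnit_iff_ne_zero.mpr (inv_ne_zero hr)).map C).mul_left_dvd.mpr hdvd)
    exact ⟨_, elementaryAut_mem_tameSubgroup one_ne_zero _ _, by
      rw [AlgEquiv.mul_apply]; exact add_lt_add_of_lt_of_le this.2 this.1⟩

end JungVanDerKulk

/-- **Jung–van der Kulk.** Every automorphism of the polynomial algebra `k[x₁,x₂]`
over a field `k` is tame. -/
theorem every_automorphism_of_polynomial_algebra_rank_two_over_field_is_tame
    (k : Type*) [Field k] (φ : PolyAut k) : φ ∈ TameSubgroup k := by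
  induction hn : degreeOf 0 (φ (X 0)) + degreeOf 1 (φ (X 0)) using Nat.strong_induction_on
    generalizing φ with
  | _ n ih =>
    subst hn
    by_cases hD : ∀ i, degreeOf i (φ (X 0)) ≠ 0
    · obtain ⟨ε, hε, hlt⟩ := JungVanDerKulk.exists_tame_degreeOf_add_lt hD
      exact (Subgroup.mul_mem_cancel_left _ hε).mp (ih _ hlt _ rfl)
    · push Not at hD
      obtain ⟨i, hi⟩ := hD
      obtain ⟨j, hj⟩ := exists_ne i
      exact JungVanDerKulk.mem_tameSubgroup_of_degreeOf_eq_zero hj.symm hi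
end

section
/- Let k be a field. The automorphism group Aut(k[x₁,x₂]) is the free product of its subgroups Af₂(k) (affine automorphisms) and Tr₂(k) (triangular automorphisms) amalgamated over H(k) = Af₂(k) ∩ Tr₂(k); that is, the canonical homomorphism from the amalgamated free product Af₂(k) *_{H(k)} Tr₂(k) to Aut(k[x₁,x₂]) is a group isomorphism. -/
open MvPolynomial

/-- An automorphism is affine if it is
`(x₁ ↦ a₁x₁+b₁x₂+c₁, x₂ ↦ a₂x₁+b₂x₂+c₂)` with invertible determinant `a₁b₂ − a₂b₁`. -/
def IsAffine {Φ : Type*} [CommRing Φ] (σ : PolyAut Φ) : Prop :=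
  ∃ a₁ b₁ c₁ a₂ b₂ c₂ : Φ, IsUnit (a₁ * b₂ - a₂ * b₁) ∧
    σ (X 0) = C a₁ * X 0 + C b₁ * X 1 + C c₁ ∧
    σ (X 1) = C a₂ * X 0 + C b₂ * X 1 + C c₂

/-- An automorphism is triangular if it is `(x₁ ↦ ax₁ + h(x₂), x₂ ↦ bx₂ + b₁)`
with `a, b` units, `b₁ ∈ Φ` and `h(x₂) ∈ Φ[x₂]`. -/
def IsTriangular {Φ : Type*} [CommRing Φ] (σ : PolyAut Φ) : Prop :=
  ∃ (a b : Φˣ) (b₁ : Φ) (h : MvPolynomial (Fin 2) Φ),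
    h ∈ Algebra.adjoin Φ {(X 1 : MvPolynomial (Fin 2) Φ)} ∧
    σ (X 0) = C (a : Φ) * X 0 + h ∧ σ (X 1) = C (b : Φ) * X 1 + C b₁

/-- The subgroup `Af₂(Φ)` of affine automorphisms.  (The set of affine automorphisms is
closed under composition and inverses, so it coincides with the subgroup it generates.) -/
noncomputable def AffineSubgroup (Φ : Type*) [CommRing Φ] : Subgroup (PolyAut Φ) :=
  Subgroup.closure {σ | IsAffine σ}

/-- The subgroup `Tr₂(Φ)` of triangular automorphisms.  (The set of triangular automorphisms
is closed under composition and inverses, so it coincides with the subgroup it generates.) -/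
noncomputable def TriangularSubgroup (Φ : Type*) [CommRing Φ] : Subgroup (PolyAut Φ) :=
  Subgroup.closure {σ | IsTriangular σ}

/-- `H(Φ) = Af₂(Φ) ∩ Tr₂(Φ)`. -/
noncomputable def HSubgroup (Φ : Type*) [CommRing Φ] : Subgroup (PolyAut Φ) :=
  AffineSubgroup Φ ⊓ TriangularSubgroup Φ

/-- The two-element family of subgroups `Af₂(Φ)` (at `true`) and `Tr₂(Φ)` (at `false`). -/
noncomputable def AfTr (Φ : Type*) [CommRing Φ] : Bool → Subgroup (PolyAut Φ) :=
  fun b => cond b (AffineSubgroup Φ) (TriangularSubgroup Φ)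

/-- The inclusions of `H(Φ)` into `Af₂(Φ)` and `Tr₂(Φ)`. -/
noncomputable def inclHom (Φ : Type*) [CommRing Φ] :
    ∀ b : Bool, ↥(HSubgroup Φ) →* ↥(AfTr Φ b) :=
  fun b => Subgroup.inclusion (by cases b
                                  · exact inf_le_right
                                  · exact inf_le_left)

/-- The canonical homomorphism from the amalgamated free product
`Af₂(Φ) *_{H(Φ)} Tr₂(Φ)` to `Aut(Φ[x₁,x₂])`. -/
noncomputable def canonicalHom (Φ : Type*) [CommRing Φ] :
    Monoid.PushoutI (inclHom Φ) →* PolyAut Φ :=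
  Monoid.PushoutI.lift (fun b => (AfTr Φ b).subtype) (HSubgroup Φ).subtype
    (fun b => Subgroup.subtype_comp_inclusion _)

namespace MvPolynomial

section TopForm

variable {σ τ k : Type*} [Field k]

/-- The polynomials all of whose monomials have `w`-weight less than `r`. -/
noncomputable def weightLT (k : Type*) [Field k] (w : σ → ℚ) (r : ℚ) :
    Submodule k (MvPolynomial σ k) :=
  restrictSupport k {d | Finsupp.weight w d < r}

/-- `q` is the (possibly zero) homogeneous part of `p` of `w`-weight `r`, and `p` has no monomial
of larger weight. -/
def IsTopForm (w : σ → ℚ) (r : ℚ) (p q : MvPolynomial σ k) : Prop :=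
  IsWeightedHomogeneous w q r ∧ p - q ∈ weightLT k w r

variable {w : σ → ℚ} {r s : ℚ} {p q p' q' : MvPolynomial σ k}

theorem mem_weightLT : p ∈ weightLT k w r ↔ ∀ d, coeff d p ≠ 0 → Finsupp.weight w d < r := by
  simp [weightLT, mem_restrictSupport_iff, Set.subset_def]

theorem weightLT_mono (h : r ≤ s) : weightLT k w r ≤ weightLT k w s :=
  restrictSupport_mono (R := k) fun _ (hd : Finsupp.weight w _ < r) => lt_of_lt_of_le hd h

theorem IsWeightedHomogeneous.mem_weightLT (hp : IsWeightedHomogeneous w p r) (h : r < s) :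
    p ∈ weightLT k w s :=
  MvPolynomial.mem_weightLT.2 fun _ hd => (hp hd).trans_lt h

theorem IsWeightedHomogeneous.mul_mem_weightLT (hp : IsWeightedHomogeneous w p r)
    (hq : q ∈ weightLT k w s) : p * q ∈ weightLT k w (r + s) := by
  classical
  refine MvPolynomial.mem_weightLT.2 fun d hd => ?_
  rw [coeff_mul] at hd
  obtain ⟨x, hx, hne⟩ := Finset.exists_ne_zero_of_sum_ne_zero hd
  rw [Finset.HasAntidiagonal.mem_antidiagonal] at hx
  rw [← hx, map_add, hp (left_ne_zero_of_mul hne)]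
  exact add_lt_add_right (MvPolynomial.mem_weightLT.1 hq _ (right_ne_zero_of_mul hne)) _

theorem mul_mem_weightLT (hp : p ∈ weightLT k w r) (hq : q ∈ weightLT k w s) :
    p * q ∈ weightLT k w (r + s) := by
  classical
  refine mem_weightLT.2 fun d hd => ?_
  rw [coeff_mul] at hd
  obtain ⟨x, hx, hne⟩ := Finset.exists_ne_zero_of_sum_ne_zero hd
  rw [Finset.HasAntidiagonal.mem_antidiagonal] at hx
  rw [← hx, map_add]
  exact add_lt_add (mem_weightLT.1 hp _ (left_ne_zero_of_mul hne))
    (mem_weightLT.1 hq _ (right_ne_zero_of_mul hne))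

theorem IsWeightedHomogeneous.isTopForm (hp : IsWeightedHomogeneous w p r) :
    IsTopForm w r p p :=
  ⟨hp, by simp⟩

theorem isTopForm_zero_of_mem (hp : p ∈ weightLT k w r) : IsTopForm w r p 0 :=
  ⟨isWeightedHomogeneous_zero _ _ _, by simpa using hp⟩

namespace IsTopForm

theorem add (h : IsTopForm w r p q) (h' : IsTopForm w r p' q') :
    IsTopForm w r (p + p') (q + q') :=
  ⟨h.1.add h'.1, by rw [add_sub_add_comm]; exact add_mem h.2 h'.2⟩

theorem sub (h : IsTopForm w r p q) (h' : IsTopForm w r p' q') :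
    IsTopForm w r (p - p') (q - q') :=
  ⟨h.1.sub h'.1, by rw [sub_sub_sub_comm]; exact sub_mem h.2 h'.2⟩

theorem sum {ι : Type*} {t : Finset ι} {f g : ι → MvPolynomial σ k}
    (h : ∀ i ∈ t, IsTopForm w r (f i) (g i)) : IsTopForm w r (∑ i ∈ t, f i) (∑ i ∈ t, g i) :=
  ⟨IsWeightedHomogeneous.sum _ _ _ fun i hi => (h i hi).1, by
    rw [← Finset.sum_sub_distrib]; exact sum_mem fun i hi => (h i hi).2⟩

theorem mul (h : IsTopForm w r p q) (h' : IsTopForm w s p' q') :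
    IsTopForm w (r + s) (p * p') (q * q') := by
  refine ⟨h.1.mul h'.1, ?_⟩
  have e : p * p' - q * q' = q * (p' - q') + q' * (p - q) + (p - q) * (p' - q') := by ring
  rw [e]
  refine add_mem (add_mem (h.1.mul_mem_weightLT h'.2) ?_) (mul_mem_weightLT h.2 h'.2)
  rw [add_comm r s]
  exact h'.1.mul_mem_weightLT h.2

theorem C_mul (h : IsTopForm w r p q) (c : k) : IsTopForm w r (C c * p) (C c * q) := by
  simpa using (isWeightedHomogeneous_C w c).isTopForm.mul h

theorem pow (h : IsTopForm w r p q) (n : ℕ) : IsTopForm w (n * r) (p ^ n) (q ^ n) := by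
  induction n with
  | zero => simpa using (isWeightedHomogeneous_one k w).isTopForm
  | succ n ih =>
    have := ih.mul h
    rw [pow_succ, pow_succ]
    convert this using 1
    push_cast
    ring

theorem mono (h : IsTopForm w r p q) (hrs : r < s) : IsTopForm w s p 0 :=
  isTopForm_zero_of_mem <| by
    have := add_mem (weightLT_mono hrs.le h.2) (h.1.mem_weightLT hrs)
    simpa using this

theorem mem_weightLT (h : IsTopForm w r p q) (hrs : r < s) : p ∈ weightLT k w s := by
  simpa using (h.mono hrs).2

theorem coeff_eq {d : σ →₀ ℕ} (h : IsTopForm w r p q) (hd : Finsupp.weight w d = r) :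
    coeff d q = coeff d p := by
  by_contra hne
  have := MvPolynomial.mem_weightLT.1 h.2 d (by
    rw [coeff_sub, sub_ne_zero]; exact fun e => hne e.symm)
  exact this.ne hd

theorem weight_le {d : σ →₀ ℕ} (h : IsTopForm w r p q) (hd : coeff d p ≠ 0) :
    Finsupp.weight w d ≤ r := by
  by_cases hq : coeff d q = 0
  · refine (MvPolynomial.mem_weightLT.1 h.2 d ?_).le
    simpa [hq] using hd
  · exact (h.1 hq).le

theorem unique (h : IsTopForm w r p q) (h' : IsTopForm w r p q') : q = q' := by
  ext d
  by_cases hd : Finsupp.weight w d = r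
  · rw [h.coeff_eq hd, h'.coeff_eq hd]
  · rw [h.1.coeff_eq_zero _ hd, h'.1.coeff_eq_zero _ hd]

theorem weight_unique (h : IsTopForm w r p q) (h' : IsTopForm w s p q') (hq : q ≠ 0)
    (hq' : q' ≠ 0) : r = s := by
  rcases lt_trichotomy r s with hrs | hrs | hrs
  · exact absurd (h'.unique (h.mono hrs)) hq'
  · exact hrs
  · exact absurd (h.unique (h'.mono hrs)) hq

theorem exists_coeff_ne_zero (h : IsTopForm w r p q) (hq : q ≠ 0) :
    ∃ d, coeff d p ≠ 0 ∧ Finsupp.weight w d = r := by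
  obtain ⟨d, hd⟩ := MvPolynomial.exists_coeff_ne_zero hq
  exact ⟨d, h.coeff_eq (h.1 hd) ▸ hd, h.1 hd⟩

theorem of_forall_weight_le (h : ∀ d, coeff d p ≠ 0 → Finsupp.weight w d ≤ r) :
    IsTopForm w r p (weightedHomogeneousComponent w r p) := by
  classical
  refine ⟨weightedHomogeneousComponent_isWeightedHomogeneous r p,
    MvPolynomial.mem_weightLT.2 fun d hd => ?_⟩
  rw [coeff_sub, coeff_weightedHomogeneousComponent] at hd
  split_ifs at hd with hdr
  · simp at hd
  · exact lt_of_le_of_ne (h d (by simpa using hd)) hdr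

theorem exists_of_ne_zero (w : σ → ℚ) (hp : p ≠ 0) :
    ∃ d q, coeff d p ≠ 0 ∧ q ≠ 0 ∧ IsTopForm w (Finsupp.weight w d) p q := by
  obtain ⟨d, hd, hmax⟩ := Finset.exists_max_image p.support (Finsupp.weight w)
    (support_nonempty.2 hp)
  have h : IsTopForm w (Finsupp.weight w d) p _ :=
    of_forall_weight_le fun d' hd' => hmax d' (mem_support_iff.2 hd')
  refine ⟨d, _, mem_support_iff.1 hd, fun h0 => mem_support_iff.1 hd ?_, h⟩
  rw [← h.coeff_eq rfl, h0, coeff_zero]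

theorem aeval_monomial {w' : τ → ℚ} {f g : τ → MvPolynomial σ k}
    (h : ∀ i, IsTopForm w (w' i) (f i) (g i)) (d : τ →₀ ℕ) (c : k) :
    IsTopForm w (Finsupp.weight w' d) (aeval f (monomial d c)) (aeval g (monomial d c)) := by
  rw [MvPolynomial.aeval_monomial, MvPolynomial.aeval_monomial]
  refine C_mul ?_ c
  induction d using Finsupp.induction_linear with
  | zero => simpa using (isWeightedHomogeneous_one k w).isTopForm
  | add d e hd he =>
    rw [Finsupp.prod_add_index' (by simp) (by simp [pow_add]),
      Finsupp.prod_add_index' (by simp) (by simp [pow_add]), map_add]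
    exact hd.mul he
  | single i n => simpa [Finsupp.weight_single] using (h i).pow n

theorem aeval {w' : τ → ℚ} {f g : τ → MvPolynomial σ k} {P Q : MvPolynomial τ k}
    (h : ∀ i, IsTopForm w (w' i) (f i) (g i)) (hP : IsTopForm w' r P Q) :
    IsTopForm w r (aeval f P) (aeval g Q) := by
  have hlow : MvPolynomial.aeval f (P - Q) ∈ weightLT k w r := by
    rw [(P - Q).as_sum, map_sum]
    refine sum_mem fun d hd => (aeval_monomial h d _).mem_weightLT ?_
    exact MvPolynomial.mem_weightLT.1 hP.2 d (mem_support_iff.1 hd)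
  have htop : IsTopForm w r (MvPolynomial.aeval f Q) (MvPolynomial.aeval g Q) := by
    rw [Q.as_sum, map_sum, map_sum]
    refine sum fun d hd => ?_
    rw [← hP.1 (mem_support_iff.1 hd)]
    exact aeval_monomial h d _
  simpa using htop.add (isTopForm_zero_of_mem hlow)

end IsTopForm

end TopForm

section Binomial

variable {σ k : Type*} [Field k]

theorem degreeOf_pderiv_le (i t : σ) (p : MvPolynomial σ k) :
    degreeOf t (pderiv i p) ≤ degreeOf t p := by
  classical
  rw [degreeOf_le_iff]
  intro d hd
  rw [mem_support_iff, coeff_pderiv] at hd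
  have : (d + Finsupp.single i 1 : σ →₀ ℕ) t ≤ degreeOf t p :=
    degreeOf_le_iff.1 le_rfl _ (mem_support_iff.2 (left_ne_zero_of_mul hd))
  rw [Finsupp.add_apply] at this
  omega

/-- Substitution of `0` for the variable `t`. -/
noncomputable def substZero (k : Type*) [Field k] [DecidableEq σ] (t : σ) :
    MvPolynomial σ k →ₐ[k] MvPolynomial σ k :=
  aeval (Function.update X t 0)

variable [DecidableEq σ] {i j t : σ}

@[simp]
theorem substZero_X_self : substZero k t (X t) = 0 := by simp [substZero]

theorem substZero_X_of_ne (h : i ≠ t) : substZero k t (X i) = X i := by simp [substZero, h]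

theorem substZero_pderiv (h : i ≠ t) (p : MvPolynomial σ k) :
    substZero k t (pderiv i p) = pderiv i (substZero k t p) := by
  induction p using MvPolynomial.induction_on with
  | C a => simp [substZero, algebraMap_eq]
  | add p q hp hq => simp [hp, hq]
  | mul_X p l hp =>
    rw [pderiv_mul, map_add, map_mul, map_mul, hp, map_mul, pderiv_mul]
    by_cases hl : l = t
    · subst hl
      simp [pderiv_X_of_ne h.symm]
    · rw [substZero_X_of_ne hl]
      by_cases hil : l = i
      · simp [hil]
      · simp [pderiv_X_of_ne hil]

theorem substZero_eq_self {p : MvPolynomial σ k} (h : degreeOf t p = 0) :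
    substZero k t p = p := by
  conv_rhs => rw [← aeval_X_left_apply p]
  refine eval₂Hom_congr' rfl (fun l hl _ => ?_) rfl
  rw [Function.update_of_ne]
  rintro rfl
  rw [vars_def, Multiset.mem_toFinset, ← Multiset.count_pos] at hl
  rw [degreeOf_def] at h
  omega

theorem degreeOf_le_of_binomial_eq (hit : i ≠ t) (hjt : j ≠ t) (hij : i ≠ j)
    {u v : MvPolynomial σ k} (hu : substZero k t u = X i) (hv : substZero k t v = X j)
    {c : k} (hc : c ≠ 0) {a b : ℕ} (ha : ((a + 1 : ℕ) : k) ≠ 0)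
    (h : u ^ (a + 1) - C c * v ^ (b + 1) = X i ^ (a + 1) - C c * X j ^ (b + 1)) :
    a * degreeOf t u ≤ degreeOf t v ∧ b * degreeOf t v ≤ degreeOf t u := by
  have hu0 : u ≠ 0 := by rintro rfl; simp at hu; exact X_ne_zero _ hu.symm
  have hv0 : v ≠ 0 := by rintro rfl; simp at hv; exact X_ne_zero _ hv.symm
  set h₀ : MvPolynomial σ k := X i ^ (a + 1) - C c * X j ^ (b + 1) with hh₀
  set u' := pderiv i u with hu'
  set v' := pderiv i v with hv'
  set W := C ((a + 1 : ℕ) : k) * v * u' - C ((b + 1 : ℕ) : k) * u * v' with hW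
  have hder : C ((a + 1 : ℕ) : k) * u ^ a * u' - C c * (C ((b + 1 : ℕ) : k) * v ^ b * v') =
      C ((a + 1 : ℕ) : k) * X i ^ a := by
    have := congrArg (pderiv i) h
    simpa [hh₀, hu', hv', pderiv_pow, pderiv_X_of_ne hij.symm, mul_assoc] using this
  have hW0 : W ≠ 0 := by
    intro h0
    have := congrArg (substZero k t) h0
    rw [hW, hu', hv'] at this
    simp only [map_sub, map_mul, substZero_pderiv hit, hu, hv, pderiv_X_self,
      pderiv_X_of_ne hij.symm, mul_zero, sub_zero, mul_one, map_zero, mul_eq_zero, X_ne_zero,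
      or_false] at this
    rw [← algebraMap_eq, AlgHom.commutes, algebraMap_eq, C_eq_zero] at this
    exact ha this
  have e₁ : u ^ a * W = C ((a + 1 : ℕ) : k) * X i ^ a * v - C ((b + 1 : ℕ) : k) * h₀ * v' := by
    rw [hW]
    linear_combination v * hder - C ((b + 1 : ℕ) : k) * v' * h
  have e₂ : C c * v ^ b * W =
      C ((a + 1 : ℕ) : k) * X i ^ a * u - C ((a + 1 : ℕ) : k) * h₀ * u' := by
    rw [hW]
    linear_combination u * hder - C ((a + 1 : ℕ) : k) * u' * h
  have dX {l : σ} (hl : l ≠ t) (n : ℕ) : degreeOf t (X l ^ n : MvPolynomial σ k) = 0 := by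
    rw [degreeOf_X_pow_of_ne n hl.symm]
  have dC (x : k) {p : MvPolynomial σ k} {n : ℕ} (hp : degreeOf t p ≤ n) :
      degreeOf t (C x * p) ≤ n := (degreeOf_C_mul_le _ _ _).trans hp
  have dh₀ : degreeOf t h₀ = 0 := by
    refine Nat.le_zero.1 ((degreeOf_sub_le _ _ _).trans (max_le (dX hit _).le (dC _ (dX hjt _).le)))
  have dmul {p q : MvPolynomial σ k} {n : ℕ} (hp : degreeOf t p = 0) (hq : degreeOf t q ≤ n) :
      degreeOf t (p * q) ≤ n := (degreeOf_mul_le _ _ _).trans (by omega)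
  constructor
  · have := congrArg (degreeOf t) e₁
    rw [degreeOf_mul_eq (pow_ne_zero _ hu0) hW0, degreeOf_pow_eq _ _ _ hu0] at this
    refine (Nat.le_add_right _ _).trans (this.trans_le ?_)
    refine (degreeOf_sub_le _ _ _).trans (max_le ?_ ?_) <;> rw [mul_assoc]
    · exact dC _ (dmul (dX hit _) le_rfl)
    · exact dC _ (dmul dh₀ (degreeOf_pderiv_le _ _ _))
  · have := congrArg (degreeOf t) e₂
    rw [mul_assoc, degreeOf_C_mul _ _ (mem_nonZeroDivisors_of_ne_zero hc),
      degreeOf_mul_eq (pow_ne_zero _ hv0) hW0, degreeOf_pow_eq _ _ _ hv0] at this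
    refine (Nat.le_add_right _ _).trans (this.trans_le ?_)
    refine (degreeOf_sub_le _ _ _).trans (max_le ?_ ?_) <;> rw [mul_assoc]
    · exact dC _ (dmul (dX hit _) le_rfl)
    · exact dC _ (dmul dh₀ (degreeOf_pderiv_le _ _ _))

theorem eq_one_of_binomial_eq (hit : i ≠ t) (hjt : j ≠ t) (hij : i ≠ j)
    {u v : MvPolynomial σ k} (hu : substZero k t u = X i) (hv : substZero k t v = X j)
    (hd : degreeOf t u ≠ 0 ∨ degreeOf t v ≠ 0)
    {c : k} (hc : c ≠ 0) {a b : ℕ} (ha : a ≠ 0) (hb : b ≠ 0) (hab : a.Coprime b)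
    (h : u ^ a - C c * v ^ b = X i ^ a - C c * X j ^ b) : a = 1 ∨ b = 1 := by
  obtain ⟨a, rfl⟩ := Nat.exists_eq_succ_of_ne_zero ha
  obtain ⟨b, rfl⟩ := Nat.exists_eq_succ_of_ne_zero hb
  simp only [Nat.succ_eq_add_one] at *
  have key : a * degreeOf t u ≤ degreeOf t v ∧ b * degreeOf t v ≤ degreeOf t u := by
    by_cases hak : ((a + 1 : ℕ) : k) = 0
    · have hbk : ((b + 1 : ℕ) : k) ≠ 0 := fun hbk => by
        have := congrArg (Int.cast : ℤ → k) (Nat.gcd_eq_gcd_ab (a + 1) (b + 1))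
        rw [hab] at this
        push_cast at this hak hbk
        simp [hak, hbk] at this
      have := degreeOf_le_of_binomial_eq hjt hit hij.symm hv hu (inv_ne_zero hc) hbk (b := a) (by
        have hcc : C c⁻¹ * C c = (1 : MvPolynomial σ k) := by rw [← C_mul, inv_mul_cancel₀ hc, C_1]
        linear_combination -C c⁻¹ * h + (X j ^ (b + 1) - v ^ (b + 1)) * hcc)
      exact this.symm
    · exact degreeOf_le_of_binomial_eq hit hjt hij hu hv hc hak h
  by_contra! hne
  obtain ⟨h1, h2⟩ := key
  have ha1 : 1 ≤ a := by omega
  have hb1 : 1 ≤ b := by omega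
  have huv : degreeOf t u = degreeOf t v := by nlinarith
  have hpos : 0 < degreeOf t v := by omega
  rw [huv] at h1 h2
  have : a = 1 := by nlinarith
  have : b = 1 := by nlinarith
  subst_vars
  simp at hab

end Binomial

section BinaryForms

universe u

variable {k : Type u} [Field k]

theorem weight_fin_two (w : Fin 2 → ℚ) (d : Fin 2 →₀ ℕ) :
    Finsupp.weight w d = d 0 * w 0 + d 1 * w 1 := by
  rw [Finsupp.weight_apply, Finsupp.sum_fintype _ _ (by simp), Fin.sum_univ_two, nsmul_eq_mul,
    nsmul_eq_mul]

theorem IsWeightedHomogeneous.exists_polynomial {a b g : ℕ} (ha : a ≠ 0) (hg : g ≠ 0)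
    (hab : a.Coprime b) {r : ℚ} {F : MvPolynomial (Fin 2) k} (hF : F ≠ 0)
    (h : IsWeightedHomogeneous ![((b * g : ℕ) : ℚ), ((a * g : ℕ) : ℚ)] F r) :
    ∃ (i j : ℕ) (q : Polynomial k), q ≠ 0 ∧
      ∀ (R : Type u) [CommRing R] [Algebra k R] (x y z : R), x ^ a = z * y ^ b →
        aeval ![x, y] F = x ^ i * y ^ j * Polynomial.aeval z q := by
  have hpar : ∀ d ∈ F.support, ∀ e ∈ F.support,
      d 0 % a = e 0 % a ∧ d 1 + b * (d 0 / a) = e 1 + b * (e 0 / a) := by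
    intro d hd e he
    have hde := (h (mem_support_iff.1 hd)).trans (h (mem_support_iff.1 he)).symm
    simp only [weight_fin_two, Matrix.cons_val_zero, Matrix.cons_val_one] at hde
    have hde' : b * d 0 + a * d 1 = b * e 0 + a * e 1 := by
      have : d 0 * (b * g) + d 1 * (a * g) = e 0 * (b * g) + e 1 * (a * g) := by exact_mod_cast hde
      refine Nat.eq_of_mul_eq_mul_right (Nat.pos_of_ne_zero hg) ?_
      linarith
    have hmod : d 0 % a = e 0 % a := by
      have : b * d 0 ≡ b * e 0 [MOD a] := by
        have h1 : (b * d 0 + a * d 1) % a = (b * e 0 + a * e 1) % a := by rw [hde']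
        simpa [Nat.ModEq] using h1
      exact Nat.ModEq.cancel_left_of_coprime hab this
    refine ⟨hmod, Nat.eq_of_mul_eq_mul_left (Nat.pos_of_ne_zero ha) ?_⟩
    have hd0 := Nat.mod_add_div (d 0) a
    have he0 := Nat.mod_add_div (e 0) a
    rw [← hd0, ← he0, hmod] at hde'
    linarith
  obtain ⟨d₀, hd₀⟩ := support_nonempty.2 hF
  refine ⟨d₀ 0 % a, d₀ 1 + b * (d₀ 0 / a),
    ∑ d ∈ F.support, Polynomial.monomial (d 0 / a) (coeff d F), fun h0 => ?_, ?_⟩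
  · have := congrArg (Polynomial.coeff · (d₀ 0 / a)) h0
    simp only [Polynomial.finsetSum_coeff, Polynomial.coeff_monomial, Polynomial.coeff_zero] at this
    rw [Finset.sum_eq_single d₀, if_pos rfl] at this
    · exact mem_support_iff.1 hd₀ this
    · intro d hd hne
      refine if_neg fun heq => hne ?_
      obtain ⟨h1, h2⟩ := hpar d hd d₀ hd₀
      rw [heq] at h2
      have h3 : d 0 = d₀ 0 := by
        rw [← Nat.mod_add_div (d 0) a, ← Nat.mod_add_div (d₀ 0) a, h1, heq]
      ext i
      fin_cases i
      · exact h3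
      · simpa using h2
    · exact fun hn => absurd hd₀ hn
  · intro R _ _ x y z hxyz
    conv_lhs => rw [F.as_sum]
    rw [map_sum, map_sum, Finset.mul_sum]
    refine Finset.sum_congr rfl fun d hd => ?_
    obtain ⟨h1, h2⟩ := hpar d hd d₀ hd₀
    rw [aeval_monomial, Polynomial.aeval_monomial, ← h1, ← h2,
      Finsupp.prod_fintype _ _ (by simp), Fin.prod_univ_two]
    simp only [Matrix.cons_val_zero, Matrix.cons_val_one]
    conv_lhs => rw [← Nat.mod_add_div (d 0) a, pow_add, pow_mul, hxyz]
    ring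

theorem exists_algebraMap_eq_of_isAlgebraic {σ : Type*} {z : FractionRing (MvPolynomial σ k)}
    (hz : IsAlgebraic k z) : ∃ p : MvPolynomial σ k, algebraMap _ _ p = z :=
  IsIntegrallyClosed.isIntegral_iff.1 (hz.isIntegral.tower_top (A := MvPolynomial σ k))

theorem exists_pow_eq_C_mul_pow {a b g : ℕ} (ha : a ≠ 0) (hg : g ≠ 0)
    (hab : a.Coprime b) {r : ℚ} {F : MvPolynomial (Fin 2) k} (hF : F ≠ 0)
    (h : IsWeightedHomogeneous ![((b * g : ℕ) : ℚ), ((a * g : ℕ) : ℚ)] F r)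
    {p q : MvPolynomial (Fin 2) k} (hp0 : p ≠ 0) (hq0 : q ≠ 0)
    (hp : IsWeightedHomogeneous 1 p ((b * g : ℕ) : ℚ))
    (hq : IsWeightedHomogeneous 1 q ((a * g : ℕ) : ℚ)) (hrel : aeval ![p, q] F = 0) :
    ∃ c : k, c ≠ 0 ∧ p ^ a = C c * q ^ b := by
  obtain ⟨i, j, f, hf0, hf⟩ := h.exists_polynomial ha hg hab hF
  set K := FractionRing (MvPolynomial (Fin 2) k)
  set ψ := algebraMap (MvPolynomial (Fin 2) k) K with hψ
  have hinj : Function.Injective ψ := IsFractionRing.injective _ _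
  have hψ0 {x : MvPolynomial (Fin 2) k} (hx : x ≠ 0) : ψ x ≠ 0 :=
    (map_ne_zero_iff _ hinj).2 hx
  have hz : ψ p ^ a = ψ p ^ a / ψ q ^ b * ψ q ^ b :=
    (div_mul_cancel₀ _ (pow_ne_zero _ (hψ0 hq0))).symm
  have hzero : aeval ![ψ p, ψ q] F = 0 := by
    have := congrArg (IsScalarTower.toAlgHom k (MvPolynomial (Fin 2) k) K) hrel
    rw [map_zero, comp_aeval_apply] at this
    rw [← this]
    congr 2
    ext i
    fin_cases i <;> rfl
  rw [hf K _ _ _ hz] at hzero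
  have halg : IsAlgebraic k (ψ p ^ a / ψ q ^ b) := by
    refine ⟨f, hf0, ?_⟩
    simpa [hψ0 hp0, hψ0 hq0] using hzero
  obtain ⟨s, hs⟩ := exists_algebraMap_eq_of_isAlgebraic halg
  have hpq : p ^ a = s * q ^ b := by
    apply hinj
    rw [map_mul, map_pow, map_pow, hs, ← hz]
  have hs0 : s ≠ 0 := by
    rintro rfl
    rw [zero_mul] at hpq
    exact pow_ne_zero _ hp0 hpq
  obtain ⟨d, s', -, hs'0, hs'⟩ := IsTopForm.exists_of_ne_zero (1 : Fin 2 → ℚ) hs0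
  have hd : Finsupp.weight (1 : Fin 2 → ℚ) d = 0 := by
    have h1 := hs'.mul (hq.isTopForm.pow b)
    rw [← hpq] at h1
    have h2 := (hp.isTopForm.pow a).weight_unique h1 (pow_ne_zero _ hp0)
      (mul_ne_zero hs'0 (pow_ne_zero _ hq0))
    push_cast at h2
    linarith
  have hsC : s = C (coeff 0 s) := by
    ext e
    rw [coeff_C]
    split_ifs with he
    · rw [he]
    · by_contra hne
      have := hs'.weight_le hne
      rw [hd] at this
      apply he
      simp only [weight_fin_two, Pi.one_apply, mul_one] at this
      have h3 : e 0 + e 1 ≤ 0 := by exact_mod_cast this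
      ext i
      fin_cases i <;> simp <;> omega
  refine ⟨coeff 0 s, fun h0 => hs0 ?_, hsC ▸ hpq⟩
  rw [hsC, h0, C_0]

theorem binomial_dvd_of_aeval_eq_zero {a b g : ℕ} (ha : a ≠ 0) (hg : g ≠ 0)
    (hab : a.Coprime b) {r : ℚ} {F : MvPolynomial (Fin 2) k} (hF : F ≠ 0)
    (h : IsWeightedHomogeneous ![((b * g : ℕ) : ℚ), ((a * g : ℕ) : ℚ)] F r)
    {p q : MvPolynomial (Fin 2) k} (hp0 : p ≠ 0) (hq0 : q ≠ 0) {c : k}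
    (hpq : p ^ a = C c * q ^ b) (hrel : aeval ![p, q] F = 0) :
    X 0 ^ a - C c * X 1 ^ b ∣ F := by
  obtain ⟨i, j, f, -, hf⟩ := h.exists_polynomial ha hg hab hF
  have hfc : f.eval c = 0 := by
    rw [hf _ _ _ _ hpq, ← algebraMap_eq, Polynomial.aeval_algebraMap_apply, algebraMap_eq] at hrel
    simpa [hp0, hq0] using hrel
  set I := Ideal.span {(X 0 ^ a - C c * X 1 ^ b : MvPolynomial (Fin 2) k)}
  rw [← Ideal.mem_span_singleton, ← Ideal.Quotient.eq_zero_iff_mem]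
  have hmk : Ideal.Quotient.mk I (X 0) ^ a =
      algebraMap k (MvPolynomial (Fin 2) k ⧸ I) c * Ideal.Quotient.mk I (X 1) ^ b := by
    rw [← sub_eq_zero, ← map_pow, ← map_pow,
      IsScalarTower.algebraMap_apply k (MvPolynomial (Fin 2) k) (MvPolynomial (Fin 2) k ⧸ I),
      Ideal.Quotient.algebraMap_eq, ← map_mul, ← map_sub, Ideal.Quotient.eq_zero_iff_mem]
    exact Ideal.subset_span rfl
  have := hf _ _ _ _ hmk
  rw [Polynomial.aeval_algebraMap_apply, Polynomial.coe_aeval_eq_eval, hfc, map_zero,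
    mul_zero] at this
  rw [← this]
  have hX : ![Ideal.Quotient.mk I (X 0), Ideal.Quotient.mk I (X 1)] =
      fun i => Ideal.Quotient.mkₐ k I (X i) := by
    ext i
    fin_cases i <;> rfl
  rw [hX, ← comp_aeval_apply, aeval_X_left_apply]
  rfl

end BinaryForms

section Deformation

variable {τ k : Type*} [Field k]

theorem weight_option_elim (w : τ → ℚ) (δ : ℚ) (d : Option τ →₀ ℕ) :
    Finsupp.weight (fun o : Option τ => o.elim δ w) d = d none * δ + Finsupp.weight w d.some := by
  induction d using Finsupp.induction_linear with
  | zero => simp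
  | add d e hd he =>
    simp only [map_add, hd, he, Finsupp.add_apply, Finsupp.some_add]
    push_cast
    ring
  | single o n => cases o <;> simp [Finsupp.weight_single]

theorem coeff_substZero {σ : Type*} [DecidableEq σ] {t : σ} (p : MvPolynomial σ k) {d : σ →₀ ℕ}
    (hd : d t = 0) : coeff d (substZero k t p) = coeff d p := by
  induction p using MvPolynomial.induction_on' with
  | add p q hp hq => simp [hp, hq]
  | monomial e c =>
    by_cases he : e t = 0
    · rw [substZero_eq_self]
      by_cases hc : c = 0
      · simp [hc]
      · rw [degreeOf_monomial_eq _ _ hc, he]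
    · have h0 : substZero k t (monomial e c) = 0 := by
        rw [substZero, aeval_monomial, Finsupp.prod,
          Finset.prod_eq_zero (Finsupp.mem_support_iff.2 he), mul_zero]
        simp [he]
      rw [h0, coeff_zero, coeff_monomial, if_neg]
      rintro rfl
      exact he hd

theorem isTopForm_rename_some {w : τ → ℚ} {δ r : ℚ} {p q : MvPolynomial τ k}
    (h : IsTopForm w r p q) :
    IsTopForm (fun o : Option τ => o.elim δ w) r (rename some p) (rename some q) := by
  rw [rename_eq_aeval]
  exact h.aeval fun i =>
    (isWeightedHomogeneous_X k (fun o : Option τ => o.elim δ w) (some i)).isTopForm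

variable [DecidableEq τ]

/-- A nontrivial deformation of the identity can be given a weight in the deformation parameter
for which it has a nontrivial homogeneous part. -/
theorem exists_isTopForm_deformation [Fintype τ] (w : τ → ℚ) {f : τ → MvPolynomial (Option τ) k}
    (hf : ∀ i, substZero k none (f i) = X (some i)) (hne : ∃ i, degreeOf none (f i) ≠ 0) :
    ∃ (δ : ℚ) (g : τ → MvPolynomial (Option τ) k),
      (∀ i, IsTopForm (fun o : Option τ => o.elim δ w) (w i) (f i) (g i)) ∧
        ∃ i, degreeOf none (g i) ≠ 0 := by
  set S : Finset ℚ := Finset.univ.biUnion fun i =>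
    ((f i).support.filter fun d => d none ≠ 0).image fun d =>
      (w i - Finsupp.weight w d.some) / d none with hS
  have hSmem {x : ℚ} : x ∈ S ↔ ∃ i d, coeff d (f i) ≠ 0 ∧ d none ≠ 0 ∧
      (w i - Finsupp.weight w d.some) / d none = x := by
    simp [hS, and_assoc]
  have hSne : S.Nonempty := by
    obtain ⟨i, hi⟩ := hne
    have : ∃ d ∈ (f i).support, d none ≠ 0 := by
      by_contra! hall
      exact hi (Nat.le_zero.1 (degreeOf_le_iff.2 fun d hd => (hall d hd).le))
    obtain ⟨d, hd, hd0⟩ := this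
    exact ⟨_, hSmem.2 ⟨i, d, mem_support_iff.1 hd, hd0, rfl⟩⟩
  set δ := S.min' hSne with hδ
  have htop : ∀ i, IsTopForm (fun o : Option τ => o.elim δ w) (w i) (f i)
      (weightedHomogeneousComponent (fun o : Option τ => o.elim δ w) (w i) (f i)) := by
    refine fun i => IsTopForm.of_forall_weight_le fun d hd => ?_
    rw [weight_option_elim]
    by_cases hd0 : d none = 0
    · rw [← coeff_substZero (f i) hd0, hf, coeff_X] at hd
      have hd' : Finsupp.single (some i) 1 = d := by
        by_contra hcon
        simp [hcon] at hd
      subst hd'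
      simp [Finsupp.weight_single]
    · have h1 : δ ≤ (w i - Finsupp.weight w d.some) / d none :=
        S.min'_le _ (hSmem.2 ⟨i, d, hd, hd0, rfl⟩)
      rw [le_div_iff₀ (by positivity)] at h1
      linarith
  refine ⟨δ, _, htop, ?_⟩
  obtain ⟨i, d, hd, hd0, hdδ⟩ := hSmem.1 (S.min'_mem hSne)
  refine ⟨i, fun h0 => hd0 (Nat.le_zero.1 (h0 ▸ degreeOf_le_iff.1 le_rfl d ?_))⟩
  rw [mem_support_iff, (htop i).coeff_eq]
  · exact hd
  · rw [weight_option_elim, hδ, ← hdδ]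
    field_simp
    ring

theorem degreeOf_none_rename_some (p : MvPolynomial τ k) : degreeOf none (rename some p) = 0 := by
  rw [degreeOf_def, Multiset.count_eq_zero, degrees_rename_of_injective (Option.some_injective _)]
  simp

theorem substZero_top {w : τ → ℚ} {δ : ℚ} {i : τ} {p q : MvPolynomial (Option τ) k}
    (h : IsTopForm (fun o : Option τ => o.elim δ w) (w i) p q)
    (hp : substZero k none p = X (some i)) : substZero k none q = X (some i) := by
  have h1 : IsTopForm (fun o : Option τ => o.elim δ w) (w i) (substZero k none p)
      (substZero k none q) := by
    refine h.aeval fun o => ?_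
    cases o with
    | none => simpa using (isWeightedHomogeneous_zero k _ _).isTopForm
    | some j =>
      simpa using (isWeightedHomogeneous_X k (fun o : Option τ => o.elim δ w) (some j)).isTopForm
  rw [hp] at h1
  exact h1.unique
    (isWeightedHomogeneous_X k (fun o : Option τ => o.elim δ w) (some i)).isTopForm

/-- For a coordinate of an automorphism, there is a nontrivial deformation of the identity fixing
that coordinate. -/
theorem exists_deformation (σ : MvPolynomial τ k ≃ₐ[k] MvPolynomial τ k) {i j : τ} (hij : i ≠ j) :
    ∃ f : τ → MvPolynomial (Option τ) k, (∀ l, substZero k none (f l) = X (some l)) ∧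
      (∃ l, degreeOf none (f l) ≠ 0) ∧ aeval f (σ (X i)) = rename some (σ (X i)) := by
  set φ : MvPolynomial τ k →ₐ[k] MvPolynomial (Option τ) k :=
    (aeval fun l => rename some (σ (X l)) + if l = j then X none else 0).comp
      σ.symm.toAlgHom with hφ
  have hφσ (l : τ) : φ (σ (X l)) = rename some (σ (X l)) + if l = j then X none else 0 := by
    simp [hφ]
  have hsub : (substZero k none).comp φ = rename some := by
    have : ((substZero k none).comp φ).comp σ.toAlgHom = (rename some).comp σ.toAlgHom := by
      ext1 l
      simp only [AlgHom.comp_apply, AlgEquiv.toAlgHom_apply, hφσ, map_add,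
        substZero_eq_self (degreeOf_none_rename_some (σ (X l)))]
      split_ifs <;> simp
    ext1 l
    have := DFunLike.congr_fun this (σ.symm (X l))
    simpa using this
  have hφX : aeval (fun l => φ (X l)) = φ := by
    ext1 l
    simp
  refine ⟨fun l => φ (X l), fun l => ?_, ?_, ?_⟩
  · have := DFunLike.congr_fun hsub (X l)
    simpa using this
  · by_contra! hall
    have heq : φ = rename some := by
      rw [← hsub]
      ext1 l
      exact (substZero_eq_self (hall l)).symm
    have := hφσ j
    rw [heq, if_pos rfl, left_eq_add] at this
    exact X_ne_zero _ this
  · rw [hφX, hφσ, if_neg hij, add_zero]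

theorem binomial_exponent_eq_one [Fintype τ] (σ : MvPolynomial τ k ≃ₐ[k] MvPolynomial τ k)
    {i i' j j' : τ}
    (hi : i ≠ i') (hj : j ≠ j') {w : τ → ℚ} {r : ℚ} {F : MvPolynomial τ k} (hF0 : F ≠ 0)
    (hF : IsTopForm w r (σ (X i)) F) {a b : ℕ} (ha : a ≠ 0) (hb : b ≠ 0) (hab : a.Coprime b)
    {c : k} (hc : c ≠ 0)
    (hall : ∀ l, l = j ∨ l = j') (hdvd : X j ^ a - C c * X j' ^ b ∣ F) : a = 1 ∨ b = 1 := by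
  obtain ⟨f, hf, hfne, hfix⟩ := exists_deformation σ hi
  obtain ⟨δ, g, hg, hgne⟩ := exists_isTopForm_deformation w hf hfne
  have hgF : aeval g F = rename some F := by
    have := hF.aeval hg
    rw [hfix] at this
    exact this.unique (isTopForm_rename_some hF)
  have hsub l : substZero k none (g l) = X (some l) := substZero_top (hg l) (hf l)
  obtain ⟨R, rfl⟩ := hdvd
  have hne : rename some ((X j ^ a - C c * X j' ^ b) * R) ≠ (0 : MvPolynomial (Option τ) k) :=
    (map_ne_zero_iff _ (rename_injective _ (Option.some_injective _))).2 hF0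
  have hdeg : degreeOf none (aeval g (X j ^ a - C c * X j' ^ b)) = 0 := by
    have h0 := degreeOf_none_rename_some ((X j ^ a - C c * X j' ^ b) * R)
    rw [← hgF, map_mul] at hne h0
    rw [degreeOf_mul_eq (left_ne_zero_of_mul hne) (right_ne_zero_of_mul hne)] at h0
    exact (Nat.add_eq_zero_iff.1 h0).1
  have hbin := substZero_eq_self hdeg
  have hsubC : substZero k (none : Option τ) (C c) = C c := AlgHom.commutes _ c
  simp only [map_sub, map_mul, map_pow, aeval_X, aeval_C, algebraMap_eq, hsub, hsubC] at hbin
  refine eq_one_of_binomial_eq (by simp) (by simp) (by simpa using hj) (hsub j) (hsub j') ?_ hc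
    ha hb hab hbin.symm
  obtain ⟨l, hl⟩ := hgne
  rcases hall l with rfl | rfl
  · exact Or.inl hl
  · exact Or.inr hl

end Deformation

end MvPolynomial

section Subgroups

variable {R : Type*} [CommRing R]

theorem PolyAut.apply_C (σ : PolyAut R) (c : R) : σ (C c) = C c := σ.commutes c

theorem PolyAut.inv_apply_eq {σ : PolyAut R} {p q : MvPolynomial (Fin 2) R} (h : σ q = p) :
    σ⁻¹ p = q :=
  (AlgEquiv.symm_apply_eq σ).2 h.symm

theorem mem_affineSubgroup {σ : PolyAut R} : σ ∈ AffineSubgroup R ↔ IsAffine σ := by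
  refine ⟨fun h => ?_, fun h => Subgroup.subset_closure h⟩
  induction h using Subgroup.closure_induction with
  | mem σ h => exact h
  | one => exact ⟨1, 0, 0, 0, 1, 0, by simp, by simp, by simp⟩
  | mul σ τ _ _ hσ hτ =>
    obtain ⟨a₁, b₁, c₁, a₂, b₂, c₂, hu, h0, h1⟩ := hσ
    obtain ⟨a₁', b₁', c₁', a₂', b₂', c₂', hu', h0', h1'⟩ := hτ
    refine ⟨a₁' * a₁ + b₁' * a₂, a₁' * b₁ + b₁' * b₂, a₁' * c₁ + b₁' * c₂ + c₁',
      a₂' * a₁ + b₂' * a₂, a₂' * b₁ + b₂' * b₂, a₂' * c₁ + b₂' * c₂ + c₂', ?_, ?_, ?_⟩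
    · convert hu.mul hu' using 1
      ring
    · simp only [AlgEquiv.mul_apply, h0', map_add, map_mul, PolyAut.apply_C, h0, h1]
      ring
    · simp only [AlgEquiv.mul_apply, h1', map_add, map_mul, PolyAut.apply_C, h0, h1]
      ring
  | inv σ _ hσ =>
    obtain ⟨a₁, b₁, c₁, a₂, b₂, c₂, hu, h0, h1⟩ := hσ
    obtain ⟨e, he⟩ := hu.exists_right_inv
    have he' : (C a₁ * C b₂ - C a₂ * C b₁) * C e = (1 : MvPolynomial (Fin 2) R) := by
      simp only [← C_mul, ← C_sub, he, C_1]
    refine ⟨e * b₂, -(e * b₁), e * (b₁ * c₂ - b₂ * c₁), -(e * a₂), e * a₁,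
      e * (a₂ * c₁ - a₁ * c₂), ?_, PolyAut.inv_apply_eq ?_, PolyAut.inv_apply_eq ?_⟩
    · convert IsUnit.of_mul_eq_one_right _ he using 1
      linear_combination e * he
    · simp only [map_add, map_mul, map_neg, map_sub, PolyAut.apply_C, h0, h1]
      linear_combination X 0 * he'
    · simp only [map_add, map_mul, map_neg, map_sub, PolyAut.apply_C, h0, h1]
      linear_combination X 1 * he'

theorem PolyAut.apply_mem_adjoin_X {σ : PolyAut R} {i : Fin 2}
    (hσ : σ (X i) ∈ Algebra.adjoin R {(X i : MvPolynomial (Fin 2) R)})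
    {p : MvPolynomial (Fin 2) R} (hp : p ∈ Algebra.adjoin R {(X i : MvPolynomial (Fin 2) R)}) :
    σ p ∈ Algebra.adjoin R {(X i : MvPolynomial (Fin 2) R)} := by
  have h : Algebra.adjoin R {(X i : MvPolynomial (Fin 2) R)} ≤
      (Algebra.adjoin R {(X i : MvPolynomial (Fin 2) R)}).comap σ.toAlgHom :=
    Algebra.adjoin_le (by simpa using hσ)
  exact h hp

theorem linear_mem_adjoin_X (i : Fin 2) (b c : R) :
    C b * X i + C c ∈ Algebra.adjoin R {(X i : MvPolynomial (Fin 2) R)} :=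
  add_mem (mul_mem (Subalgebra.algebraMap_mem _ b) (Algebra.self_mem_adjoin_singleton R _))
    (Subalgebra.algebraMap_mem _ c)

theorem mem_triangularSubgroup {σ : PolyAut R} : σ ∈ TriangularSubgroup R ↔ IsTriangular σ := by
  refine ⟨fun h => ?_, fun h => Subgroup.subset_closure h⟩
  induction h using Subgroup.closure_induction with
  | mem σ h => exact h
  | one => exact ⟨1, 1, 0, 0, zero_mem _, by simp, by simp⟩
  | mul σ τ _ _ hσ hτ =>
    obtain ⟨a, b, c, h, hh, h0, h1⟩ := hσ
    obtain ⟨a', b', c', h', hh', h0', h1'⟩ := hτ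
    refine ⟨a' * a, b' * b, b' * c + c', C (a' : R) * h + σ h',
      add_mem (mul_mem (Subalgebra.algebraMap_mem _ _) hh)
        (PolyAut.apply_mem_adjoin_X (h1 ▸ linear_mem_adjoin_X 1 _ _) hh'), ?_, ?_⟩
    · simp only [AlgEquiv.mul_apply, h0', map_add, map_mul, PolyAut.apply_C, h0, Units.val_mul]
      ring
    · simp only [AlgEquiv.mul_apply, h1', map_add, map_mul, PolyAut.apply_C, h1, Units.val_mul]
      ring
  | inv σ _ hσ =>
    obtain ⟨a, b, c, h, hh, h0, h1⟩ := hσ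
    have ha : C (a : R) * C ((a⁻¹ : Rˣ) : R) = (1 : MvPolynomial (Fin 2) R) := by
      rw [← C_mul, Units.mul_inv, C_1]
    have hb : C (b : R) * C ((b⁻¹ : Rˣ) : R) = (1 : MvPolynomial (Fin 2) R) := by
      rw [← C_mul, Units.mul_inv, C_1]
    have h1' : σ⁻¹ (X 1) = C ((b⁻¹ : Rˣ) : R) * X 1 + C (-((b⁻¹ : Rˣ) : R) * c) := by
      refine PolyAut.inv_apply_eq ?_
      simp only [map_add, map_mul, map_neg, PolyAut.apply_C, h1]
      linear_combination X 1 * hb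
    have hs : σ (σ⁻¹ h) = h := AlgEquiv.apply_symm_apply σ h
    refine ⟨a⁻¹, b⁻¹, _, C (-((a⁻¹ : Rˣ) : R)) * σ⁻¹ h,
      mul_mem (Subalgebra.algebraMap_mem _ _)
        (PolyAut.apply_mem_adjoin_X (h1' ▸ linear_mem_adjoin_X 1 _ _) hh),
      PolyAut.inv_apply_eq ?_, h1'⟩
    simp only [map_add, map_mul, map_neg, PolyAut.apply_C, h0, hs]
    linear_combination X 0 * ha

end Subgroups

section Generation

variable {k : Type*} [Field k]

theorem eq_zero_of_linear_eq_C {a b c : k}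
    (h : C a * X 0 + C b * X 1 = (C c : MvPolynomial (Fin 2) k)) : a = 0 ∧ b = 0 := by
  have h0 := congrArg (aeval (R := k) ![(1 : k), 0]) h
  have h1 := congrArg (aeval (R := k) ![(0 : k), 1]) h
  have h2 := congrArg (aeval (R := k) ![(0 : k), 0]) h
  simp at h0 h1 h2
  exact ⟨h0.trans h2.symm, h1.trans h2.symm⟩

theorem eq_linear_of_weight_le_one {m n : ℕ} (hm : m ≠ 0) (hn : n ≠ 0)
    {p : MvPolynomial (Fin 2) k}
    (h : ∀ d, coeff d p ≠ 0 → Finsupp.weight ![(m : ℚ), (n : ℚ)] d ≤ 1) :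
    ∃ a b c : k, p = C a * X 0 + C b * X 1 + C c := by
  refine ⟨coeff (Finsupp.single 0 1) p, coeff (Finsupp.single 1 1) p, coeff 0 p, ?_⟩
  ext d
  simp only [coeff_add, coeff_C_mul, coeff_X, coeff_C]
  by_cases hd : coeff d p = 0
  · split_ifs <;> simp_all
  · have h1 := h d hd
    rw [weight_fin_two] at h1
    simp only [Matrix.cons_val_zero, Matrix.cons_val_one] at h1
    have h2 : d 0 * m + d 1 * n ≤ 1 := by exact_mod_cast h1
    have h3 : d 0 + d 1 ≤ 1 := le_trans
      (add_le_add (Nat.le_mul_of_pos_right _ (Nat.pos_of_ne_zero hm))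
        (Nat.le_mul_of_pos_right _ (Nat.pos_of_ne_zero hn))) h2
    have key : d = Finsupp.single 0 1 ∨ d = Finsupp.single 1 1 ∨ d = 0 := by
      rcases Nat.eq_zero_or_pos (d 0) with h | h
      · rcases Nat.eq_zero_or_pos (d 1) with h' | h'
        · right; right
          ext i; fin_cases i <;> simp [h, h']
        · right; left
          ext i; fin_cases i
          · simp [h]
          · simp; omega
      · left
        ext i; fin_cases i
        · simp; omega
        · simp; omega
    rcases key with rfl | rfl | rfl <;> simp [Finsupp.single_eq_single_iff, eq_comm]

theorem isAffine_of_linear {σ : PolyAut k} {a₁ b₁ c₁ a₂ b₂ c₂ : k}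
    (h0 : σ (X 0) = C a₁ * X 0 + C b₁ * X 1 + C c₁)
    (h1 : σ (X 1) = C a₂ * X 0 + C b₂ * X 1 + C c₂) : IsAffine σ := by
  refine ⟨a₁, b₁, c₁, a₂, b₂, c₂, isUnit_iff_ne_zero.2 fun hdet => ?_, h0, h1⟩
  have hdet' : C a₁ * C b₂ - C a₂ * C b₁ = (0 : MvPolynomial (Fin 2) k) := by
    simp only [← C_mul, ← C_sub, hdet, C_0]
  have hb := eq_zero_of_linear_eq_C (a := b₂) (b := -b₁) (c := b₂ * c₁ - b₁ * c₂) (σ.injective (by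
    simp only [map_add, map_mul, map_neg, map_sub, PolyAut.apply_C, h0, h1]
    linear_combination X 0 * hdet'))
  have ha := eq_zero_of_linear_eq_C (a := a₂) (b := -a₁) (c := a₂ * c₁ - a₁ * c₂) (σ.injective (by
    simp only [map_add, map_mul, map_neg, map_sub, PolyAut.apply_C, h0, h1]
    linear_combination - X 1 * hdet'))
  have hx := eq_zero_of_linear_eq_C (a := (1 : k)) (b := 0) (c := c₁) (σ.injective (by
    simp [PolyAut.apply_C, h0, neg_eq_zero.1 ha.2, neg_eq_zero.1 hb.2]))
  exact one_ne_zero hx.1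

theorem exists_isTopForm_one {p : MvPolynomial (Fin 2) k} (hp : p ≠ 0) :
    ∃ (m : ℕ) (q : MvPolynomial (Fin 2) k), q ≠ 0 ∧ IsTopForm 1 (m : ℚ) p q := by
  obtain ⟨d, q, -, hq, h⟩ := IsTopForm.exists_of_ne_zero 1 hp
  refine ⟨d 0 + d 1, q, hq, ?_⟩
  rw [weight_fin_two] at h
  simpa using h

theorem PolyAut.apply_X_ne_zero (σ : PolyAut k) (i : Fin 2) : σ (X i) ≠ 0 :=
  (map_ne_zero_iff σ σ.injective).2 (X_ne_zero i)

theorem PolyAut.apply_X_ne_C (σ : PolyAut k) (i : Fin 2) (c : k) : σ (X i) ≠ C c := by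
  rw [← PolyAut.apply_C σ c, σ.injective.ne_iff]
  intro h
  have := congrArg totalDegree h
  simp at this

theorem PolyAut.weight_ne_zero {σ : PolyAut k} {i : Fin 2} {m : ℕ} {q : MvPolynomial (Fin 2) k}
    (h : IsTopForm 1 (m : ℚ) (σ (X i)) q) : m ≠ 0 := by
  rintro rfl
  refine σ.apply_X_ne_C i (coeff 0 (σ (X i))) ?_
  ext d
  rw [coeff_C]
  split_ifs with hd
  · rw [hd]
  · by_contra hne
    have := h.weight_le hne
    rw [weight_fin_two] at this
    simp only [Pi.one_apply, mul_one, Nat.cast_zero] at this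
    have h0 : d 0 + d 1 ≤ 0 := by exact_mod_cast this
    exact hd (by ext i; fin_cases i <;> simp <;> omega)

theorem PolyAut.aeval_apply_X (σ : PolyAut k) (p : MvPolynomial (Fin 2) k) :
    aeval ![σ (X 0), σ (X 1)] p = σ p := by
  have : aeval ![σ (X 0), σ (X 1)] = (σ : MvPolynomial (Fin 2) k →ₐ[k] _) :=
    MvPolynomial.algHom_ext fun i => by fin_cases i <;> simp
  exact DFunLike.congr_fun this p

theorem PolyAut.exists_eq_C_mul_pow {σ : PolyAut k} {m n : ℕ} {f g F : MvPolynomial (Fin 2) k}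
    {r : ℚ} {i : Fin 2} (hf0 : f ≠ 0) (hg0 : g ≠ 0) (hF0 : F ≠ 0)
    (hf : IsTopForm 1 (m : ℚ) (σ (X 0)) f) (hg : IsTopForm 1 (n : ℚ) (σ (X 1)) g)
    (hF : IsTopForm ![(m : ℚ), (n : ℚ)] r (σ⁻¹ (X i)) F) (hr : 1 < r) :
    ∃ (c : k) (b : ℕ), (f = C c * g ^ b ∧ m = b * n) ∨ (g = C c * f ^ b ∧ n = b * m) := by
  have hm := PolyAut.weight_ne_zero hf
  have hn := PolyAut.weight_ne_zero hg
  obtain ⟨b, a, hab, hmb, hna⟩ := Nat.exists_coprime m n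
  set e := Nat.gcd m n
  have he : e ≠ 0 := fun h => hm (by rw [hmb, h, mul_zero])
  have hb : b ≠ 0 := fun h => hm (by rw [hmb, h, zero_mul])
  have ha : a ≠ 0 := fun h => hn (by rw [hna, h, zero_mul])
  clear_value e
  subst hmb hna
  have hrel : aeval ![f, g] F = 0 := by
    have h1 := IsTopForm.aeval (w := 1) (f := ![σ (X 0), σ (X 1)]) (g := ![f, g])
      (fun i => by fin_cases i; exacts [hf, hg]) hF
    rw [PolyAut.aeval_apply_X, show σ (σ⁻¹ (X i)) = X i from AlgEquiv.apply_symm_apply σ _] at h1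
    refine h1.unique (IsTopForm.mono (r := 1) (q := X i) ?_ hr)
    exact IsWeightedHomogeneous.isTopForm
      (by simpa using isWeightedHomogeneous_X k (1 : Fin 2 → ℚ) i)
  obtain ⟨c, hc, hfg⟩ := exists_pow_eq_C_mul_pow ha he hab.symm hF0 hF.1 hf0 hg0 hf.1 hg.1 hrel
  have hdvd := binomial_dvd_of_aeval_eq_zero ha he hab.symm hF0 hF.1 hf0 hg0 hfg hrel
  obtain ⟨i', hi'⟩ := exists_ne i
  have := binomial_exponent_eq_one σ⁻¹ hi'.symm (zero_ne_one (α := Fin 2)) hF0 hF ha hb hab.symm hc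
    (fun l => by fin_cases l <;> simp) hdvd
  rcases this with rfl | rfl
  · exact ⟨c, b, Or.inl ⟨by simpa using hfg, by ring⟩⟩
  · refine ⟨c⁻¹, a, Or.inr ⟨?_, by ring⟩⟩
    rw [hfg, pow_one, ← mul_assoc, ← C_mul, inv_mul_cancel₀ hc, C_1, one_mul]

/-- The elementary automorphism `x₁ ↦ x₁ + c x₂ ^ b`, `x₂ ↦ x₂`. -/
noncomputable def elementaryAut (c : k) (b : ℕ) : PolyAut k :=
  AlgEquiv.ofAlgHom (aeval ![X 0 + C c * X 1 ^ b, X 1]) (aeval ![X 0 - C c * X 1 ^ b, X 1])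
    (MvPolynomial.algHom_ext fun i => by fin_cases i <;> simp [algebraMap_eq])
    (MvPolynomial.algHom_ext fun i => by fin_cases i <;> simp [algebraMap_eq])

theorem elementaryAut_X_zero (c : k) (b : ℕ) : elementaryAut c b (X 0) = X 0 + C c * X 1 ^ b := by
  simp [elementaryAut]

theorem elementaryAut_X_one (c : k) (b : ℕ) : elementaryAut c b (X 1) = X 1 := by
  simp [elementaryAut]

theorem elementaryAut_mem (c : k) (b : ℕ) : elementaryAut c b ∈ TriangularSubgroup k :=
  mem_triangularSubgroup.2 ⟨1, 1, 0, C c * X 1 ^ b,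
    mul_mem (Subalgebra.algebraMap_mem _ c) (pow_mem (Algebra.self_mem_adjoin_singleton k _) b),
    by simp [elementaryAut_X_zero], by simp [elementaryAut_X_one]⟩

/-- The automorphism exchanging the two variables. -/
noncomputable def swapAut (k : Type*) [Field k] : PolyAut k := renameEquiv k (Equiv.swap 0 1)

theorem swapAut_X_zero : swapAut k (X 0) = X 1 := by simp [swapAut]

theorem swapAut_X_one : swapAut k (X 1) = X 0 := by simp [swapAut]

theorem swapAut_mem : swapAut k ∈ AffineSubgroup k :=
  mem_affineSubgroup.2 ⟨0, 1, 0, 1, 0, 0, by simp, by simp [swapAut_X_zero],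
    by simp [swapAut_X_one]⟩

theorem PolyAut.exists_lt_isTopForm {σ : PolyAut k} {m n b : ℕ} {c : k}
    {f g : MvPolynomial (Fin 2) k} (hf : IsTopForm 1 (m : ℚ) (σ (X 0)) f)
    (hg : IsTopForm 1 (n : ℚ) (σ (X 1)) g) (hfg : f = C c * g ^ b) (hmn : m = b * n) :
    ∃ m' < m, ∃ f', f' ≠ 0 ∧ IsTopForm 1 (m' : ℚ) ((σ * elementaryAut (-c) b) (X 0)) f' := by
  obtain ⟨m', f', hf'0, hf'⟩ := exists_isTopForm_one ((σ * elementaryAut (-c) b).apply_X_ne_zero 0)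
  refine ⟨m', ?_, f', hf'0, hf'⟩
  have h : (σ * elementaryAut (-c) b) (X 0) = σ (X 0) - C c * σ (X 1) ^ b := by
    rw [AlgEquiv.mul_apply, elementaryAut_X_zero]
    simp only [map_add, map_mul, map_pow, map_neg, PolyAut.apply_C]
    ring
  have hlt : (σ * elementaryAut (-c) b) (X 0) ∈ weightLT k 1 (m : ℚ) := by
    have hgb := (hg.pow b).C_mul c
    rw [← hfg, ← Nat.cast_mul, ← hmn] at hgb
    have := (hf.sub hgb).2
    rwa [sub_self, sub_zero, ← h] at this
  obtain ⟨d, hd, hdm⟩ := hf'.exists_coeff_ne_zero hf'0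
  have := mem_weightLT.1 hlt d hd
  rw [hdm] at this
  exact_mod_cast this

theorem PolyAut.isAffine_of_weight_le {σ : PolyAut k} {m n : ℕ} (hm : m ≠ 0) (hn : n ≠ 0)
    (h : ∀ i d, coeff d (σ (X i)) ≠ 0 → Finsupp.weight ![(m : ℚ), (n : ℚ)] d ≤ 1) :
    IsAffine σ := by
  obtain ⟨_, _, _, h0⟩ := eq_linear_of_weight_le_one hm hn (h 0)
  obtain ⟨_, _, _, h1⟩ := eq_linear_of_weight_le_one hm hn (h 1)
  exact isAffine_of_linear h0 h1

theorem PolyAut.mem_sup_of_isTopForm (N : ℕ) : ∀ (σ : PolyAut k) (m n : ℕ)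
    (f g : MvPolynomial (Fin 2) k), f ≠ 0 → g ≠ 0 → IsTopForm 1 (m : ℚ) (σ (X 0)) f →
    IsTopForm 1 (n : ℚ) (σ (X 1)) g → m + n = N → σ ∈ AffineSubgroup k ⊔ TriangularSubgroup k := by
  induction N using Nat.strong_induction_on with
  | _ N ih =>
    intro σ m n f g hf0 hg0 hf hg hN
    have hρ (c : k) (b : ℕ) : elementaryAut c b ∈ AffineSubgroup k ⊔ TriangularSubgroup k :=
      Subgroup.mem_sup_right (elementaryAut_mem c b)
    have hs : swapAut k ∈ AffineSubgroup k ⊔ TriangularSubgroup k :=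
      Subgroup.mem_sup_left swapAut_mem
    by_cases hr : ∀ i d, coeff d (σ⁻¹ (X i)) ≠ 0 → Finsupp.weight ![(m : ℚ), (n : ℚ)] d ≤ 1
    · have := isAffine_of_weight_le (weight_ne_zero hf) (weight_ne_zero hg) hr
      exact Subgroup.mem_sup_left (inv_mem_iff.1 (mem_affineSubgroup.2 this))
    · push Not at hr
      obtain ⟨i, d, hd, hr⟩ := hr
      obtain ⟨e, F, -, hF0, hF⟩ := IsTopForm.exists_of_ne_zero ![(m : ℚ), (n : ℚ)]
        (apply_X_ne_zero σ⁻¹ i)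
      obtain ⟨c, b, ⟨hfg, hmn⟩ | ⟨hfg, hmn⟩⟩ :=
        exists_eq_C_mul_pow hf0 hg0 hF0 hf hg hF (hr.trans_le (hF.weight_le hd))
      · obtain ⟨m', hm', f', hf'0, hf'⟩ := exists_lt_isTopForm hf hg hfg hmn
        refine (Subgroup.mul_mem_cancel_right _ (hρ (-c) b)).1
          (ih (m' + n) (by omega) _ m' n f' g hf'0 hg0 hf' ?_ rfl)
        rwa [AlgEquiv.mul_apply, elementaryAut_X_one]
      · have hf₂ : IsTopForm 1 (m : ℚ) ((σ * swapAut k) (X 1)) f := by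
          rwa [AlgEquiv.mul_apply, swapAut_X_one]
        have hg₂ : IsTopForm 1 (n : ℚ) ((σ * swapAut k) (X 0)) g := by
          rwa [AlgEquiv.mul_apply, swapAut_X_zero]
        obtain ⟨n', hn', g', hg'0, hg'⟩ := exists_lt_isTopForm hg₂ hf₂ hfg hmn
        refine (Subgroup.mul_mem_cancel_right _ hs).1
          ((Subgroup.mul_mem_cancel_right _ (hρ (-c) b)).1 (ih (n' + m) (by omega) _ n' m g' f hg'0 hf0 hg' ?_ rfl))
        rwa [AlgEquiv.mul_apply, elementaryAut_X_one]

theorem affineSubgroup_sup_triangularSubgroup :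
    AffineSubgroup k ⊔ TriangularSubgroup k = ⊤ := by
  refine eq_top_iff.2 fun σ _ => ?_
  obtain ⟨m, f, hf0, hf⟩ := exists_isTopForm_one (σ.apply_X_ne_zero 0)
  obtain ⟨n, g, hg0, hg⟩ := exists_isTopForm_one (σ.apply_X_ne_zero 1)
  exact PolyAut.mem_sup_of_isTopForm _ σ m n f g hf0 hg0 hf hg rfl

end Generation

section NormalForms

variable {k : Type*} [Field k]

theorem totalDegree_polynomial_aeval {σ : Type*} {g : MvPolynomial σ k} (hg : g.totalDegree ≠ 0)
    {p : Polynomial k} (hp : p ≠ 0) :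
    Polynomial.aeval g p ≠ 0 ∧
      (Polynomial.aeval g p).totalDegree = p.natDegree * g.totalDegree := by
  induction h : p.natDegree generalizing p with
  | zero =>
    obtain ⟨c, rfl⟩ := Polynomial.natDegree_eq_zero.1 h
    have hc : c ≠ 0 := by simpa using hp
    simp [MvPolynomial.algebraMap_eq, hc]
  | succ n ih =>
    have hn : p.divX.natDegree = n := by
      rw [Polynomial.natDegree_divX_eq_natDegree_tsub_one, h, Nat.add_sub_cancel]
    have hq : p.divX ≠ 0 := fun hq => by
      rw [Polynomial.divX_eq_zero_iff.1 hq, Polynomial.natDegree_C] at h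
      omega
    obtain ⟨hq0, hdeg⟩ := ih hq hn
    have hg0 : g ≠ 0 := by rintro rfl; simp at hg
    have hmul : (Polynomial.aeval g p.divX * g).totalDegree = (n + 1) * g.totalDegree := by
      rw [totalDegree_mul_of_isDomain hq0 hg0, hdeg]
      ring
    have hpos : 0 < (n + 1) * g.totalDegree := by positivity
    have hsum : Polynomial.aeval g p = Polynomial.aeval g p.divX * g + C (p.coeff 0) := by
      conv_lhs => rw [← Polynomial.divX_mul_X_add p]
      simp [MvPolynomial.algebraMap_eq]
    have hfin : (Polynomial.aeval g p).totalDegree = (n + 1) * g.totalDegree := by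
      rw [hsum, totalDegree_add_eq_left_of_totalDegree_lt, hmul]
      rwa [totalDegree_C, hmul]
    refine ⟨fun h0 => ?_, hfin⟩
    rw [h0, totalDegree_zero] at hfin
    exact hpos.ne hfin

theorem totalDegree_C_mul_of_ne_zero {σ : Type*} {a : k} (ha : a ≠ 0) (p : MvPolynomial σ k) :
    (C a * p).totalDegree = p.totalDegree := by
  rcases eq_or_ne p 0 with rfl | hp
  · simp
  · rw [totalDegree_mul_of_isDomain (C_ne_zero.2 ha) hp, totalDegree_C, zero_add]

theorem totalDegree_C_mul_le {σ : Type*} (a : k) (p : MvPolynomial σ k) :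
    (C a * p).totalDegree ≤ p.totalDegree := by
  simpa using totalDegree_mul (C a) p

theorem PolyAut.totalDegree_apply_X_ne_zero (σ : PolyAut k) (i : Fin 2) :
    (σ (X i)).totalDegree ≠ 0 := fun h =>
  σ.apply_X_ne_C i _ (totalDegree_eq_zero_iff_eq_C.1 h)

theorem PolyAut.totalDegree_apply_X_of_mem_affineSubgroup {σ : PolyAut k}
    (h : σ ∈ AffineSubgroup k) (i : Fin 2) : (σ (X i)).totalDegree = 1 := by
  have key (a b c : k) :
      (C a * X 0 + C b * X 1 + C c : MvPolynomial (Fin 2) k).totalDegree ≤ 1 := by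
    refine (totalDegree_add _ _).trans (max_le ((totalDegree_add _ _).trans (max_le ?_ ?_)) ?_)
    · exact (totalDegree_C_mul_le _ _).trans (totalDegree_X _).le
    · exact (totalDegree_C_mul_le _ _).trans (totalDegree_X _).le
    · simp
  obtain ⟨a₁, b₁, c₁, a₂, b₂, c₂, -, h0, h1⟩ := mem_affineSubgroup.1 h
  refine le_antisymm ?_ (Nat.one_le_iff_ne_zero.2 (σ.totalDegree_apply_X_ne_zero i))
  fin_cases i
  · exact h0 ▸ key _ _ _
  · exact h1 ▸ key _ _ _

theorem exists_of_mem_triangularSubgroup_of_notMem {t : PolyAut k}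
    (ht : t ∈ TriangularSubgroup k) (ht' : t ∉ AffineSubgroup k) :
    ∃ (a b c : k) (p : Polynomial k), b ≠ 0 ∧ 2 ≤ p.natDegree ∧
      t (X 0) = C a * X 0 + Polynomial.aeval (X 1) p ∧ t (X 1) = C b * X 1 + C c := by
  obtain ⟨a, b, c, h, hh, h0, h1⟩ := mem_triangularSubgroup.1 ht
  rw [Algebra.adjoin_singleton_eq_range_aeval] at hh
  obtain ⟨p, rfl⟩ := hh
  refine ⟨a, b, c, p, b.ne_zero, ?_, h0, h1⟩
  by_contra hp
  obtain ⟨u, v, rfl⟩ := Polynomial.exists_eq_X_add_C_of_natDegree_le_one (p := p) (by omega)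
  refine ht' (mem_affineSubgroup.2 (isAffine_of_linear (a₁ := a) (b₁ := u) (c₁ := v)
    (a₂ := 0) (b₂ := b) (c₂ := c) ?_ ?_))
  · simp [h0, MvPolynomial.algebraMap_eq, add_assoc]
  · simp [h1]

theorem exists_of_mem_affineSubgroup_of_notMem {t : PolyAut k}
    (ht : t ∈ AffineSubgroup k) (ht' : t ∉ TriangularSubgroup k) :
    ∃ a₁ b₁ c₁ a₂ b₂ c₂ : k, a₂ ≠ 0 ∧
      t (X 0) = C a₁ * X 0 + C b₁ * X 1 + C c₁ ∧ t (X 1) = C a₂ * X 0 + C b₂ * X 1 + C c₂ := by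
  obtain ⟨a₁, b₁, c₁, a₂, b₂, c₂, hu, h0, h1⟩ := mem_affineSubgroup.1 ht
  refine ⟨a₁, b₁, c₁, a₂, b₂, c₂, ?_, h0, h1⟩
  rintro rfl
  rw [zero_mul, sub_zero, isUnit_iff_ne_zero, mul_ne_zero_iff] at hu
  refine ht' (mem_triangularSubgroup.2 ⟨Units.mk0 a₁ hu.1, Units.mk0 b₂ hu.2, c₂, _,
    linear_mem_adjoin_X 1 b₁ c₁, ?_, ?_⟩)
  · simp [h0, add_assoc]
  · simp [h1]

theorem PolyAut.totalDegree_lt_of_mul_triangular {s t : PolyAut k}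
    (hs : (s (X 0)).totalDegree ≤ (s (X 1)).totalDegree)
    (ht : t ∈ TriangularSubgroup k) (ht' : t ∉ AffineSubgroup k) :
    ((s * t) (X 1)).totalDegree < ((s * t) (X 0)).totalDegree := by
  obtain ⟨a, b, c, p, hb, hp, h0, h1⟩ := exists_of_mem_triangularSubgroup_of_notMem ht ht'
  have hpos := s.totalDegree_apply_X_ne_zero 1
  have hdeg := (totalDegree_polynomial_aeval hpos (p := p) (by rintro rfl; simp at hp)).2
  have hlt : (C a * s (X 0)).totalDegree < (Polynomial.aeval (s (X 1)) p).totalDegree := by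
    have := totalDegree_C_mul_le a (s (X 0))
    have := Nat.mul_le_mul_right (s (X 1)).totalDegree hp
    omega
  have h1' : ((s * t) (X 1)).totalDegree ≤ (s (X 1)).totalDegree := by
    rw [AlgEquiv.mul_apply, h1, map_add, map_mul, apply_C, apply_C]
    exact (totalDegree_add _ _).trans (max_le (totalDegree_C_mul_le _ _) (by simp))
  have h0' : ((s * t) (X 0)).totalDegree = (Polynomial.aeval (s (X 1)) p).totalDegree := by
    rw [AlgEquiv.mul_apply, h0, map_add, map_mul, apply_C, ← Polynomial.aeval_algHom_apply,
      totalDegree_add_eq_right_of_totalDegree_lt hlt]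
  have := Nat.mul_le_mul_right (s (X 1)).totalDegree hp
  omega

theorem PolyAut.totalDegree_le_of_mul_affine {s t : PolyAut k}
    (hs : (s (X 1)).totalDegree < (s (X 0)).totalDegree)
    (ht : t ∈ AffineSubgroup k) (ht' : t ∉ TriangularSubgroup k) :
    ((s * t) (X 0)).totalDegree ≤ ((s * t) (X 1)).totalDegree ∧
      1 < ((s * t) (X 1)).totalDegree := by
  obtain ⟨a₁, b₁, c₁, a₂, b₂, c₂, ha, h0, h1⟩ := exists_of_mem_affineSubgroup_of_notMem ht ht'
  have hpos := s.totalDegree_apply_X_ne_zero 1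
  have h1' : ((s * t) (X 1)).totalDegree = (s (X 0)).totalDegree := by
    simp only [AlgEquiv.mul_apply, h1, map_add, map_mul, apply_C, add_assoc]
    rw [totalDegree_add_eq_left_of_totalDegree_lt, totalDegree_C_mul_of_ne_zero ha]
    rw [totalDegree_C_mul_of_ne_zero ha]
    refine (totalDegree_add _ _).trans_lt (max_lt ((totalDegree_C_mul_le _ _).trans_lt hs) ?_)
    rw [totalDegree_C]
    omega
  have h0' : ((s * t) (X 0)).totalDegree ≤ (s (X 0)).totalDegree := by
    simp only [AlgEquiv.mul_apply, h0, map_add, map_mul, apply_C]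
    refine (totalDegree_add _ _).trans (max_le ((totalDegree_add _ _).trans (max_le ?_ ?_)) ?_)
    · exact totalDegree_C_mul_le _ _
    · exact (totalDegree_C_mul_le _ _).trans hs.le
    · simp
  omega

theorem mul_prod_ne_one (l : List (Σ b, AfTr k b)) :
    ∀ s : PolyAut k, (∀ x ∈ l, (x.2 : PolyAut k) ∉ HSubgroup k) →
      l.IsChain (fun x y => x.1 ≠ y.1) →
      ((s (X 1)).totalDegree < (s (X 0)).totalDegree ∧ (∀ x ∈ l.head?, x.1 ≠ false)) ∨
        (((s (X 0)).totalDegree ≤ (s (X 1)).totalDegree ∧ 1 < (s (X 1)).totalDegree) ∧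
          ∀ x ∈ l.head?, x.1 ≠ true) →
      s * (l.map fun x => (x.2 : PolyAut k)).prod ≠ 1 := by
  induction l with
  | nil =>
    rintro s - - (⟨h, -⟩ | ⟨h, -⟩) hs <;>
    · rw [List.map_nil, List.prod_nil, mul_one] at hs
      simp [hs] at h
  | cons x l ih =>
    intro s hl hc h
    rw [List.map_cons, List.prod_cons, ← mul_assoc]
    rw [List.isChain_cons] at hc
    refine ih _ (fun y hy => hl y (List.mem_cons_of_mem _ hy)) hc.2 ?_
    have hx := hl x List.mem_cons_self
    obtain ⟨b, x⟩ := x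
    cases b with
    | false =>
      refine Or.inl ⟨PolyAut.totalDegree_lt_of_mul_triangular ?_ x.2 fun h => hx ⟨h, x.2⟩,
        fun y hy => (hc.1 y hy).symm⟩
      rcases h with ⟨-, h⟩ | ⟨h, -⟩
      · simp at h
      · exact h.1
    | true =>
      refine Or.inr ⟨PolyAut.totalDegree_le_of_mul_affine ?_ x.2 fun h => hx ⟨x.2, h⟩,
        fun y hy => (hc.1 y hy).symm⟩
      rcases h with ⟨h, -⟩ | ⟨-, h⟩
      · exact h
      · simp at h

theorem mul_prod_ne_one_of_mem_affineSubgroup {s : PolyAut k} (hs : s ∈ AffineSubgroup k)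
    {x : TriangularSubgroup k} {l : List (Σ b, AfTr k b)}
    (hl : ∀ y ∈ (⟨false, x⟩ : Σ b, AfTr k b) :: l, (y.2 : PolyAut k) ∉ HSubgroup k)
    (hc : ((⟨false, x⟩ : Σ b, AfTr k b) :: l).IsChain (fun x y => x.1 ≠ y.1)) :
    s * (x * (l.map fun x => (x.2 : PolyAut k)).prod) ≠ 1 := by
  rw [← mul_assoc]
  rw [List.isChain_cons] at hc
  refine mul_prod_ne_one l _ (fun y hy => hl y (List.mem_cons_of_mem _ hy)) hc.2
    (Or.inl ⟨PolyAut.totalDegree_lt_of_mul_triangular ?_ x.2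
      fun h => hl _ List.mem_cons_self ⟨h, x.2⟩, fun y hy => (hc.1 y hy).symm⟩)
  rw [PolyAut.totalDegree_apply_X_of_mem_affineSubgroup hs,
    PolyAut.totalDegree_apply_X_of_mem_affineSubgroup hs]

theorem mul_prod_ne_one_of_mem_HSubgroup {h : PolyAut k} (hh : h ∈ HSubgroup k)
    {l : List (Σ b, AfTr k b)} (hne : l ≠ [])
    (hl : ∀ x ∈ l, (x.2 : PolyAut k) ∉ HSubgroup k)
    (hc : l.IsChain (fun x y => x.1 ≠ y.1)) :
    h * (l.map fun x => (x.2 : PolyAut k)).prod ≠ 1 := by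
  obtain _ | ⟨⟨b, x⟩, l⟩ := l
  · exact absurd rfl hne
  rw [List.map_cons, List.prod_cons]
  cases b with
  | false => exact mul_prod_ne_one_of_mem_affineSubgroup hh.1 hl hc
  | true =>
    obtain _ | ⟨⟨b, y⟩, l⟩ := l
    · intro h1
      rw [List.map_nil, List.prod_nil, mul_one] at h1
      exact hl _ List.mem_cons_self (eq_inv_of_mul_eq_one_right h1 ▸ inv_mem hh)
    · rw [List.isChain_cons_cons] at hc
      cases b with
      | true => exact absurd rfl hc.1
      | false =>
        rw [List.map_cons, List.prod_cons, ← mul_assoc]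
        exact mul_prod_ne_one_of_mem_affineSubgroup (mul_mem hh.1 x.2)
          (fun z hz => hl z (List.mem_cons_of_mem _ hz)) hc.2

theorem canonicalHom_of {b : Bool} (x : AfTr k b) :
    canonicalHom k (Monoid.PushoutI.of b x) = x :=
  Monoid.PushoutI.lift_of (fun b => (AfTr k b).subtype) (HSubgroup k).subtype
    (fun _ => Subgroup.subtype_comp_inclusion _) x

theorem canonicalHom_base (h : HSubgroup k) :
    canonicalHom k (Monoid.PushoutI.base (inclHom k) h) = h :=
  Monoid.PushoutI.lift_base (fun b => (AfTr k b).subtype) (HSubgroup k).subtype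
    (fun _ => Subgroup.subtype_comp_inclusion _) h

theorem canonicalHom_injective : Function.Injective (canonicalHom k) := by
  classical
  rw [injective_iff_map_eq_one]
  intro x hx
  obtain ⟨d⟩ := Monoid.PushoutI.NormalWord.transversal_nonempty (inclHom k)
    fun b => Subgroup.inclusion_injective _
  obtain ⟨w, rfl⟩ := (Monoid.PushoutI.NormalWord.equiv (d := d)).symm.surjective x
  change canonicalHom k w.prod = 1 at hx
  change w.prod = 1
  have hprod : canonicalHom k w.prod =
      w.head * (w.toList.map fun x => (x.2 : PolyAut k)).prod := by
    simp [canonicalHom_base, canonicalHom_of, Monoid.PushoutI.NormalWord.prod,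
      Monoid.CoprodI.Word.prod, map_list_prod, Function.comp_def]
  have hl : ∀ x ∈ w.toList, (x.2 : PolyAut k) ∉ HSubgroup k := by
    intro x hx hmem
    have hx1 : x.2 ∈ (inclHom k x.1).range := ⟨⟨x.2, hmem⟩, rfl⟩
    refine w.ne_one x hx ?_
    have := (d.compl x.1).1 (a₁ := (⟨x.2, hx1⟩, ⟨1, d.one_mem x.1⟩))
      (a₂ := (1, ⟨x.2, w.normalized x.1 x.2 hx⟩)) (by simp)
    exact (congrArg (fun z => (z.2 : AfTr k x.1)) this).symm
  by_cases hne : w.toList = []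
  · rw [hprod, hne, List.map_nil, List.prod_nil, mul_one, OneMemClass.coe_eq_one] at hx
    simp [Monoid.PushoutI.NormalWord.prod, Monoid.CoprodI.Word.prod, hne, hx]
  · exact absurd (hprod ▸ hx) (mul_prod_ne_one_of_mem_HSubgroup w.head.2 hne hl w.chain_ne)

theorem canonicalHom_surjective : Function.Surjective (canonicalHom k) := by
  rw [← MonoidHom.range_eq_top, eq_top_iff, ← affineSubgroup_sup_triangularSubgroup, sup_le_iff]
  exact ⟨fun σ hσ => ⟨_, canonicalHom_of (b := true) ⟨σ, hσ⟩⟩,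
    fun σ hσ => ⟨_, canonicalHom_of (b := false) ⟨σ, hσ⟩⟩⟩

end NormalForms

/-- Over a field `k`, `Aut(k[x₁,x₂])` is the free product of the subgroups of affine and
triangular automorphisms amalgamated over their intersection: the canonical homomorphism
`Af₂(k) *_{H(k)} Tr₂(k) →* Aut(k[x₁,x₂])` is a group isomorphism. -/
theorem aut_polynomial_algebra_rank_two_is_amalgamated_product
    (k : Type*) [Field k] : Function.Bijective (canonicalHom k) := by
  exact ⟨canonicalHom_injective, canonicalHom_surjective⟩
end

section
/- Let Φ be an integral domain, let B₀ = {(x₁ + h(x₂), x₂) | h(x₂) ∈ x₂²Φ[x₂]}, and let A₀ be any fixed system of representatives (containing the identity) of the left cosets of Af₂(Φ) modulo H(Φ) = Af₂(Φ) ∩ Tr₂(Φ). Then every tame automorphism φ of Φ[x₁,x₂] can be written uniquely in the form φ = σ₁ ∘ τ₁ ∘ σ₂ ∘ τ₂ ∘ ⋯ ∘ σ_k ∘ τ_k ∘ λ, where σ_i ∈ A₀ with σ₂, …, σ_k ≠ id, τ_i ∈ B₀ with τ₁, …, τ_k ≠ id, and λ ∈ Af₂(Φ). -/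
open MvPolynomial

/-- `B₀ = {(x₁ + h(x₂), x₂) | h(x₂) ∈ x₂²Φ[x₂]}`, a system of representatives of the left
cosets of `Tr₂(Φ)` modulo `H(Φ)`. -/
def B₀ (Φ : Type*) [CommRing Φ] : Set (PolyAut Φ) :=
  {σ | ∃ h : MvPolynomial (Fin 2) Φ, h ∈ Algebra.adjoin Φ {(X 1 : MvPolynomial (Fin 2) Φ)} ∧
    σ (X 0) = X 0 + X 1 ^ 2 * h ∧ σ (X 1) = X 1}

/-- `A₀` is a system of representatives, containing the identity, of the left cosets of
`Af₂(Φ)` modulo `H(Φ) = Af₂(Φ) ∩ Tr₂(Φ)`. -/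
def IsAffineTransversal {Φ : Type*} [CommRing Φ] (A₀ : Set (PolyAut Φ)) : Prop :=
  (1 : PolyAut Φ) ∈ A₀ ∧ (∀ a ∈ A₀, IsAffine a) ∧
    ∀ g : PolyAut Φ, IsAffine g →
      ∃! a, a ∈ A₀ ∧ IsAffine (a⁻¹ * g) ∧ IsTriangular (a⁻¹ * g)

namespace PolyAut

section CommRing

variable {Φ : Type*} [CommRing Φ]

lemma inv_apply_apply (σ : PolyAut Φ) (x : MvPolynomial (Fin 2) Φ) : σ⁻¹ (σ x) = x := by
  rw [← AlgEquiv.mul_apply, inv_mul_cancel, AlgEquiv.one_apply]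

lemma apply_C_s3 (σ : PolyAut Φ) (a : Φ) : σ (C a) = C a := σ.commutes a

lemma ext_X {σ τ : PolyAut Φ} (h₀ : σ (X 0) = τ (X 0)) (h₁ : σ (X 1) = τ (X 1)) : σ = τ := by
  have h : (σ : MvPolynomial (Fin 2) Φ →ₐ[Φ] MvPolynomial (Fin 2) Φ) = τ :=
    MvPolynomial.algHom_ext fun i => by fin_cases i <;> assumption
  exact AlgEquiv.ext fun x => DFunLike.congr_fun h x

lemma mem_adjoin_X_iff {i : Fin 2} {h : MvPolynomial (Fin 2) Φ} :
    h ∈ Algebra.adjoin Φ {(X i : MvPolynomial (Fin 2) Φ)} ↔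
      ∃ p : Polynomial Φ, Polynomial.aeval (X i : MvPolynomial (Fin 2) Φ) p = h := by
  rw [Algebra.adjoin_singleton_eq_range_aeval, AlgHom.mem_range]

lemma apply_aeval (σ : PolyAut Φ) (x : MvPolynomial (Fin 2) Φ) (p : Polynomial Φ) :
    σ (Polynomial.aeval x p) = Polynomial.aeval (σ x) p :=
  (Polynomial.aeval_algHom_apply σ x p).symm

/-- If `σ` maps `X i` into the subalgebra generated by `X j`, it maps the whole subalgebra
generated by `X i` there. -/
lemma apply_mem_adjoin {σ : PolyAut Φ} {i j : Fin 2} {h : MvPolynomial (Fin 2) Φ}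
    (hi : σ (X i) ∈ Algebra.adjoin Φ {(X j : MvPolynomial (Fin 2) Φ)})
    (hh : h ∈ Algebra.adjoin Φ {(X i : MvPolynomial (Fin 2) Φ)}) :
    σ h ∈ Algebra.adjoin Φ {(X j : MvPolynomial (Fin 2) Φ)} := by
  obtain ⟨p, rfl⟩ := mem_adjoin_X_iff.1 hh
  rw [apply_aeval]
  obtain ⟨q, hq⟩ := mem_adjoin_X_iff.1 hi
  rw [← hq]
  exact mem_adjoin_X_iff.2 ⟨p.comp q, Polynomial.aeval_comp ..⟩

lemma C_mem_adjoin (a : Φ) (s : Set (MvPolynomial (Fin 2) Φ)) : C a ∈ Algebra.adjoin Φ s :=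
  Subalgebra.algebraMap_mem _ a

lemma X_mem_adjoin (i : Fin 2) :
    (X i : MvPolynomial (Fin 2) Φ) ∈ Algebra.adjoin Φ {(X i : MvPolynomial (Fin 2) Φ)} :=
  Algebra.subset_adjoin rfl

lemma isAffine_one : IsAffine (1 : PolyAut Φ) :=
  ⟨1, 0, 0, 0, 1, 0, by simp, by simp, by simp⟩

lemma isTriangular_one : IsTriangular (1 : PolyAut Φ) :=
  ⟨1, 1, 0, 0, zero_mem _, by simp, by simp⟩

end CommRing

end PolyAut

open PolyAut

section CommRing

variable {Φ : Type*} [CommRing Φ]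

lemma IsAffine.mul {σ τ : PolyAut Φ} (hσ : IsAffine σ) (hτ : IsAffine τ) : IsAffine (σ * τ) := by
  obtain ⟨a₁, b₁, c₁, a₂, b₂, c₂, hu, h₀, h₁⟩ := hσ
  obtain ⟨a₁', b₁', c₁', a₂', b₂', c₂', hu', h₀', h₁'⟩ := hτ
  refine ⟨a₁' * a₁ + b₁' * a₂, a₁' * b₁ + b₁' * b₂, a₁' * c₁ + b₁' * c₂ + c₁',
    a₂' * a₁ + b₂' * a₂, a₂' * b₁ + b₂' * b₂, a₂' * c₁ + b₂' * c₂ + c₂', ?_, ?_, ?_⟩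
  · convert hu.mul hu' using 1
    ring
  all_goals
    simp only [AlgEquiv.mul_apply, h₀', h₁', map_add, map_mul, apply_C_s3, h₀, h₁]
    ring

lemma IsAffine.inv {σ : PolyAut Φ} (hσ : IsAffine σ) : IsAffine σ⁻¹ := by
  obtain ⟨a₁, b₁, c₁, a₂, b₂, c₂, ⟨u, hu⟩, h₀, h₁⟩ := hσ
  set d : Φ := ((u⁻¹ : Φˣ) : Φ) with hd
  have hdu : d * (a₁ * b₂ - a₂ * b₁) = 1 := by rw [← hu, hd, Units.inv_mul]
  have hC : (C d * (C a₁ * C b₂ - C a₂ * C b₁) : MvPolynomial (Fin 2) Φ) = 1 := by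
    simp only [← C_mul, ← C_sub, hdu, C_1]
  have e₀ := inv_apply_apply σ (X 0)
  have e₁ := inv_apply_apply σ (X 1)
  simp only [h₀, h₁, map_add, map_mul, apply_C_s3] at e₀ e₁
  refine ⟨d * b₂, -(d * b₁), d * (b₁ * c₂ - b₂ * c₁), -(d * a₂), d * a₁,
    d * (a₂ * c₁ - a₁ * c₂), ?_, ?_, ?_⟩
  · refine IsUnit.of_mul_eq_one (a₁ * b₂ - a₂ * b₁) ?_
    linear_combination (d * (a₁ * b₂ - a₂ * b₁) + 1) * hdu
  · simp only [C_mul, C_sub, C_neg]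
    linear_combination C d * C b₂ * e₀ - C d * C b₁ * e₁ - σ⁻¹ (X 0) * hC
  · simp only [C_mul, C_sub, C_neg]
    linear_combination C d * C a₁ * e₁ - C d * C a₂ * e₀ - σ⁻¹ (X 1) * hC

lemma IsTriangular.mul {σ τ : PolyAut Φ} (hσ : IsTriangular σ) (hτ : IsTriangular τ) :
    IsTriangular (σ * τ) := by
  obtain ⟨a, b, c, h, hh, h₀, h₁⟩ := hσ
  obtain ⟨a', b', c', h', hh', h₀', h₁'⟩ := hτ
  have hX : σ (X 1) ∈ Algebra.adjoin Φ {(X 1 : MvPolynomial (Fin 2) Φ)} := by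
    rw [h₁]
    exact add_mem (mul_mem (C_mem_adjoin _ _) (X_mem_adjoin 1)) (C_mem_adjoin _ _)
  refine ⟨a' * a, b' * b, b' * c + c', C (a' : Φ) * h + σ h',
    add_mem (mul_mem (C_mem_adjoin _ _) hh) (apply_mem_adjoin hX hh'), ?_, ?_⟩
  all_goals
    simp only [AlgEquiv.mul_apply, h₀', h₁', map_add, map_mul, apply_C_s3, h₀, h₁, Units.val_mul]
    ring

lemma IsTriangular.inv {σ : PolyAut Φ} (hσ : IsTriangular σ) : IsTriangular σ⁻¹ := by
  obtain ⟨a, b, c, h, hh, h₀, h₁⟩ := hσ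
  have e₀ := inv_apply_apply σ (X 0)
  have e₁ := inv_apply_apply σ (X 1)
  simp only [h₀, h₁, map_add, map_mul, apply_C_s3] at e₀ e₁
  have ha : (C ((a⁻¹ : Φˣ) : Φ) * C (a : Φ) : MvPolynomial (Fin 2) Φ) = 1 := by
    rw [← C_mul, Units.inv_mul, C_1]
  have hb : (C ((b⁻¹ : Φˣ) : Φ) * C (b : Φ) : MvPolynomial (Fin 2) Φ) = 1 := by
    rw [← C_mul, Units.inv_mul, C_1]
  have hX₁ : σ⁻¹ (X 1) = C ((b⁻¹ : Φˣ) : Φ) * X 1 + C (-(((b⁻¹ : Φˣ) : Φ) * c)) := by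
    simp only [C_mul, C_neg]
    linear_combination C ((b⁻¹ : Φˣ) : Φ) * e₁ - σ⁻¹ (X 1) * hb
  have hX : σ⁻¹ (X 1) ∈ Algebra.adjoin Φ {(X 1 : MvPolynomial (Fin 2) Φ)} := by
    rw [hX₁]
    exact add_mem (mul_mem (C_mem_adjoin _ _) (X_mem_adjoin 1)) (C_mem_adjoin _ _)
  refine ⟨a⁻¹, b⁻¹, _, -(C ((a⁻¹ : Φˣ) : Φ) * σ⁻¹ h),
    neg_mem (mul_mem (C_mem_adjoin _ _) (apply_mem_adjoin hX hh)), ?_, hX₁⟩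
  linear_combination C ((a⁻¹ : Φˣ) : Φ) * e₀ - σ⁻¹ (X 0) * ha

namespace PolyAut

lemma B₀.isTriangular {σ : PolyAut Φ} (hσ : σ ∈ B₀ Φ) : IsTriangular σ := by
  obtain ⟨h, hh, h₀, h₁⟩ := hσ
  exact ⟨1, 1, 0, _, mul_mem (pow_mem (X_mem_adjoin 1) 2) hh, by simp [h₀], by simp [h₁]⟩

lemma B₀.mul {σ τ : PolyAut Φ} (hσ : σ ∈ B₀ Φ) (hτ : τ ∈ B₀ Φ) : σ * τ ∈ B₀ Φ := by
  obtain ⟨h, hh, h₀, h₁⟩ := hσ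
  obtain ⟨h', hh', h₀', h₁'⟩ := hτ
  refine ⟨h + σ h', add_mem hh (apply_mem_adjoin (by rw [h₁]; exact X_mem_adjoin 1) hh'), ?_, ?_⟩
  · simp only [AlgEquiv.mul_apply, h₀', map_add, map_mul, map_pow, h₀, h₁]
    ring
  · rw [AlgEquiv.mul_apply, h₁', h₁]

lemma B₀.inv {σ : PolyAut Φ} (hσ : σ ∈ B₀ Φ) : σ⁻¹ ∈ B₀ Φ := by
  obtain ⟨h, hh, h₀, h₁⟩ := hσ
  have e₀ := inv_apply_apply σ (X 0)
  have e₁ := inv_apply_apply σ (X 1)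
  rw [h₁] at e₁
  simp only [h₀, map_add, map_mul, map_pow, e₁] at e₀
  refine ⟨-σ⁻¹ h, neg_mem (apply_mem_adjoin (by rw [e₁]; exact X_mem_adjoin 1) hh), ?_, e₁⟩
  linear_combination e₀

/-- The automorphism `(x₁ + p(x₂), x₂)`. -/
noncomputable def shear (p : Polynomial Φ) : PolyAut Φ :=
  AlgEquiv.ofAlgHom (aeval ![X 0 + Polynomial.aeval (X 1) p, X 1])
    (aeval ![X 0 - Polynomial.aeval (X 1) p, X 1])
    (MvPolynomial.algHom_ext fun i => by
      fin_cases i <;> simp [← Polynomial.aeval_algHom_apply])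
    (MvPolynomial.algHom_ext fun i => by
      fin_cases i <;> simp [← Polynomial.aeval_algHom_apply])

lemma shear_X_zero (p : Polynomial Φ) :
    shear p (X 0) = X 0 + Polynomial.aeval (X 1 : MvPolynomial (Fin 2) Φ) p := by
  simp [shear]

lemma shear_X_one (p : Polynomial Φ) : shear p (X 1) = X 1 := by
  simp [shear]

lemma exists_eq_mul_of_isTriangular {σ : PolyAut Φ} (hσ : IsTriangular σ) :
    ∃ τ ∈ B₀ Φ, ∃ η : PolyAut Φ, IsAffine η ∧ IsTriangular η ∧ σ = τ * η := by
  obtain ⟨a, b, c, h, hh, h₀, h₁⟩ := id hσ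
  obtain ⟨p, rfl⟩ := mem_adjoin_X_iff.1 hh
  set q : Polynomial Φ := Polynomial.C ((a⁻¹ : Φˣ) : Φ) * p.divX.divX with hq
  set τ : PolyAut Φ := shear (Polynomial.X ^ 2 * q) with hτdef
  have hτ₀ : τ (X 0) = X 0 + X 1 ^ 2 * Polynomial.aeval (X 1) q := by
    rw [hτdef, shear_X_zero]
    simp
  have hτ₁ : τ (X 1) = X 1 := shear_X_one _
  have hτ : τ ∈ B₀ Φ := ⟨_, mem_adjoin_X_iff.2 ⟨q, rfl⟩, hτ₀, hτ₁⟩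
  have i₁ : τ⁻¹ (X 1) = X 1 := by
    rw [← hτ₁, inv_apply_apply, hτ₁]
  have i₀ : τ⁻¹ (X 0) = X 0 - X 1 ^ 2 * Polynomial.aeval (X 1) q := by
    have := inv_apply_apply τ (X 0)
    rw [hτ₀, map_add, map_mul, map_pow, apply_aeval, i₁] at this
    linear_combination this
  have ha : (C (a : Φ) * C ((a⁻¹ : Φˣ) : Φ) : MvPolynomial (Fin 2) Φ) = 1 := by
    rw [← C_mul, Units.mul_inv, C_1]
  refine ⟨τ, hτ, τ⁻¹ * σ, ?_, (B₀.isTriangular (B₀.inv hτ)).mul hσ, by group⟩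
  refine ⟨a, p.divX.coeff 0, p.coeff 0, 0, b, c, by simp, ?_, ?_⟩
  · have e : (Polynomial.aeval (X 1 : MvPolynomial (Fin 2) Φ) p) =
        (Polynomial.aeval (X 1) p.divX.divX * X 1 + C (p.divX.coeff 0)) * X 1 + C (p.coeff 0) := by
      conv_lhs => rw [← Polynomial.divX_mul_X_add p, ← Polynomial.divX_mul_X_add p.divX]
      simp [MvPolynomial.algebraMap_eq]
    have eq : (Polynomial.aeval (X 1 : MvPolynomial (Fin 2) Φ) q) =
        C ((a⁻¹ : Φˣ) : Φ) * Polynomial.aeval (X 1) p.divX.divX := by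
      simp [hq, MvPolynomial.algebraMap_eq]
    rw [AlgEquiv.mul_apply, h₀, map_add, map_mul, apply_C_s3, i₀, apply_aeval, i₁, e, eq]
    linear_combination -X 1 ^ 2 * Polynomial.aeval (X 1) p.divX.divX * ha
  · rw [AlgEquiv.mul_apply, h₁, map_add, map_mul, apply_C_s3, apply_C_s3, i₁]
    simp

/-- The automorphism exchanging the two variables. -/
noncomputable def swap (Φ : Type*) [CommRing Φ] : PolyAut Φ :=
  renameEquiv Φ (Equiv.swap 0 1)

lemma swap_X_zero : swap Φ (X 0) = X 1 := by simp [swap]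

lemma swap_X_one : swap Φ (X 1) = X 0 := by simp [swap]

lemma swap_mul_swap : swap Φ * swap Φ = 1 :=
  ext_X (by simp [swap_X_zero, swap_X_one]) (by simp [swap_X_zero, swap_X_one])

lemma isAffine_swap : IsAffine (swap Φ) :=
  ⟨0, 1, 0, 1, 0, 0, by simp, by simp [swap_X_zero], by simp [swap_X_one]⟩

lemma isTriangular_or_of_isElementary {σ : PolyAut Φ} (hσ : IsElementary σ) :
    IsTriangular σ ∨ IsTriangular (swap Φ * σ * swap Φ) := by
  rcases hσ with ⟨α, f, hf, h₀, h₁⟩ | ⟨β, g, hg, h₀, h₁⟩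
  · exact .inl ⟨α, 1, 0, f, hf, h₀, by simp [h₁]⟩
  · refine .inr ⟨β, 1, 0, swap Φ g, apply_mem_adjoin ?_ hg, ?_, ?_⟩
    · rw [swap_X_zero]
      exact X_mem_adjoin 1
    · simp [swap_X_zero, swap_X_one, h₁, apply_C_s3]
    · simp [swap_X_zero, swap_X_one, h₀]

/-- The conditions on the pairs `(σᵢ, τᵢ)` of a normal form. -/
def IsReduced (A₀ : Set (PolyAut Φ)) (w : List (PolyAut Φ × PolyAut Φ)) : Prop :=
  (∀ p ∈ w, p.1 ∈ A₀ ∧ p.2 ∈ B₀ Φ ∧ p.2 ≠ 1) ∧ ∀ p ∈ w.tail, p.1 ≠ 1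

/-- The product `σ₁τ₁⋯σ_kτ_k`. -/
noncomputable def wordProd (w : List (PolyAut Φ × PolyAut Φ)) : PolyAut Φ :=
  (w.map fun p => p.1 * p.2).prod

lemma wordProd_nil : wordProd ([] : List (PolyAut Φ × PolyAut Φ)) = 1 := rfl

lemma wordProd_cons (p : PolyAut Φ × PolyAut Φ) (w : List (PolyAut Φ × PolyAut Φ)) :
    wordProd (p :: w) = p.1 * p.2 * wordProd w := by
  simp [wordProd]

lemma isReduced_nil (A₀ : Set (PolyAut Φ)) : IsReduced A₀ [] := by
  simp [IsReduced]

lemma isReduced_cons_iff {A₀ : Set (PolyAut Φ)} {p : PolyAut Φ × PolyAut Φ}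
    {w : List (PolyAut Φ × PolyAut Φ)} :
    IsReduced A₀ (p :: w) ↔ (p.1 ∈ A₀ ∧ p.2 ∈ B₀ Φ ∧ p.2 ≠ 1) ∧ IsReduced A₀ w ∧
      ∀ q ∈ w, q.1 ≠ 1 := by
  simp only [IsReduced, List.forall_mem_cons, List.tail_cons]
  exact ⟨fun h => ⟨h.1.1, ⟨h.1.2, fun q hq => h.2 q (List.mem_of_mem_tail hq)⟩, h.2⟩,
    fun h => ⟨⟨h.1, h.2.1.1⟩, h.2.2⟩⟩

lemma eq_one_of_isTriangular {A₀ : Set (PolyAut Φ)} (hA₀ : IsAffineTransversal A₀)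
    {σ : PolyAut Φ} (hσ : σ ∈ A₀) (ht : IsTriangular σ) : σ = 1 := by
  have ha := hA₀.2.1 σ hσ
  refine (hA₀.2.2 σ ha).unique ⟨hσ, ?_⟩ ⟨hA₀.1, ?_⟩
  · simpa using ⟨isAffine_one, isTriangular_one⟩
  · simpa using ⟨ha, ht⟩

lemma totalDegree_C_mul_le (a : Φ) (f : MvPolynomial (Fin 2) Φ) :
    (C a * f).totalDegree ≤ f.totalDegree :=
  (totalDegree_mul _ _).trans (by simp)

lemma totalDegree_linear_le (a b c : Φ) (f g : MvPolynomial (Fin 2) Φ) :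
    (C a * f + C b * g + C c).totalDegree ≤ max f.totalDegree g.totalDegree := by
  refine (totalDegree_add _ _).trans (max_le ((totalDegree_add _ _).trans ?_) (by simp))
  exact max_le_max (totalDegree_C_mul_le _ _) (totalDegree_C_mul_le _ _)

/-- An automorphism is decomposable if it admits a decomposition in normal form. -/
def IsDecomposable (A₀ : Set (PolyAut Φ)) (φ : PolyAut Φ) : Prop :=
  ∃ w l, IsReduced A₀ w ∧ IsAffine l ∧ φ = wordProd w * l

lemma IsDecomposable.B₀_mul {A₀ : Set (PolyAut Φ)} (hA₀ : IsAffineTransversal A₀)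
    {τ φ : PolyAut Φ} (hφ : IsDecomposable A₀ φ) (hτ : τ ∈ B₀ Φ) : IsDecomposable A₀ (τ * φ) := by
  obtain ⟨w, l, hw, hl, rfl⟩ := hφ
  by_cases h1 : τ = 1
  · exact ⟨w, l, hw, hl, by rw [h1, one_mul]⟩
  by_cases hw1 : ∀ p ∈ w, p.1 ≠ 1
  · exact ⟨(1, τ) :: w, l, isReduced_cons_iff.2 ⟨⟨hA₀.1, hτ, h1⟩, hw, hw1⟩, hl,
      by rw [wordProd_cons, one_mul, mul_assoc]⟩
  cases w with
  | nil => simp at hw1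
  | cons p w =>
    obtain ⟨σ, τ'⟩ := p
    obtain ⟨⟨-, hτ', -⟩, hw', hw1'⟩ := isReduced_cons_iff.1 hw
    obtain rfl : σ = 1 := by
      by_contra hσ
      exact hw1 (List.forall_mem_cons.2 ⟨hσ, hw1'⟩)
    by_cases h2 : τ * τ' = 1
    · exact ⟨w, l, hw', hl, by rw [wordProd_cons, one_mul, ← mul_assoc, ← mul_assoc, h2, one_mul]⟩
    · exact ⟨(1, τ * τ') :: w, l, isReduced_cons_iff.2 ⟨⟨hA₀.1, B₀.mul hτ hτ', h2⟩, hw', hw1'⟩, hl,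
        by simp only [wordProd_cons, one_mul, mul_assoc]⟩

end PolyAut

end CommRing

namespace PolyAut

section IsDomain

variable {Φ : Type*} [CommRing Φ] [IsDomain Φ]

lemma totalDegree_apply_X_pos (σ : PolyAut Φ) (i : Fin 2) : 0 < (σ (X i)).totalDegree := by
  refine Nat.pos_of_ne_zero fun h => ?_
  rw [totalDegree_eq_zero_iff_eq_C, ← apply_C_s3 σ, σ.injective.eq_iff] at h
  have := congrArg totalDegree h
  simp at this

lemma totalDegree_C_mul {a : Φ} (ha : a ≠ 0) (f : MvPolynomial (Fin 2) Φ) :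
    (C a * f).totalDegree = f.totalDegree := by
  rcases eq_or_ne f 0 with rfl | hf
  · simp
  · rw [totalDegree_mul_of_isDomain (by simpa using ha) hf]
    simp

lemma totalDegree_linear {a : Φ} (ha : a ≠ 0) (b c : Φ) {f g : MvPolynomial (Fin 2) Φ}
    (h : g.totalDegree < f.totalDegree) :
    (C a * f + C b * g + C c).totalDegree = f.totalDegree := by
  have hb := totalDegree_C_mul_le b g
  have h₁ : (C a * f + C b * g).totalDegree = f.totalDegree := by
    rw [totalDegree_add_eq_left_of_totalDegree_lt, totalDegree_C_mul ha]
    rw [totalDegree_C_mul ha]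
    lia
  rw [totalDegree_add_eq_left_of_totalDegree_lt, h₁]
  rw [h₁, totalDegree_C]
  lia

lemma totalDegree_of_isAffine {σ : PolyAut Φ} (hσ : IsAffine σ) (i : Fin 2) :
    (σ (X i)).totalDegree = 1 := by
  refine le_antisymm ?_ (totalDegree_apply_X_pos σ i)
  obtain ⟨a₁, b₁, c₁, a₂, b₂, c₂, -, h₀, h₁⟩ := hσ
  fin_cases i
  · simpa [h₀] using totalDegree_linear_le a₁ b₁ c₁ (X 0) (X 1)
  · simpa [h₁] using totalDegree_linear_le a₂ b₂ c₂ (X 0) (X 1)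

lemma not_isAffine_of_totalDegree_lt {σ : PolyAut Φ}
    (h : (σ (X 1)).totalDegree < (σ (X 0)).totalDegree) : ¬ IsAffine σ := fun hσ => by
  simp [totalDegree_of_isAffine hσ] at h

/-- Right multiplication by a nontrivial element of `B₀` makes the first component dominate. -/
lemma totalDegree_lt_mul_B₀ {σ τ : PolyAut Φ}
    (hσ : (σ (X 0)).totalDegree ≤ (σ (X 1)).totalDegree) (hτ : τ ∈ B₀ Φ) (h1 : τ ≠ 1) :
    ((σ * τ) (X 1)).totalDegree < ((σ * τ) (X 0)).totalDegree := by
  obtain ⟨h, -, h₀, h₁⟩ := hτ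
  have hh : h ≠ 0 := by
    rintro rfl
    exact h1 (ext_X (by simp [h₀]) (by simp [h₁]))
  have hX : σ (X 1) ≠ 0 := by simp
  have hσh : σ h ≠ 0 := by simpa using hh
  have hpos := totalDegree_apply_X_pos σ 1
  have hd : (σ (X 1) ^ 2 * σ h).totalDegree =
      (σ (X 1)).totalDegree + (σ (X 1)).totalDegree + (σ h).totalDegree := by
    rw [totalDegree_mul_of_isDomain (pow_ne_zero 2 hX) hσh, sq, totalDegree_mul_of_isDomain hX hX]
  simp only [AlgEquiv.mul_apply, h₀, h₁, map_add, map_mul, map_pow]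
  rw [totalDegree_add_eq_right_of_totalDegree_lt] <;> lia

/-- Right multiplication by a non-triangular affine automorphism makes the second component
at least as large as the first. -/
lemma totalDegree_le_mul_affine {σ τ : PolyAut Φ}
    (hσ : (σ (X 1)).totalDegree < (σ (X 0)).totalDegree) (hτ : IsAffine τ)
    (ht : ¬ IsTriangular τ) :
    ((σ * τ) (X 0)).totalDegree ≤ ((σ * τ) (X 1)).totalDegree := by
  obtain ⟨a₁, b₁, c₁, a₂, b₂, c₂, hu, h₀, h₁⟩ := hτ
  have ha : a₂ ≠ 0 := by
    rintro rfl
    rw [zero_mul, sub_zero, IsUnit.mul_iff] at hu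
    refine ht ⟨hu.1.unit, hu.2.unit, c₂, C b₁ * X 1 + C c₁,
      add_mem (mul_mem (C_mem_adjoin _ _) (X_mem_adjoin 1)) (C_mem_adjoin _ _), ?_, ?_⟩
    · simp [h₀, add_assoc]
    · simp [h₁]
  simp only [AlgEquiv.mul_apply, h₀, h₁, map_add, map_mul, apply_C_s3]
  rw [totalDegree_linear ha _ _ hσ]
  exact (totalDegree_linear_le _ _ _ _ _).trans (max_le le_rfl hσ.le)

lemma eq_one_of_isAffine {τ : PolyAut Φ} (hτ : τ ∈ B₀ Φ) (ha : IsAffine τ) : τ = 1 := by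
  by_contra h
  have := totalDegree_lt_mul_B₀ (σ := 1) (by simp) hτ h
  rw [one_mul] at this
  exact not_isAffine_of_totalDegree_lt this ha

variable {A₀ : Set (PolyAut Φ)}

lemma totalDegree_lt_mul_wordProd (hA₀ : IsAffineTransversal A₀)
    {w : List (PolyAut Φ × PolyAut Φ)} (hw : IsReduced A₀ w) (hw1 : ∀ p ∈ w, p.1 ≠ 1)
    {σ : PolyAut Φ} (hσ : (σ (X 1)).totalDegree < (σ (X 0)).totalDegree) :
    ((σ * wordProd w) (X 1)).totalDegree < ((σ * wordProd w) (X 0)).totalDegree := by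
  induction w generalizing σ with
  | nil => simpa [wordProd_nil] using hσ
  | cons p w ih =>
    obtain ⟨⟨h1, h2, h3⟩, hw', hw1'⟩ := isReduced_cons_iff.1 hw
    have hp : ¬ IsTriangular p.1 := fun h =>
      hw1 p List.mem_cons_self (eq_one_of_isTriangular hA₀ h1 h)
    rw [wordProd_cons, ← mul_assoc, ← mul_assoc]
    exact ih hw' hw1' (totalDegree_lt_mul_B₀
      (totalDegree_le_mul_affine hσ (hA₀.2.1 _ h1) hp) h2 h3)

lemma totalDegree_inv_le (hA₀ : IsAffineTransversal A₀)
    {w : List (PolyAut Φ × PolyAut Φ)} (hw : IsReduced A₀ w) (hw1 : ∀ p ∈ w, p.1 ≠ 1)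
    {l : PolyAut Φ} (hl : IsAffine l) :
    ((wordProd w * l)⁻¹ (X 0)).totalDegree ≤ ((wordProd w * l)⁻¹ (X 1)).totalDegree := by
  induction w with
  | nil =>
    rw [wordProd_nil, one_mul, totalDegree_of_isAffine hl.inv, totalDegree_of_isAffine hl.inv]
  | cons p w ih =>
    obtain ⟨⟨h1, h2, h3⟩, hw', hw1'⟩ := isReduced_cons_iff.1 hw
    have hp : ¬ IsTriangular p.1⁻¹ := fun h =>
      hw1 p List.mem_cons_self (eq_one_of_isTriangular hA₀ h1 (by simpa using h.inv))
    have e : (wordProd (p :: w) * l)⁻¹ = (wordProd w * l)⁻¹ * p.2⁻¹ * p.1⁻¹ := by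
      rw [wordProd_cons]
      group
    rw [e]
    exact totalDegree_le_mul_affine (totalDegree_lt_mul_B₀ (ih hw' hw1') (B₀.inv h2)
      (inv_ne_one.2 h3)) (hA₀.2.1 _ h1).inv hp

lemma not_isAffine_wordProd_mul (hA₀ : IsAffineTransversal A₀)
    {p : PolyAut Φ × PolyAut Φ} {w : List (PolyAut Φ × PolyAut Φ)} (hw : IsReduced A₀ (p :: w))
    {l : PolyAut Φ} (hl : IsAffine l) : ¬ IsAffine (wordProd (p :: w) * l) := fun h => by
  obtain ⟨⟨h1, h2, h3⟩, hw', hw1'⟩ := isReduced_cons_iff.1 hw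
  have hp := hA₀.2.1 _ h1
  refine not_isAffine_of_totalDegree_lt (totalDegree_lt_mul_wordProd hA₀ hw' hw1'
    (totalDegree_lt_mul_B₀ (σ := p.1) ?_ h2 h3)) ?_
  · simp [totalDegree_of_isAffine hp]
  · rw [← wordProd_cons]
    simpa [mul_assoc] using h.mul hl.inv

lemma wordProd_mul_injective (hA₀ : IsAffineTransversal A₀)
    {w w' : List (PolyAut Φ × PolyAut Φ)} (hw : IsReduced A₀ w) (hw' : IsReduced A₀ w')
    {l l' : PolyAut Φ} (hl : IsAffine l) (hl' : IsAffine l')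
    (h : wordProd w * l = wordProd w' * l') : w = w' ∧ l = l' := by
  induction w generalizing w' with
  | nil =>
    cases w' with
    | nil => exact ⟨rfl, by simpa [wordProd_nil] using h⟩
    | cons p' w' =>
      refine absurd ?_ (not_isAffine_wordProd_mul hA₀ hw' hl')
      rwa [← h, wordProd_nil, one_mul]
  | cons p w ih =>
    cases w' with
    | nil =>
      refine absurd ?_ (not_isAffine_wordProd_mul hA₀ hw hl)
      rwa [h, wordProd_nil, one_mul]
    | cons p' w' =>
      obtain ⟨σ, τ⟩ := p
      obtain ⟨σ', τ'⟩ := p'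
      replace ⟨⟨h1, h2, h3⟩, hw, hw1⟩ := isReduced_cons_iff.1 hw
      replace ⟨⟨h1', h2', h3'⟩, hw', hw1'⟩ := isReduced_cons_iff.1 hw'
      dsimp only at h1 h2 h3 h1' h2' h3'
      have key : ∀ δ : PolyAut Φ, (δ (X 1)).totalDegree < (δ (X 0)).totalDegree →
          δ * wordProd w * l ≠ 1 := fun δ hδ hδ1 => by
        refine not_isAffine_of_totalDegree_lt (totalDegree_lt_mul_wordProd hA₀ hw hw1 hδ) ?_
        rw [eq_inv_of_mul_eq_one_left hδ1]
        exact hl.inv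
      have hR := totalDegree_inv_le hA₀ hw' hw1' hl'
      simp only [wordProd_cons] at h
      have haff : IsAffine (σ'⁻¹ * σ) := (hA₀.2.1 _ h1').inv.mul (hA₀.2.1 _ h1)
      have hσ : σ' = σ := by
        by_cases ht : IsTriangular (σ'⁻¹ * σ)
        · refine (hA₀.2.2 σ (hA₀.2.1 _ h1)).unique ⟨h1', haff, ht⟩ ⟨h1, ?_⟩
          rw [inv_mul_cancel]
          exact ⟨isAffine_one, isTriangular_one⟩
        · refine absurd ?_ (key _ (totalDegree_lt_mul_B₀ (totalDegree_le_mul_affine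
            (totalDegree_lt_mul_B₀ hR (B₀.inv h2') (inv_ne_one.2 h3')) haff ht) h2 h3))
          calc (wordProd w' * l')⁻¹ * τ'⁻¹ * (σ'⁻¹ * σ) * τ * wordProd w * l
              = (σ' * τ' * wordProd w' * l')⁻¹ * (σ * τ * wordProd w * l) := by group
            _ = 1 := by rw [h, inv_mul_cancel]
      subst hσ
      have hτ : τ' = τ := by
        by_contra hne
        refine absurd ?_ (key _ (totalDegree_lt_mul_B₀ hR (B₀.mul (B₀.inv h2') h2)
          fun e => hne (inv_mul_eq_one.1 e)))
        calc (wordProd w' * l')⁻¹ * (τ'⁻¹ * τ) * wordProd w * l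
            = (σ' * τ' * wordProd w' * l')⁻¹ * (σ' * τ * wordProd w * l) := by group
          _ = 1 := by rw [h, inv_mul_cancel]
      subst hτ
      obtain ⟨rfl, rfl⟩ := ih hw hw' (by simpa only [mul_assoc, mul_right_inj] using h)
      exact ⟨rfl, rfl⟩

/-- An affine automorphism can be moved to the right through a reduced word. -/
lemma exists_affine_mul_wordProd (hA₀ : IsAffineTransversal A₀)
    {w : List (PolyAut Φ × PolyAut Φ)} (hw : IsReduced A₀ w)
    {a : PolyAut Φ} (ha : IsAffine a) :
    ∃ w' l, IsReduced A₀ w' ∧ IsAffine l ∧ a * wordProd w = wordProd w' * l ∧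
      (IsTriangular a → (∀ p ∈ w, p.1 ≠ 1) → ∀ p ∈ w', p.1 ≠ 1) := by
  induction w generalizing a with
  | nil => exact ⟨[], a, isReduced_nil _, ha, by simp [wordProd_nil], by simp⟩
  | cons p w ih =>
    obtain ⟨σ, τ⟩ := p
    obtain ⟨⟨h1, h2, h3⟩, hw, hw1⟩ := isReduced_cons_iff.1 hw
    dsimp only at h1 h2 h3
    obtain ⟨σ', ⟨hσ', hη, hηt⟩, -⟩ := hA₀.2.2 _ (ha.mul (hA₀.2.1 _ h1))
    obtain ⟨τ', hτ', η', hη', hηt', e⟩ :=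
      exists_eq_mul_of_isTriangular (hηt.mul (B₀.isTriangular h2))
    obtain ⟨w', l, hw', hl, e', hw1'⟩ := ih hw hη'
    refine ⟨(σ', τ') :: w', l, isReduced_cons_iff.2 ⟨⟨hσ', hτ', ?_⟩, hw', hw1' hηt' hw1⟩, hl,
      ?_, ?_⟩
    · rintro rfl
      refine h3 (eq_one_of_isAffine h2 ?_)
      rw [one_mul] at e
      rw [eq_inv_mul_of_mul_eq e]
      exact hη.inv.mul hη'
    · calc a * wordProd ((σ, τ) :: w) = σ' * (σ'⁻¹ * (a * σ) * τ) * wordProd w := by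
            rw [wordProd_cons]
            group
        _ = σ' * τ' * (η' * wordProd w) := by
            rw [e]
            group
        _ = wordProd ((σ', τ') :: w') * l := by
            rw [e', wordProd_cons]
            group
    · intro hat hne
      refine List.forall_mem_cons.2 ⟨?_, hw1' hηt' hw1⟩
      rintro rfl
      refine hne _ List.mem_cons_self (eq_one_of_isTriangular hA₀ h1 ?_)
      simpa using hat.inv.mul hηt

lemma IsDecomposable.affine_mul (hA₀ : IsAffineTransversal A₀) {a φ : PolyAut Φ}
    (hφ : IsDecomposable A₀ φ) (ha : IsAffine a) : IsDecomposable A₀ (a * φ) := by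
  obtain ⟨w, l, hw, hl, rfl⟩ := hφ
  obtain ⟨w', l', hw', hl', e, -⟩ := exists_affine_mul_wordProd hA₀ hw ha
  exact ⟨w', l' * l, hw', hl'.mul hl, by rw [← mul_assoc, e, mul_assoc]⟩

lemma IsDecomposable.triangular_mul (hA₀ : IsAffineTransversal A₀) {t φ : PolyAut Φ}
    (hφ : IsDecomposable A₀ φ) (ht : IsTriangular t) : IsDecomposable A₀ (t * φ) := by
  obtain ⟨τ, hτ, η, hη, -, rfl⟩ := exists_eq_mul_of_isTriangular ht
  rw [mul_assoc]
  exact (hφ.affine_mul hA₀ hη).B₀_mul hA₀ hτ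

lemma IsDecomposable.of_conj_swap (hA₀ : IsAffineTransversal A₀) {t φ : PolyAut Φ}
    (hφ : IsDecomposable A₀ φ) (ht : IsTriangular (swap Φ * t * swap Φ)) :
    IsDecomposable A₀ (t * φ) := by
  have e : t * φ = swap Φ * (swap Φ * t * swap Φ * (swap Φ * φ)) := by
    calc t * φ = (swap Φ * swap Φ) * t * (swap Φ * swap Φ) * φ := by
          rw [swap_mul_swap, one_mul, mul_one]
      _ = _ := by simp only [mul_assoc]
  rw [e]
  exact ((hφ.affine_mul hA₀ isAffine_swap).triangular_mul hA₀ ht).affine_mul hA₀ isAffine_swap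

lemma isDecomposable_of_mem_tameSubgroup (hA₀ : IsAffineTransversal A₀) {φ : PolyAut Φ}
    (hφ : φ ∈ TameSubgroup Φ) : IsDecomposable A₀ φ := by
  induction hφ using Subgroup.closure_induction_left with
  | one => exact ⟨[], 1, isReduced_nil _, isAffine_one, by rw [wordProd_nil, one_mul]⟩
  | mul_left σ hσ φ _ ih =>
    rcases isTriangular_or_of_isElementary hσ with ht | ht
    · exact ih.triangular_mul hA₀ ht
    · exact ih.of_conj_swap hA₀ ht
  | inv_mul_cancel σ hσ φ _ ih =>
    rcases isTriangular_or_of_isElementary hσ with ht | ht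
    · exact ih.triangular_mul hA₀ ht.inv
    · refine ih.of_conj_swap hA₀ ?_
      have e := ht.inv
      rwa [mul_inv_rev, mul_inv_rev, inv_eq_of_mul_eq_one_left swap_mul_swap, ← mul_assoc] at e

end IsDomain

end PolyAut

/-- Every tame automorphism of `Φ[x₁,x₂]` over an integral domain `Φ` has a unique
decomposition `φ = σ₁ ∘ τ₁ ∘ σ₂ ∘ τ₂ ∘ ⋯ ∘ σ_k ∘ τ_k ∘ λ` with `σᵢ ∈ A₀`,
`σ₂, …, σ_k ≠ id`, `τᵢ ∈ B₀`, `τ₁, …, τ_k ≠ id` and `λ` affine. -/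
theorem tame_automorphism_unique_decomposition
    (Φ : Type*) [CommRing Φ] [IsDomain Φ]
    (A₀ : Set (PolyAut Φ)) (hA₀ : IsAffineTransversal A₀)
    (φ : PolyAut Φ) (hφ : φ ∈ TameSubgroup Φ) :
    ∃! d : List (PolyAut Φ × PolyAut Φ) × PolyAut Φ,
      (∀ p ∈ d.1, p.1 ∈ A₀ ∧ p.2 ∈ B₀ Φ ∧ p.2 ≠ 1) ∧
      (∀ p ∈ d.1.tail, p.1 ≠ 1) ∧
      IsAffine d.2 ∧
      φ = (d.1.map fun p => p.1 * p.2).prod * d.2 := by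
  obtain ⟨w, l, hw, hl, e⟩ := isDecomposable_of_mem_tameSubgroup hA₀ hφ
  refine ⟨(w, l), ⟨hw.1, hw.2, hl, e⟩, ?_⟩
  rintro ⟨w', l'⟩ ⟨h1, h2, hl', e'⟩
  obtain ⟨rfl, rfl⟩ := wordProd_mul_injective hA₀ hw ⟨h1, h2⟩ hl hl' (e.symm.trans e')
  rfl
end
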